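/- Assume conditions (★) and in addition that m(m + max_{1≤j≤m}|d_j − d̄|) = o(An) and x_{m+1} = ⋯ = x_n = 0. Then the probability that a uniformly random graph with degree sequence d has X^{[m]} as an induced subgraph is λ^X (1−λ)^{binom(m,2)−X} · exp( ω_{1,1}/(2An) − ω_{0,2}/(4An) + o(1) ) as n → ∞. -/

import Mathlib

open Filter Finset Asymptotics MeasureTheory
open scoped Classical Topology

noncomputable section

/-- The number of simple graphs on `Fin n` with degree sequence `d` having
no edge in common with the graph `X`. -/
def gCount {n : ℕ} (d : Fin n → ℕ) (X : SimpleGraph (Fin n)) : ℕ :=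
  Nat.card {H : SimpleGraph (Fin n) //
    (∀ v, Nat.card (H.neighborSet v) = d v) ∧ Disjoint H.edgeSet X.edgeSet}

/-- The degree `x_j` of vertex `j` in the graph `X`. -/
def xDeg {n : ℕ} (X : SimpleGraph (Fin n)) (j : Fin n) : ℕ :=
  Nat.card (X.neighborSet j)

/-- The number of edges of `X`. -/
def xEdges {n : ℕ} (X : SimpleGraph (Fin n)) : ℕ := Nat.card X.edgeSet

/-- The average degree `d̄ = 2E/n`. -/
def dBar {n : ℕ} (d : Fin n → ℕ) : ℝ := (∑ j, (d j : ℝ)) / n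

/-- The density `λ = d̄/(n-1)`. -/
def lamb {n : ℕ} (d : Fin n → ℕ) : ℝ := dBar d / ((n : ℝ) - 1)

/-- `A = λ(1-λ)/2`. -/
def aPar {n : ℕ} (d : Fin n → ℕ) : ℝ := lamb d * (1 - lamb d) / 2

/-- `δ_j = d_j - d̄ + λ x_j`. -/
def deltaPar {n : ℕ} (d : Fin n → ℕ) (X : SimpleGraph (Fin n)) (j : Fin n) : ℝ :=
  (d j : ℝ) - dBar d + lamb d * (xDeg X j : ℝ)

/-- The sum over unordered pairs `{j,k}` with `X.Adj j k` of `f j * f k`. -/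
def pairSum {n : ℕ} (X : SimpleGraph (Fin n)) (f : Fin n → ℝ) : ℝ :=
  (∑ j, ∑ k, if X.Adj j k then f j * f k else 0) / 2

/-- `R = Σ_j (d_j - d̄)²`. -/
def rPar {n : ℕ} (d : Fin n → ℕ) : ℝ := ∑ j, ((d j : ℝ) - dBar d)^2

/-- The naive estimate `Ĝ(d,X)`. -/
def gHat {n : ℕ} (d : Fin n → ℕ) (X : SimpleGraph (Fin n)) : ℝ :=
  (1 - lamb d) ^ (-(xEdges X : ℝ)) *
  (lamb d ^ lamb d * (1 - lamb d) ^ (1 - lamb d)) ^ n.choose 2 *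
  ∏ j, ((n - 1 - xDeg X j).choose (d j) : ℝ)

/-- The number of graphs with degree sequence `d` whose induced subgraph on the
first `m` vertices equals that of `X`. -/
def gInd {n : ℕ} (d : Fin n → ℕ) (X : SimpleGraph (Fin n)) (m : ℕ) : ℕ :=
  Nat.card {H : SimpleGraph (Fin n) //
    (∀ v, Nat.card (H.neighborSet v) = d v) ∧
    ∀ j k : Fin n, (j : ℕ) < m → (k : ℕ) < m → (H.Adj j k ↔ X.Adj j k)}

/-- `ω_{k,ℓ} = Σ_{j=1}^m (d_j - d̄)^k (x_j - λ(m-1))^ℓ`. -/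
def omegaPar {n : ℕ} (d : Fin n → ℕ) (X : SimpleGraph (Fin n)) (m k ℓ : ℕ) : ℝ :=
  ∑ j : Fin n, if (j : ℕ) < m then
    ((d j : ℝ) - dBar d)^k * ((xDeg X j : ℝ) - lamb d * ((m : ℝ) - 1))^ℓ else 0

section Switching

set_option linter.unusedSectionVars false

variable {V : Type*} [DecidableEq V]

/-- The `0`-`1` indicator of adjacency. -/
def adjInd (H : SimpleGraph V) (v w : V) : ℝ := if H.Adj v w then 1 else 0

theorem adjInd_comm (H : SimpleGraph V) (v w : V) : adjInd H v w = adjInd H w v := by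
  simp [adjInd, H.adj_comm]

theorem adjInd_self (H : SimpleGraph V) (v : V) : adjInd H v v = 0 := by
  simp [adjInd]

theorem adjInd_eq_zero_or_one (H : SimpleGraph V) (v w : V) :
    adjInd H v w = 0 ∨ adjInd H v w = 1 := by
  unfold adjInd; split_ifs <;> simp

theorem adjInd_nonneg (H : SimpleGraph V) (v w : V) : 0 ≤ adjInd H v w := by
  rcases adjInd_eq_zero_or_one H v w with h | h <;> simp [h]

theorem adjInd_le_one (H : SimpleGraph V) (v w : V) : adjInd H v w ≤ 1 := by
  rcases adjInd_eq_zero_or_one H v w with h | h <;> simp [h]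

/-- The graph obtained from `H` by complementing the pairs of the four-cycle `v w v' u`. -/
def toggle (H : SimpleGraph V) (v v' w u : V) : SimpleGraph V where
  Adj x y := x ≠ y ∧ Xor (H.Adj x y)
    (((x = v ∨ x = v') ∧ (y = w ∨ y = u)) ∨ ((x = w ∨ x = u) ∧ (y = v ∨ y = v')))
  symm := ⟨by
    rintro x y ⟨hxy, h⟩
    refine ⟨hxy.symm, ?_⟩
    rw [H.adj_comm]
    have : (((y = v ∨ y = v') ∧ (x = w ∨ x = u)) ∨ ((y = w ∨ y = u) ∧ (x = v ∨ x = v'))) ↔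
      (((x = v ∨ x = v') ∧ (y = w ∨ y = u)) ∨ ((x = w ∨ x = u) ∧ (y = v ∨ y = v'))) := by tauto
    rwa [this]⟩
  loopless := ⟨fun x h => h.1 rfl⟩

theorem toggle_toggle (H : SimpleGraph V) (v v' w u : V) :
    toggle (toggle H v v' w u) v v' w u = H := by
  ext x y
  simp only [toggle, Xor]
  have : H.Adj x y → x ≠ y := fun h => h.ne
  tauto

theorem toggle_swap (H : SimpleGraph V) (v v' w u : V) :
    toggle H v' v w u = toggle H v v' w u := by
  ext x y
  simp only [toggle, Xor, or_comm (a := x = v'), or_comm (a := y = v')]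

theorem adjInd_toggle_of_not (H : SimpleGraph V) {v v' w u x y : V}
    (h : ¬ (((x = v ∨ x = v') ∧ (y = w ∨ y = u)) ∨ ((x = w ∨ x = u) ∧ (y = v ∨ y = v')))) :
    adjInd (toggle H v v' w u) x y = adjInd H x y := by
  have : (toggle H v v' w u).Adj x y ↔ H.Adj x y := by
    simp only [toggle, Xor]
    have : H.Adj x y → x ≠ y := fun h => h.ne
    tauto
  simp [adjInd, this]

theorem adjInd_toggle_of (H : SimpleGraph V) {v v' w u x y : V} (hxy : x ≠ y)
    (h : (((x = v ∨ x = v') ∧ (y = w ∨ y = u)) ∨ ((x = w ∨ x = u) ∧ (y = v ∨ y = v')))) :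
    adjInd (toggle H v v' w u) x y = 1 - adjInd H x y := by
  have : (toggle H v v' w u).Adj x y ↔ ¬ H.Adj x y := by
    simp only [toggle, Xor]
    tauto
  by_cases h2 : H.Adj x y <;> simp [adjInd, this, h2]

/-- A family of graphs is switching-closed on `U` with degrees `d` when it is stable under
switchings of alternating four-cycles inside `U` and every member has degree `d v` into `U`
at every `v ∈ U`. -/
structure SwitchFamily (U : Finset V) (d : V → ℝ) (Ω : Finset (SimpleGraph V)) : Prop where
  closed : ∀ H ∈ Ω, ∀ v ∈ U, ∀ v' ∈ U, ∀ w ∈ U, ∀ u ∈ U, v ≠ v' → w ≠ u → v ≠ w → v ≠ u →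
    v' ≠ w → v' ≠ u → H.Adj v w → ¬ H.Adj v' w → ¬ H.Adj v u → H.Adj v' u →
    toggle H v v' w u ∈ Ω
  deg : ∀ H ∈ Ω, ∀ v ∈ U, ∑ w ∈ U, adjInd H v w = d v

variable {U : Finset V} {d : V → ℝ} {Ω : Finset (SimpleGraph V)}

/-- The indicator that `w` is adjacent to `v` and not to `v'`. -/
def exclInd (H : SimpleGraph V) (v v' w : V) : ℝ := adjInd H v w * (1 - adjInd H v' w)

theorem exclInd_eq_zero_or_one (H : SimpleGraph V) (v v' w : V) :
    exclInd H v v' w = 0 ∨ exclInd H v v' w = 1 := by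
  unfold exclInd
  rcases adjInd_eq_zero_or_one H v w with h | h <;>
    rcases adjInd_eq_zero_or_one H v' w with h' | h' <;> simp [h, h']

theorem exclInd_nonneg (H : SimpleGraph V) (v v' w : V) : 0 ≤ exclInd H v v' w := by
  rcases exclInd_eq_zero_or_one H v v' w with h | h <;> simp [h]

theorem exclInd_le_one (H : SimpleGraph V) (v v' w : V) : exclInd H v v' w ≤ 1 := by
  rcases exclInd_eq_zero_or_one H v v' w with h | h <;> simp [h]

theorem exclInd_ne_zero {H : SimpleGraph V} {v v' w : V} (h : exclInd H v v' w ≠ 0) :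
    H.Adj v w ∧ ¬ H.Adj v' w := by
  unfold exclInd adjInd at h
  by_cases h1 : H.Adj v w <;> by_cases h2 : H.Adj v' w <;> simp_all

theorem exclInd_toggle (H : SimpleGraph V) {v v' w u : V} (hvw : v ≠ w) (hvw' : v' ≠ w) :
    exclInd (toggle H v v' w u) v' v w = exclInd H v v' w := by
  unfold exclInd
  rw [adjInd_toggle_of H hvw (by tauto), adjInd_toggle_of H hvw' (by tauto)]
  ring

theorem exclInd_toggle' (H : SimpleGraph V) {v v' w u : V} (hvw : v ≠ u) (hvw' : v' ≠ u) :
    exclInd (toggle H v v' w u) v v' u = exclInd H v' v u := by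
  unfold exclInd
  rw [adjInd_toggle_of H hvw (by tauto), adjInd_toggle_of H hvw' (by tauto)]
  ring

/-- The basic switching bijection. -/
theorem SwitchFamily.sum_switch (hΩ : SwitchFamily U d Ω) {v v' w u : V}
    (hv : v ∈ U) (hv' : v' ∈ U) (hw : w ∈ U) (hu : u ∈ U) (hvv : v ≠ v') (hwu : w ≠ u)
    (hvw : v ≠ w) (hvu : v ≠ u) (hvw' : v' ≠ w) (hvu' : v' ≠ u) (F : SimpleGraph V → ℝ) :
    ∑ H ∈ Ω, exclInd H v v' w * exclInd H v' v u * F (toggle H v v' w u) =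
      ∑ H ∈ Ω, exclInd H v' v w * exclInd H v v' u * F H := by
  refine Finset.sum_bij_ne_zero (fun H _ _ => toggle H v v' w u) ?_ ?_ ?_ ?_
  · intro H hH h
    have h1 := exclInd_ne_zero (left_ne_zero_of_mul (left_ne_zero_of_mul h))
    have h2 := exclInd_ne_zero (right_ne_zero_of_mul (left_ne_zero_of_mul h))
    exact hΩ.closed H hH v hv v' hv' w hw u hu hvv hwu hvw hvu hvw' hvu' h1.1 h1.2 h2.2 h2.1
  · intro H _ _ H' _ _ h
    rw [← toggle_toggle H v v' w u, h, toggle_toggle]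
  · intro H hH h
    have h1 := exclInd_ne_zero (left_ne_zero_of_mul (left_ne_zero_of_mul h))
    have h2 := exclInd_ne_zero (right_ne_zero_of_mul (left_ne_zero_of_mul h))
    refine ⟨toggle H v v' w u, ?_, ?_, toggle_toggle H v v' w u⟩
    · rw [← toggle_swap]
      exact hΩ.closed H hH v' hv' v hv w hw u hu hvv.symm hwu hvw' hvu' hvw hvu
        h1.1 h1.2 h2.2 h2.1
    · rw [toggle_toggle, ← toggle_swap, exclInd_toggle H hvw' hvw, toggle_swap, ← toggle_swap,
        exclInd_toggle' H hvu' hvu]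
      exact h
  · intro H _ _
    rw [exclInd_toggle H hvw hvw', exclInd_toggle' H hvu hvu']

theorem SwitchFamily.sum_switch_sum (hΩ : SwitchFamily U d Ω) {v v' w : V} {R : Finset V}
    (hv : v ∈ U) (hv' : v' ∈ U) (hw : w ∈ U) (hvv : v ≠ v') (hvw : v ≠ w) (hvw' : v' ≠ w)
    (hR : ∀ u ∈ R, u ∈ U ∧ u ≠ v ∧ u ≠ v' ∧ u ≠ w) (F : SimpleGraph V → ℝ)
    (hF : ∀ H ∈ Ω, ∀ u ∈ R, H.Adj v w → ¬ H.Adj v' w → ¬ H.Adj v u → H.Adj v' u →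
      F (toggle H v v' w u) = F H) :
    ∑ H ∈ Ω, exclInd H v v' w * (∑ u ∈ R, exclInd H v' v u) * F H =
      ∑ H ∈ Ω, exclInd H v' v w * (∑ u ∈ R, exclInd H v v' u) * F H := by
  simp only [Finset.mul_sum, Finset.sum_mul]
  rw [Finset.sum_comm, Finset.sum_comm (s := Ω)]
  refine Finset.sum_congr rfl fun u hu => ?_
  obtain ⟨h1, h2, h3, h4⟩ := hR u hu
  rw [← hΩ.sum_switch hv hv' hw h1 hvv h4.symm hvw h2.symm hvw' h3.symm F]
  refine Finset.sum_congr rfl fun H hH => ?_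
  by_cases h : exclInd H v v' w * exclInd H v' v u = 0
  · simp [h]
  · have e1 := exclInd_ne_zero (left_ne_zero_of_mul h)
    have e2 := exclInd_ne_zero (right_ne_zero_of_mul h)
    rw [hF H hH u hu e1.1 e1.2 e2.2 e2.1]

/-- The number of vertices of `U` adjacent to exactly one of `v`, `v'` (these two excluded). -/
def symDist (U : Finset V) (H : SimpleGraph V) (v v' : V) : ℝ :=
  ∑ w ∈ U \ {v, v'}, (adjInd H v w - adjInd H v' w) ^ 2

theorem symDist_comm (H : SimpleGraph V) (v v' : V) : symDist U H v v' = symDist U H v' v := by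
  unfold symDist
  rw [Finset.pair_comm]
  exact Finset.sum_congr rfl fun w _ => by ring

theorem symDist_nonneg (H : SimpleGraph V) (v v' : V) : 0 ≤ symDist U H v v' :=
  Finset.sum_nonneg fun _ _ => sq_nonneg _

theorem sq_sub_le_symDist (H : SimpleGraph V) {v v' w : V} (hw : w ∈ U) (hvw : v ≠ w)
    (hvw' : v' ≠ w) : (adjInd H v w - adjInd H v' w) ^ 2 ≤ symDist U H v v' := by
  unfold symDist
  exact Finset.single_le_sum (f := fun w => (adjInd H v w - adjInd H v' w) ^ 2)
    (fun _ _ => sq_nonneg _) (by simp [hw, hvw.symm, hvw'.symm])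

theorem SwitchFamily.sum_sub (hΩ : SwitchFamily U d Ω) {H : SimpleGraph V} (hH : H ∈ Ω) {v v' : V}
    (hv : v ∈ U) (hv' : v' ∈ U) (hvv : v ≠ v') :
    ∑ w ∈ U \ {v, v'}, (adjInd H v w - adjInd H v' w) = d v - d v' := by
  have h1 := hΩ.deg H hH v hv
  have h2 := hΩ.deg H hH v' hv'
  have hs : ({v, v'} : Finset V) ⊆ U := by
    intro x hx
    simp only [Finset.mem_insert, Finset.mem_singleton] at hx
    rcases hx with rfl | rfl <;> assumption
  rw [← h1, ← h2, ← Finset.sum_sub_distrib, ← Finset.sum_sdiff hs, Finset.sum_pair hvv]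
  simp [adjInd_self, adjInd_comm H v' v]

theorem exclInd_add (H : SimpleGraph V) (v v' w : V) :
    exclInd H v v' w + exclInd H v' v w = (adjInd H v w - adjInd H v' w) ^ 2 := by
  unfold exclInd
  rcases adjInd_eq_zero_or_one H v w with h | h <;>
    rcases adjInd_eq_zero_or_one H v' w with h' | h' <;> simp [h, h']

theorem exclInd_sub (H : SimpleGraph V) (v v' w : V) :
    exclInd H v v' w - exclInd H v' v w = adjInd H v w - adjInd H v' w := by
  unfold exclInd
  ring

theorem SwitchFamily.two_mul_sum_exclInd (hΩ : SwitchFamily U d Ω) {H : SimpleGraph V}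
    (hH : H ∈ Ω) {v v' : V} (hv : v ∈ U) (hv' : v' ∈ U) (hvv : v ≠ v') :
    2 * ∑ w ∈ U \ {v, v'}, exclInd H v v' w = symDist U H v v' + (d v - d v') := by
  rw [← hΩ.sum_sub hH hv hv' hvv, symDist, ← Finset.sum_add_distrib, Finset.mul_sum]
  refine Finset.sum_congr rfl fun w _ => ?_
  rw [← exclInd_add, ← exclInd_sub]
  ring

theorem symDist_toggle (H : SimpleGraph V) {v v' w u : V} (h1 : v ≠ w) (h2 : v' ≠ w)
    (h3 : v ≠ u) (h4 : v' ≠ u) :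
    symDist U (toggle H v v' w u) v v' = symDist U H v v' := by
  unfold symDist
  refine Finset.sum_congr rfl fun x hx => ?_
  by_cases hx : x = w ∨ x = u
  · have hvx : v ≠ x := by rcases hx with rfl | rfl <;> assumption
    have hvx' : v' ≠ x := by rcases hx with rfl | rfl <;> assumption
    rw [adjInd_toggle_of H hvx (by tauto), adjInd_toggle_of H hvx' (by tauto)]
    ring
  · rw [adjInd_toggle_of_not H (by tauto), adjInd_toggle_of_not H (by tauto)]

end Switching

section Averaging

set_option linter.unusedSectionVars false

variable {V : Type*} [DecidableEq V] {U : Finset V} {d : V → ℝ} {Ω : Finset (SimpleGraph V)}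

theorem SwitchFamily.sum_sub_mul (hΩ : SwitchFamily U d Ω) {v v' w : V} {Q : Finset V}
    (hv : v ∈ U) (hv' : v' ∈ U) (hw : w ∈ U) (hvv : v ≠ v') (hvw : v ≠ w) (hvw' : v' ≠ w)
    (hQ : Q ⊆ U \ {v, v', w}) (F : SimpleGraph V → ℝ)
    (hF : ∀ H ∈ Ω, ∀ u ∈ (U \ {v, v', w}) \ Q, H.Adj v w → ¬ H.Adj v' w → ¬ H.Adj v u →
      H.Adj v' u → F (toggle H v v' w u) = F H) :
    ∑ H ∈ Ω, (adjInd H v w - adjInd H v' w) * symDist U H v v' * F H =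
      ∑ H ∈ Ω, ((adjInd H v w - adjInd H v' w) ^ 2 * (d v - d v') +
        2 * (exclInd H v v' w * (∑ u ∈ Q, exclInd H v' v u) -
          exclInd H v' v w * (∑ u ∈ Q, exclInd H v v' u))) * F H := by
  have key := hΩ.sum_switch_sum (R := (U \ {v, v', w}) \ Q) hv hv' hw hvv hvw hvw'
    (fun u hu => by
      simp only [Finset.mem_sdiff, Finset.mem_insert, Finset.mem_singleton, not_or] at hu
      exact ⟨hu.1.1, hu.1.2.1, hu.1.2.2.1, hu.1.2.2.2⟩) F hF
  rw [← sub_eq_zero, ← Finset.sum_sub_distrib] at key ⊢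
  rw [← mul_eq_zero_of_right 2 key, Finset.mul_sum]
  refine Finset.sum_congr rfl fun H hH => ?_
  have hU : insert w (U \ {v, v', w}) = U \ {v, v'} := by
    ext x
    simp only [Finset.mem_insert, Finset.mem_sdiff, Finset.mem_singleton, not_or]
    constructor
    · rintro (rfl | h)
      · exact ⟨hw, hvw.symm, hvw'.symm⟩
      · tauto
    · intro h
      by_cases hx : x = w
      · exact Or.inl hx
      · tauto
  have hn : w ∉ U \ {v, v', w} := by simp
  have e1 := hΩ.two_mul_sum_exclInd hH hv hv' hvv
  have e2 := hΩ.two_mul_sum_exclInd hH hv' hv hvv.symm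
  rw [symDist_comm, Finset.pair_comm] at e2
  rw [← hU, Finset.sum_insert hn, ← Finset.sum_sdiff hQ] at e1 e2
  rw [← exclInd_add, ← exclInd_sub]
  linear_combination (exclInd H v' v w * F H) * e1 - (exclInd H v v' w * F H) * e2

/-- Graphs in `Ω` in which `v` and `v'` have nearly the same neighbours. -/
def lowSet (U : Finset V) (Ω : Finset (SimpleGraph V)) (J : ℝ) (v v' : V) :
    Finset (SimpleGraph V) := Ω.filter fun H => symDist U H v v' < J

theorem SwitchFamily.sum_sub_eq (hΩ : SwitchFamily U d Ω) {v v' w : V}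
    (hv : v ∈ U) (hv' : v' ∈ U) (hw : w ∈ U) (hvv : v ≠ v') (hvw : v ≠ w) (hvw' : v' ≠ w)
    (F : SimpleGraph V → ℝ)
    (hF : ∀ H ∈ Ω, ∀ u ∈ U, u ≠ v → u ≠ v' → u ≠ w → H.Adj v w → ¬ H.Adj v' w →
      ¬ H.Adj v u → H.Adj v' u → F (toggle H v v' w u) = F H) :
    ∑ H ∈ Ω, (adjInd H v w - adjInd H v' w) * F H =
      ∑ H ∈ Ω, (adjInd H v w - adjInd H v' w) ^ 2 * ((d v - d v') / symDist U H v v') * F H := by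
  have key := hΩ.sum_sub_mul (Q := ∅) hv hv' hw hvv hvw hvw' (by simp)
    (fun H => F H / symDist U H v v') (by
      intro H hH u hu a1 a2 a3 a4
      simp only [Finset.sdiff_empty, Finset.mem_sdiff, Finset.mem_insert, Finset.mem_singleton,
        not_or] at hu
      rw [hF H hH u hu.1 hu.2.1 hu.2.2.1 hu.2.2.2 a1 a2 a3 a4,
        symDist_toggle H hvw hvw' (Ne.symm hu.2.1) (Ne.symm hu.2.2.1)])
  simp only [Finset.sum_empty, mul_zero, sub_self, add_zero] at key
  calc _ = _ := Finset.sum_congr rfl fun H _ => ?_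
    _ = _ := key
    _ = _ := Finset.sum_congr rfl fun H _ => by ring
  by_cases h : symDist U H v v' = 0
  · have := sq_sub_le_symDist H hw hvw hvw'
    have h2 : (adjInd H v w - adjInd H v' w) ^ 2 = 0 := le_antisymm (h ▸ this) (sq_nonneg _)
    rw [pow_eq_zero_iff two_ne_zero] at h2
    simp [h2]
  · field_simp

theorem sq_div_le {ξ s J : ℝ} (hξ : ξ ^ 2 ≤ 1) (hs : ξ ^ 2 ≤ s) (hJ : 0 < J) :
    ξ ^ 2 / s ≤ 1 / J + if s < J then 1 else 0 := by
  have h0 := sq_nonneg ξ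
  split_ifs with h
  · have : ξ ^ 2 / s ≤ 1 := div_le_one_of_le₀ hs (h0.trans hs)
    have : 0 < 1 / J := by positivity
    linarith
  · push Not at h
    rw [add_zero]
    exact div_le_div₀ zero_le_one hξ hJ h

theorem sq_adjInd_sub_le_one (H : SimpleGraph V) (v v' w : V) :
    (adjInd H v w - adjInd H v' w) ^ 2 ≤ 1 := by
  rcases adjInd_eq_zero_or_one H v w with h | h <;>
    rcases adjInd_eq_zero_or_one H v' w with h' | h' <;> simp [h, h']

theorem SwitchFamily.abs_sum_sub_mul_le (hΩ : SwitchFamily U d Ω) {v v' w : V} {Q : Finset V}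
    (hv : v ∈ U) (hv' : v' ∈ U) (hw : w ∈ U) (hvv : v ≠ v') (hvw : v ≠ w) (hvw' : v' ≠ w)
    (hQ : Q ⊆ U \ {v, v', w}) {J : ℝ} (hJ : 0 < J) (F : SimpleGraph V → ℝ)
    (hF1 : ∀ H ∈ Ω, |F H| ≤ 1)
    (hF : ∀ H ∈ Ω, ∀ u ∈ (U \ {v, v', w}) \ Q, H.Adj v w → ¬ H.Adj v' w → ¬ H.Adj v u →
      H.Adj v' u → F (toggle H v v' w u) = F H) :
    |∑ H ∈ Ω, (adjInd H v w - adjInd H v' w) * F H| ≤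
      (|d v - d v'| + 2 * Q.card) * (Ω.card / J + (lowSet U Ω J v v').card) := by
  have key := hΩ.sum_sub_mul (Q := Q) hv hv' hw hvv hvw hvw' hQ
    (fun H => F H / symDist U H v v') (by
      intro H hH u hu a1 a2 a3 a4
      have hu' := hu
      simp only [Finset.mem_sdiff, Finset.mem_insert, Finset.mem_singleton, not_or] at hu
      rw [hF H hH u hu' a1 a2 a3 a4,
        symDist_toggle H hvw hvw' (Ne.symm hu.1.2.1) (Ne.symm hu.1.2.2.1)])
  have e1 : ∑ H ∈ Ω, (adjInd H v w - adjInd H v' w) * F H =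
      ∑ H ∈ Ω, (adjInd H v w - adjInd H v' w) * symDist U H v v' * (F H / symDist U H v v') := by
    refine Finset.sum_congr rfl fun H _ => ?_
    by_cases h : symDist U H v v' = 0
    · have := sq_sub_le_symDist H hw hvw hvw'
      have h2 : (adjInd H v w - adjInd H v' w) ^ 2 = 0 := le_antisymm (h ▸ this) (sq_nonneg _)
      rw [pow_eq_zero_iff two_ne_zero] at h2
      simp [h2]
    · field_simp
  rw [e1, key]
  have e2 : (Ω.card / J + (lowSet U Ω J v v').card : ℝ) =
      ∑ H ∈ Ω, (1 / J + if symDist U H v v' < J then 1 else 0) := by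
    rw [Finset.sum_add_distrib, Finset.sum_const, lowSet, Finset.card_filter]
    push_cast
    simp [div_eq_mul_inv]
  rw [e2, Finset.mul_sum]
  refine (Finset.abs_sum_le_sum_abs _ _).trans (Finset.sum_le_sum fun H hH => ?_)
  set s := symDist U H v v'
  set ξ := adjInd H v w - adjInd H v' w with hξ
  have hs0 : 0 ≤ s := symDist_nonneg H v v'
  have b1 : ξ ^ 2 / s ≤ _ := sq_div_le (sq_adjInd_sub_le_one H v v' w)
    (sq_sub_le_symDist H hw hvw hvw') hJ
  have hQb : ∀ x y : V, 0 ≤ ∑ u ∈ Q, exclInd H x y u ∧ ∑ u ∈ Q, exclInd H x y u ≤ Q.card := by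
    intro x y
    refine ⟨Finset.sum_nonneg fun u _ => exclInd_nonneg H x y u, ?_⟩
    calc _ ≤ ∑ u ∈ Q, (1 : ℝ) := Finset.sum_le_sum fun u _ => exclInd_le_one H x y u
      _ = _ := by simp
  have b2 : |2 * (exclInd H v v' w * (∑ u ∈ Q, exclInd H v' v u) -
          exclInd H v' v w * (∑ u ∈ Q, exclInd H v v' u))| ≤ 2 * Q.card * ξ ^ 2 := by
    have h1 := hQb v' v
    have h2 := hQb v v'
    rw [hξ, ← exclInd_add]
    have g1 := exclInd_nonneg H v v' w
    have g2 := exclInd_nonneg H v' v w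
    rw [abs_le]
    constructor <;> nlinarith [mul_nonneg g1 h1.1, mul_nonneg g2 h2.1,
      mul_nonneg g1 (sub_nonneg.2 h1.2), mul_nonneg g2 (sub_nonneg.2 h2.2)]
  have b3 : |ξ ^ 2 * (d v - d v') + 2 * (exclInd H v v' w * (∑ u ∈ Q, exclInd H v' v u) -
          exclInd H v' v w * (∑ u ∈ Q, exclInd H v v' u))| ≤
      (|d v - d v'| + 2 * Q.card) * ξ ^ 2 := by
    refine (abs_add_le _ _).trans ?_
    rw [abs_mul, abs_of_nonneg (sq_nonneg ξ)]
    linarith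
  rw [abs_mul, abs_div, abs_of_nonneg hs0]
  calc _ ≤ ((|d v - d v'| + 2 * Q.card) * ξ ^ 2) * (1 / s) := by
        gcongr
        exact hF1 H hH
    _ = (|d v - d v'| + 2 * Q.card) * (ξ ^ 2 / s) := by ring
    _ ≤ _ := by gcongr

end Averaging

section LowSymDist

set_option linter.unusedSectionVars false

variable {V : Type*} [DecidableEq V] {U : Finset V} {d : V → ℝ} {Ω : Finset (SimpleGraph V)}

/-- The dense near-regular range, on the scale `|U| = L ^ 100`. -/
structure NearRegular (U : Finset V) (d : V → ℝ) (Ω : Finset (SimpleGraph V)) (L D : ℝ) :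
    Prop where
  switch : SwitchFamily U d Ω
  large : 1000000 ≤ L
  card : (U.card : ℝ) = L ^ 100
  dev : ∀ v ∈ U, |d v - D| ≤ L ^ 51
  lower : L ^ 99 ≤ D
  upper : L ^ 99 ≤ L ^ 100 - D
  mean : ∑ v ∈ U, d v = L ^ 100 * D

theorem mul_pow_le_pow {L : ℝ} (hL : 1000000 ≤ L) {i j : ℕ} (hij : i < j) :
    1000000 * L ^ i ≤ L ^ j := by
  have h1 : (1 : ℝ) ≤ L := by linarith
  calc 1000000 * L ^ i ≤ L * L ^ i := by gcongr
    _ = L ^ (i + 1) := by ring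
    _ ≤ L ^ j := pow_le_pow_right₀ h1 hij

theorem symDist_toggle_le (H : SimpleGraph V) {a b v v' u : V} (hva : v ≠ a) (hvb : v ≠ b)
    (hva' : v' ≠ a) (hvb' : v' ≠ b) :
    symDist U (toggle H v v' b u) a b ≤ symDist U H a b + 2 := by
  have h1 : ∀ z : V, ∑ w ∈ U \ {a, b}, (if w = z then (1 : ℝ) else 0) ≤ 1 := by
    intro z
    rw [Finset.sum_ite_eq' (U \ {a, b}) z]
    split_ifs <;> norm_num
  calc symDist U (toggle H v v' b u) a b ≤
      ∑ w ∈ U \ {a, b}, ((adjInd H a w - adjInd H b w) ^ 2 + (if w = v then (1 : ℝ) else 0)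
        + (if w = v' then (1 : ℝ) else 0)) := by
        refine Finset.sum_le_sum fun w hw => ?_
        simp only [Finset.mem_sdiff, Finset.mem_insert, Finset.mem_singleton, not_or] at hw
        have h0 := sq_nonneg (adjInd H a w - adjInd H b w)
        have h2 := sq_adjInd_sub_le_one (toggle H v v' b u) a b w
        by_cases hwv : w = v
        · rw [if_pos hwv]
          split_ifs <;> linarith
        · by_cases hwv' : w = v'
          · rw [if_neg hwv, if_pos hwv']
            linarith
          · rw [if_neg hwv, if_neg hwv',
              adjInd_toggle_of_not H (by
                rintro (⟨h | h, h'⟩ | ⟨h | h, h' | h'⟩)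
                · exact hva h.symm
                · exact hva' h.symm
                · exact hwv h'
                · exact hwv' h'
                · exact hwv h'
                · exact hwv' h'),
              adjInd_toggle_of_not H (by
                rintro (⟨h | h, h'⟩ | ⟨h | h, h' | h'⟩)
                · exact hvb h.symm
                · exact hvb' h.symm
                · exact hwv h'
                · exact hwv' h'
                · exact hwv h'
                · exact hwv' h')]
            linarith
    _ ≤ symDist U H a b + 2 := by
        rw [Finset.sum_add_distrib, Finset.sum_add_distrib, symDist]
        linarith [h1 v', h1 v]

/-- The number of switchings that increase the symmetric difference of `a` and `b`. -/
def raiseCount (U : Finset V) (H : SimpleGraph V) (a b : V) : ℝ :=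
  ∑ v ∈ U \ {a, b}, ∑ v' ∈ U \ {a, b}, ∑ u ∈ U,
    if v ≠ v' ∧ u ≠ a ∧ u ≠ b ∧ u ≠ v ∧ u ≠ v' then
      exclInd H v v' b * exclInd H v' v u * exclInd H v v' a else 0

theorem SwitchFamily.sum_raiseCount_le (hΩ : SwitchFamily U d Ω) {a b : V}
    (hb : b ∈ U) (hab : a ≠ b) (x : ℝ) :
    ∑ H ∈ lowSet U Ω x a b, raiseCount U H a b ≤
      (lowSet U Ω (x + 2) a b).card * ((x + 2) ^ 2 * U.card) := by
  have hstep : ∑ H ∈ lowSet U Ω x a b, raiseCount U H a b ≤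
      ∑ v ∈ U \ {a, b}, ∑ v' ∈ U \ {a, b}, ∑ u ∈ U,
        if v ≠ v' ∧ u ≠ a ∧ u ≠ b ∧ u ≠ v ∧ u ≠ v' then ∑ H ∈ Ω,
        exclInd H v' v b * exclInd H v v' u *
          (exclInd H v v' a * if symDist U H a b < x + 2 then 1 else 0) else 0 := by
    unfold raiseCount
    rw [Finset.sum_comm]
    refine Finset.sum_le_sum fun v hv => ?_
    rw [Finset.sum_comm]
    refine Finset.sum_le_sum fun v' hv' => ?_
    rw [Finset.sum_comm]
    refine Finset.sum_le_sum fun u hu => ?_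
    split_ifs with hc
    swap
    · simp
    obtain ⟨c1, c2, c3, c4, c5⟩ := hc
    simp only [Finset.mem_sdiff, Finset.mem_insert, Finset.mem_singleton, not_or] at hv hv'
    rw [← hΩ.sum_switch hv.1 hv'.1 hb hu c1 c3.symm hv.2.2 c4.symm hv'.2.2 c5.symm
      (fun H => exclInd H v v' a * if symDist U H a b < x + 2 then 1 else 0),
      lowSet, Finset.sum_filter]
    refine Finset.sum_le_sum fun H _ => ?_
    have hn : ∀ z : V, ¬(((z = v ∨ z = v') ∧ (a = b ∨ a = u)) ∨
        ((z = b ∨ z = u) ∧ (a = v ∨ a = v'))) := by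
      rintro z (⟨_, h | h⟩ | ⟨_, h | h⟩)
      · exact hab h
      · exact c2 h.symm
      · exact hv.2.1 h.symm
      · exact hv'.2.1 h.symm
    have he : exclInd (toggle H v v' b u) v v' a = exclInd H v v' a := by
      unfold exclInd
      rw [adjInd_toggle_of_not H (hn v), adjInd_toggle_of_not H (hn v')]
    have hs := symDist_toggle_le (U := U) H hv.2.1 hv.2.2 hv'.2.1 hv'.2.2 (u := u)
    have g1 := exclInd_nonneg H v v' b
    have g2 := exclInd_nonneg H v' v u
    have g3 := exclInd_nonneg H v v' a
    rw [he]
    by_cases h : symDist U H a b < x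
    · rw [if_pos h, if_pos (by linarith)]
      linarith
    · rw [if_neg h]
      positivity
  refine hstep.trans ?_
  have hrw : ∀ v v' u : V, ∑ H ∈ Ω, exclInd H v' v b * exclInd H v v' u *
        (exclInd H v v' a * if symDist U H a b < x + 2 then 1 else 0) =
      ∑ H ∈ lowSet U Ω (x + 2) a b,
        exclInd H v' v b * exclInd H v v' u * exclInd H v v' a := by
    intro v v' u
    rw [lowSet, Finset.sum_filter]
    refine Finset.sum_congr rfl fun H _ => ?_
    split_ifs <;> simp
  calc _ ≤ ∑ v ∈ U \ {a, b}, ∑ v' ∈ U \ {a, b}, ∑ u ∈ U, ∑ H ∈ lowSet U Ω (x + 2) a b,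
        (adjInd H a v - adjInd H b v) ^ 2 * (adjInd H a v' - adjInd H b v') ^ 2 := by
        refine Finset.sum_le_sum fun v _ => Finset.sum_le_sum fun v' _ =>
          Finset.sum_le_sum fun u _ => ?_
        split_ifs with hc
        swap
        · positivity
        rw [hrw]
        refine Finset.sum_le_sum fun H _ => ?_
        unfold exclInd
        rw [adjInd_comm H a v, adjInd_comm H b v, adjInd_comm H a v', adjInd_comm H b v']
        rcases adjInd_eq_zero_or_one H v a with h1 | h1 <;>
          rcases adjInd_eq_zero_or_one H v b with h2 | h2 <;>
          rcases adjInd_eq_zero_or_one H v' a with h3 | h3 <;>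
          rcases adjInd_eq_zero_or_one H v' b with h4 | h4 <;>
          rcases adjInd_eq_zero_or_one H v u with h5 | h5 <;>
          rcases adjInd_eq_zero_or_one H v' u with h6 | h6 <;>
          simp [h1, h2, h3, h4, h5, h6]
    _ = ∑ H ∈ lowSet U Ω (x + 2) a b, symDist U H a b ^ 2 * U.card := by
        simp only [Finset.sum_const, nsmul_eq_mul]
        simp_rw [← Finset.mul_sum]
        have hsq : ∀ H : SimpleGraph V, symDist U H a b ^ 2 * U.card = U.card *
            ∑ v ∈ U \ {a, b}, ∑ v' ∈ U \ {a, b},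
              (adjInd H a v - adjInd H b v) ^ 2 * (adjInd H a v' - adjInd H b v') ^ 2 := by
          intro H
          rw [symDist, sq, Finset.sum_mul_sum, mul_comm]
        simp_rw [hsq]
        rw [← Finset.mul_sum, Finset.sum_comm (s := lowSet U Ω (x + 2) a b)]
        refine congrArg _ (Finset.sum_congr rfl fun v _ => ?_)
        rw [Finset.sum_comm (s := lowSet U Ω (x + 2) a b)]
    _ ≤ ∑ H ∈ lowSet U Ω (x + 2) a b, (x + 2) ^ 2 * U.card := by
        refine Finset.sum_le_sum fun H hH => ?_
        have h1 := (Finset.mem_filter.1 hH).2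
        have h2 := symDist_nonneg (U := U) H a b
        gcongr
    _ = _ := by simp

theorem le_raiseCount (H : SimpleGraph V) (a b : V) :
    ∑ u ∈ U, (∑ v' ∈ U \ {a, b}, (1 - adjInd H v' a) * (1 - adjInd H v' b) * adjInd H v' u) *
        (∑ v ∈ U \ {a, b}, adjInd H v a * adjInd H v b * (1 - adjInd H v u)) - (U.card : ℝ) ^ 2 ≤
      raiseCount U H a b := by
  have hcard : ((U \ {a, b}).card : ℝ) ≤ U.card := by
    exact_mod_cast Finset.card_le_card Finset.sdiff_subset
  have h1 : ∑ v ∈ U \ {a, b}, ∑ v' ∈ U \ {a, b}, ∑ u ∈ U, (if u = v then (1 : ℝ) else 0) ≤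
      (U.card : ℝ) ^ 2 := by
    calc _ ≤ ∑ v ∈ U \ {a, b}, ∑ v' ∈ U \ {a, b}, (1 : ℝ) := by
          refine Finset.sum_le_sum fun v _ => Finset.sum_le_sum fun v' _ => ?_
          rw [Finset.sum_ite_eq']
          split_ifs <;> norm_num
      _ = ((U \ {a, b}).card : ℝ) ^ 2 := by simp; ring
      _ ≤ _ := by gcongr
  have h2 : ∑ u ∈ U, (∑ v' ∈ U \ {a, b},
        (1 - adjInd H v' a) * (1 - adjInd H v' b) * adjInd H v' u) *
        (∑ v ∈ U \ {a, b}, adjInd H v a * adjInd H v b * (1 - adjInd H v u)) =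
      ∑ v ∈ U \ {a, b}, ∑ v' ∈ U \ {a, b}, ∑ u ∈ U,
        exclInd H v v' b * exclInd H v' v u * exclInd H v v' a := by
    simp_rw [Finset.sum_mul_sum]
    rw [Finset.sum_comm]
    conv_rhs => rw [Finset.sum_comm]
    refine Finset.sum_congr rfl fun v' _ => ?_
    rw [Finset.sum_comm]
    refine Finset.sum_congr rfl fun v _ => Finset.sum_congr rfl fun u _ => ?_
    unfold exclInd
    ring
  have h3 : ∑ v ∈ U \ {a, b}, ∑ v' ∈ U \ {a, b}, ∑ u ∈ U,
        exclInd H v v' b * exclInd H v' v u * exclInd H v v' a ≤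
      raiseCount U H a b + ∑ v ∈ U \ {a, b}, ∑ v' ∈ U \ {a, b}, ∑ u ∈ U,
        (if u = v then (1 : ℝ) else 0) := by
    unfold raiseCount
    simp_rw [← Finset.sum_add_distrib]
    refine Finset.sum_le_sum fun v _ => Finset.sum_le_sum fun v' _ =>
      Finset.sum_le_sum fun u _ => ?_
    by_cases c4 : u = v
    · rw [if_pos c4, if_neg (by tauto), zero_add]
      have g1 := exclInd_le_one H v v' b
      have g2 := exclInd_le_one H v' v u
      have g3 := exclInd_le_one H v v' a
      exact mul_le_one₀ (mul_le_one₀ g1 (exclInd_nonneg _ _ _ _) g2) (exclInd_nonneg _ _ _ _) g3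
    rw [if_neg c4, add_zero]
    split_ifs with hc
    · exact le_rfl
    · have : v = v' ∨ u = a ∨ u = b ∨ u = v' := by tauto
      refine le_of_eq ?_
      unfold exclInd
      rcases this with rfl | rfl | rfl | rfl
      · rcases adjInd_eq_zero_or_one H v b with h | h <;> simp [h]
      · rcases adjInd_eq_zero_or_one H v' u with h | h <;> simp [h]
      · rcases adjInd_eq_zero_or_one H v' u with h | h <;> simp [h]
      · simp [adjInd_self]
  linarith

theorem NearRegular.raiseCount_ge {L D : ℝ} (hR : NearRegular U d Ω L D) {H : SimpleGraph V}
    (hH : H ∈ Ω) {a b : V} (ha : a ∈ U) (hb : b ∈ U) (hab : a ≠ b)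
    (hs : symDist U H a b ≤ L ^ 96) : L ^ 295 ≤ raiseCount U H a b := by
  set s := symDist U H a b
  set W := U \ {a, b} with hW
  have hL := hR.large
  have h0 : ∀ x y, 0 ≤ adjInd H x y := adjInd_nonneg H
  have h1 : ∀ x y, adjInd H x y ≤ 1 := adjInd_le_one H
  set α : ℝ := ∑ v ∈ W, adjInd H v a * adjInd H v b with hα
  set q : V → ℝ := fun u => ∑ v ∈ W, adjInd H v a * adjInd H v b * adjInd H v u with hq
  set p : V → ℝ := fun u => ∑ v ∈ W, (1 - adjInd H v a) * (1 - adjInd H v b) * adjInd H v u with hp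
  have habU : ({a, b} : Finset V) ⊆ U := by
    intro x hx
    simp only [Finset.mem_insert, Finset.mem_singleton] at hx
    rcases hx with rfl | rfl <;> assumption
  have hsplit : ∀ u ∈ U, d u ≤ 2 + ∑ v ∈ W, adjInd H v u := by
    intro u hu
    have := hR.switch.deg H hH u hu
    rw [← this, ← Finset.sum_sdiff habU, Finset.sum_pair hab]
    have e : ∑ x ∈ U \ {a, b}, adjInd H u x = ∑ v ∈ W, adjInd H v u :=
      Finset.sum_congr rfl fun x _ => adjInd_comm H u x
    rw [e]
    linarith [h1 u a, h1 u b]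
  have hαle : α ≤ d a := by
    rw [← hR.switch.deg H hH a ha]
    calc α ≤ ∑ v ∈ W, adjInd H a v := by
          refine Finset.sum_le_sum fun v _ => ?_
          rw [adjInd_comm H a v]
          exact mul_le_of_le_one_right (h0 _ _) (h1 _ _)
      _ ≤ _ := Finset.sum_le_sum_of_subset_of_nonneg Finset.sdiff_subset fun _ _ _ => h0 _ _
  have hα0 : 0 ≤ α := Finset.sum_nonneg fun v _ => mul_nonneg (h0 _ _) (h0 _ _)
  have hαge : d a ≤ 2 + α + s := by
    refine (hsplit a ha).trans ?_
    rw [add_assoc, hα, show s = ∑ w ∈ W, (adjInd H a w - adjInd H b w) ^ 2 from rfl,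
      ← Finset.sum_add_distrib]
    gcongr with v _
    rw [adjInd_comm H a v, adjInd_comm H b v]
    rcases adjInd_eq_zero_or_one H v a with h | h <;>
      rcases adjInd_eq_zero_or_one H v b with h' | h' <;> simp [h, h']
  have hpge : ∀ u ∈ U, d u ≤ 2 + (q u + p u + s) := by
    intro u hu
    refine (hsplit u hu).trans ?_
    rw [hq, hp, show s = ∑ w ∈ W, (adjInd H a w - adjInd H b w) ^ 2 from rfl]
    rw [← Finset.sum_add_distrib, ← Finset.sum_add_distrib]
    gcongr with v _
    rw [adjInd_comm H a v, adjInd_comm H b v]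
    rcases adjInd_eq_zero_or_one H v a with h | h <;>
      rcases adjInd_eq_zero_or_one H v b with h' | h' <;>
      rcases adjInd_eq_zero_or_one H v u with h'' | h'' <;> simp [h, h', h'']
  have hp0 : ∀ u, 0 ≤ p u := fun u => Finset.sum_nonneg fun v _ =>
    mul_nonneg (mul_nonneg (sub_nonneg.2 (h1 _ _)) (sub_nonneg.2 (h1 _ _))) (h0 _ _)
  have hαq : ∀ u, ∑ v ∈ W, adjInd H v a * adjInd H v b * (1 - adjInd H v u) = α - q u := by
    intro u
    rw [hα, hq, ← Finset.sum_sub_distrib]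
    exact Finset.sum_congr rfl fun v _ => by ring
  have hαq0 : ∀ u, 0 ≤ α - q u := fun u => by
    rw [← hαq]
    exact Finset.sum_nonneg fun v _ => mul_nonneg (mul_nonneg (h0 _ _) (h0 _ _))
      (sub_nonneg.2 (h1 _ _))
  have hqsum : ∑ u ∈ U, q u ≤ (D + L ^ 51) * α := by
    rw [hq, Finset.sum_comm, hα, Finset.mul_sum]
    refine Finset.sum_le_sum fun v hv => ?_
    rw [← Finset.mul_sum, hR.switch.deg H hH v (Finset.mem_sdiff.1 hv).1, mul_comm]
    have := abs_le.1 (hR.dev v (Finset.mem_sdiff.1 hv).1)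
    have := mul_nonneg (h0 v a) (h0 v b)
    gcongr
    linarith
  have hda := abs_le.1 (hR.dev a ha)
  set e : ℝ := L ^ 51 + L ^ 96 + 2 with he
  have hT := le_raiseCount (U := U) H a b
  rw [← hW] at hT
  have hterm : ∀ u ∈ U, L ^ 98 * (D - e - q u) - L ^ 196 / 4 ≤ p u * (α - q u) := by
    intro u hu
    have hdu := abs_le.1 (hR.dev u hu)
    have g1 : D - e - q u ≤ p u := by linarith [hpge u hu]
    have g2 : D - e - q u ≤ α - q u := by linarith
    have hsq : L ^ 98 * (D - e - q u) - L ^ 196 / 4 ≤ (D - e - q u) ^ 2 := by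
      nlinarith [sq_nonneg (D - e - q u - L ^ 98 / 2)]
    by_cases hx : 0 ≤ D - e - q u
    · refine hsq.trans ?_
      rw [sq]
      exact mul_le_mul g1 g2 hx (hp0 u)
    · push Not at hx
      have := mul_nonneg (hp0 u) (hαq0 u)
      have : L ^ 98 * (D - e - q u) ≤ 0 := mul_nonpos_of_nonneg_of_nonpos (by positivity) hx.le
      have : 0 ≤ L ^ 196 := by positivity
      linarith
  have hsum := Finset.sum_le_sum hterm
  rw [Finset.sum_sub_distrib, ← Finset.mul_sum, Finset.sum_sub_distrib, Finset.sum_const,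
    Finset.sum_const, nsmul_eq_mul, nsmul_eq_mul, hR.card] at hsum
  simp_rw [hαq] at hT
  rw [hR.card] at hT
  change ∑ x ∈ U, p x * (α - q x) - (L ^ 100) ^ 2 ≤ _ at hT
  have hq2 : ∑ u ∈ U, q u ≤ (D + L ^ 51) ^ 2 := by
    refine hqsum.trans ?_
    rw [sq]
    have : 0 ≤ L ^ 51 := by positivity
    have : 0 ≤ L ^ 99 := by positivity
    gcongr
    · linarith [hR.lower]
    · linarith
  have k1 := mul_pow_le_pow hL (show 197 < 198 by norm_num)
  have k2 := mul_pow_le_pow hL (show 196 < 197 by norm_num)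
  have k3 := mul_pow_le_pow hL (show 151 < 196 by norm_num)
  have k4 := mul_pow_le_pow hL (show 102 < 151 by norm_num)
  have k5 := mul_pow_le_pow hL (show 100 < 102 by norm_num)
  have hD1 := hR.lower
  have hD2 := hR.upper
  have hD0 : 0 ≤ D := le_trans (by positivity) hD1
  have hp100 : 0 ≤ L ^ 100 := by positivity
  have hDN : L ^ 198 ≤ D * (L ^ 100 - D) := by
    calc L ^ 198 = L ^ 99 * L ^ 99 := by ring
      _ ≤ _ := by gcongr
  have hD3 : D * L ^ 51 ≤ L ^ 151 := by
    calc D * L ^ 51 ≤ L ^ 100 * L ^ 51 := by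
          gcongr
          have : 0 ≤ L ^ 99 := by positivity
          linarith
      _ = _ := by ring
  have hX : L ^ 198 / 2 ≤ L ^ 100 * (D - e) - ∑ u ∈ U, q u := by
    have : L ^ 100 * (D - e) - (D + L ^ 51) ^ 2 = D * (L ^ 100 - D) -
      (L ^ 151 + L ^ 196 + 2 * L ^ 100) - 2 * (D * L ^ 51) - L ^ 102 := by rw [he]; ring
    linarith
  have hfin : L ^ 98 * (L ^ 198 / 2) ≤ L ^ 98 * (L ^ 100 * (D - e) - ∑ u ∈ U, q u) := by gcongr
  have k6 := mul_pow_le_pow hL (show 295 < 296 by norm_num)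
  have k7 := mul_pow_le_pow hL (show 200 < 295 by norm_num)
  have e1 : L ^ 98 * (L ^ 198 / 2) = L ^ 296 / 2 := by ring
  have e2 : L ^ 100 * (L ^ 196 / 4) = L ^ 296 / 4 := by ring
  have e3 : (L ^ 100) ^ 2 = L ^ 200 := by ring
  have : 0 ≤ L ^ 200 := by positivity
  linarith

theorem NearRegular.card_lowSet_step {L D : ℝ} (hR : NearRegular U d Ω L D) {a b : V}
    (ha : a ∈ U) (hb : b ∈ U) (hab : a ≠ b) {x : ℝ} (hx : 0 ≤ x) (hx2 : x + 2 ≤ L ^ 96) :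
    L ^ 2 * (lowSet U Ω x a b).card ≤ (lowSet U Ω (x + 2) a b).card := by
  have hL := hR.large
  have h1 := hR.switch.sum_raiseCount_le hb hab x
  have h2 : (lowSet U Ω x a b).card * L ^ 295 ≤
      ∑ H ∈ lowSet U Ω x a b, raiseCount U H a b := by
    rw [← nsmul_eq_mul]
    refine Finset.card_nsmul_le_sum _ _ _ fun H hH => ?_
    have := Finset.mem_filter.1 hH
    exact hR.raiseCount_ge this.1 ha hb hab (by linarith [this.2])
  have h3 : (x + 2) ^ 2 * U.card ≤ L ^ 293 := by
    rw [hR.card]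
    calc (x + 2) ^ 2 * L ^ 100 ≤ (L ^ 96) ^ 2 * L ^ 100 := by gcongr
      _ = L ^ 292 := by ring
      _ ≤ L ^ 293 := pow_le_pow_right₀ (by linarith) (by norm_num)
  have h4 : (lowSet U Ω x a b).card * L ^ 295 ≤ (lowSet U Ω (x + 2) a b).card * L ^ 293 :=
    h2.trans (h1.trans (by gcongr))
  have hp : 0 < L ^ 293 := by positivity
  have : L ^ 295 = L ^ 2 * L ^ 293 := by ring
  rw [this] at h4
  refine le_of_mul_le_mul_right ?_ hp
  linarith

theorem NearRegular.card_lowSet_le {L D : ℝ} (hR : NearRegular U d Ω L D) {a b : V}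
    (ha : a ∈ U) (hb : b ∈ U) (hab : a ≠ b) :
    L ^ 600 * (lowSet U Ω (L ^ 95) a b).card ≤ Ω.card := by
  have hL := hR.large
  have key : ∀ k : ℕ, k ≤ 300 →
      L ^ (2 * k) * (lowSet U Ω (L ^ 95) a b).card ≤ (lowSet U Ω (L ^ 95 + 2 * k) a b).card := by
    intro k
    induction k with
    | zero => intro _; simp
    | succ k ih =>
      intro hk
      have hk' : (k : ℝ) + 1 ≤ 300 := by exact_mod_cast hk
      have k1 := mul_pow_le_pow hL (show 95 < 96 by norm_num)
      have k2 : 1 ≤ L ^ 95 := one_le_pow₀ (by linarith)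
      have h1 := hR.card_lowSet_step ha hb hab (x := L ^ 95 + 2 * k) (by positivity) (by linarith)
      have h2 := ih (by omega)
      have h3 : L ^ 95 + 2 * ((k + 1 : ℕ) : ℝ) = L ^ 95 + 2 * k + 2 := by push_cast; ring
      rw [h3]
      refine le_trans ?_ h1
      calc L ^ (2 * (k + 1)) * ((lowSet U Ω (L ^ 95) a b).card : ℝ)
          = L ^ 2 * (L ^ (2 * k) * (lowSet U Ω (L ^ 95) a b).card) := by ring
        _ ≤ _ := by gcongr
  have h := key 300 le_rfl
  refine h.trans ?_
  exact_mod_cast Finset.card_filter_le _ _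

end LowSymDist

section Concentration

set_option linter.unusedSectionVars false

variable {V : Type*} [DecidableEq V] {U : Finset V} {d : V → ℝ} {Ω : Finset (SimpleGraph V)}
  {L D : ℝ}

theorem NearRegular.abs_sub_le (hR : NearRegular U d Ω L D) {v v' : V} (hv : v ∈ U)
    (hv' : v' ∈ U) : |d v - d v'| ≤ 2 * L ^ 51 := by
  have h1 := abs_le.1 (hR.dev v hv)
  have h2 := abs_le.1 (hR.dev v' hv')
  rw [abs_le]
  constructor <;> linarith

theorem NearRegular.abs_sum_sub_mul_le (hR : NearRegular U d Ω L D) {v v' w : V} {Q : Finset V}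
    (hv : v ∈ U) (hv' : v' ∈ U) (hw : w ∈ U) (hvv : v ≠ v') (hvw : v ≠ w) (hvw' : v' ≠ w)
    (hQ : Q ⊆ U \ {v, v', w}) (hQc : Q.card ≤ 10) (F : SimpleGraph V → ℝ)
    (hF1 : ∀ H ∈ Ω, |F H| ≤ 1)
    (hF : ∀ H ∈ Ω, ∀ u ∈ (U \ {v, v', w}) \ Q, H.Adj v w → ¬ H.Adj v' w → ¬ H.Adj v u →
      H.Adj v' u → F (toggle H v v' w u) = F H) :
    L ^ 43 * |∑ H ∈ Ω, (adjInd H v w - adjInd H v' w) * F H| ≤ Ω.card := by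
  have hL := hR.large
  have hL0 : 0 < L := by linarith
  have h1 := hR.switch.abs_sum_sub_mul_le hv hv' hw hvv hvw hvw' hQ (J := L ^ 95) (by positivity)
    F hF1 hF
  have h2 := hR.card_lowSet_le hv hv' hvv
  have h3 := hR.abs_sub_le hv hv'
  have h4 : (Q.card : ℝ) ≤ 10 := by exact_mod_cast hQc
  set X := |∑ H ∈ Ω, (adjInd H v w - adjInd H v' w) * F H|
  set B : ℝ := ((lowSet U Ω (L ^ 95) v v').card : ℝ)
  have hB : B ≤ Ω.card / L ^ 95 := by
    rw [le_div_iff₀ (by positivity)]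
    refine le_trans ?_ h2
    rw [mul_comm]
    have : L ^ 95 ≤ L ^ 600 := pow_le_pow_right₀ (by linarith) (by norm_num)
    gcongr
  have h5 : X ≤ (2 * L ^ 51 + 20) * (2 * (Ω.card / L ^ 95)) := by
    refine h1.trans ?_
    have : (0 : ℝ) ≤ Ω.card / L ^ 95 := by positivity
    have : (0 : ℝ) ≤ B := by positivity
    gcongr <;> linarith
  have k1 : (2 * L ^ 51 + 20) * 2 ≤ L ^ 52 := by
    have k1 := mul_pow_le_pow hL (show 51 < 52 by norm_num)
    have k2 : 1 ≤ L ^ 51 := one_le_pow₀ (by linarith)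
    linarith
  calc L ^ 43 * X ≤ L ^ 43 * ((2 * L ^ 51 + 20) * (2 * (Ω.card / L ^ 95))) := by gcongr
    _ = (L ^ 43 * ((2 * L ^ 51 + 20) * 2)) * (Ω.card / L ^ 95) := by ring
    _ ≤ (L ^ 43 * L ^ 52) * (Ω.card / L ^ 95) := by gcongr
    _ = Ω.card := by field_simp

/-- Edges of `Ω` decorrelate from quantities that few switchings affect. -/
theorem NearRegular.decorrelate (hR : NearRegular U d Ω L D) {S : Finset V} (hS : S ⊆ U)
    (hSc : S.card ≤ 10) {a b : V} (ha : a ∈ S) (hb : b ∈ S) (hab : a ≠ b)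
    (F : SimpleGraph V → ℝ) (hF1 : ∀ H ∈ Ω, |F H| ≤ 1)
    (hF : ∀ H ∈ Ω, ∀ l ∈ U \ S, ∀ u ∈ U \ S, l ≠ u → F (toggle H b l a u) = F H) :
    L ^ 42 * |∑ H ∈ Ω, adjInd H a b * F H - D / L ^ 100 * ∑ H ∈ Ω, F H| ≤ Ω.card := by
  have hL := hR.large
  have hL0 : 0 < L := by linarith
  have hbd : ∀ l ∈ U \ S, |∑ H ∈ Ω, (adjInd H b a - adjInd H l a) * F H| ≤ Ω.card / L ^ 43 := by
    intro l hl
    rw [le_div_iff₀ (by positivity), mul_comm]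
    have hlU := (Finset.mem_sdiff.1 hl).1
    have hlS := (Finset.mem_sdiff.1 hl).2
    have hlb : b ≠ l := fun h => hlS (h ▸ hb)
    have hla : l ≠ a := fun h => hlS (h ▸ ha)
    refine hR.abs_sum_sub_mul_le (Q := S \ {a, b}) (hS hb) hlU (hS ha) hlb hab.symm hla ?_ ?_
      F hF1 ?_
    · intro x hx
      simp only [Finset.mem_sdiff, Finset.mem_insert, Finset.mem_singleton, not_or] at hx ⊢
      exact ⟨hS hx.1, hx.2.2, fun h => hlS (h ▸ hx.1), hx.2.1⟩
    · exact (Finset.card_le_card Finset.sdiff_subset).trans hSc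
    · intro H hH u hu _ _ _ _
      simp only [Finset.mem_sdiff, Finset.mem_insert, Finset.mem_singleton, not_or] at hu
      refine hF H hH l hl u ?_ (Ne.symm hu.1.2.2.1)
      simp only [Finset.mem_sdiff]
      tauto
  have hsum := (Finset.abs_sum_le_sum_abs (fun l => ∑ H ∈ Ω, (adjInd H b a - adjInd H l a) * F H)
    (U \ S)).trans (Finset.sum_le_sum hbd)
  rw [Finset.sum_const, nsmul_eq_mul, Finset.sum_comm] at hsum
  have hcard : ((U \ S).card : ℝ) = L ^ 100 - S.card := by
    rw [Finset.card_sdiff_of_subset hS, Nat.cast_sub (Finset.card_le_card hS), hR.card]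
  have hSc' : (S.card : ℝ) ≤ 10 := by exact_mod_cast hSc
  have hdiff : |L ^ 100 * (∑ H ∈ Ω, adjInd H a b * F H) - D * ∑ H ∈ Ω, F H -
      ∑ H ∈ Ω, ∑ l ∈ U \ S, (adjInd H b a - adjInd H l a) * F H| ≤ Ω.card * (L ^ 51 + 20) := by
    rw [Finset.mul_sum, Finset.mul_sum, ← Finset.sum_sub_distrib, ← Finset.sum_sub_distrib]
    refine (Finset.abs_sum_le_sum_abs _ _).trans ?_
    rw [← nsmul_eq_mul]
    refine Finset.sum_le_card_nsmul _ _ _ fun H hH => ?_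
    rw [← Finset.sum_mul, Finset.sum_sub_distrib, Finset.sum_const, nsmul_eq_mul, hcard]
    have hdeg := hR.switch.deg H hH a (hS ha)
    rw [← Finset.sum_sdiff hS] at hdeg
    have e1 : ∑ l ∈ U \ S, adjInd H l a = ∑ l ∈ U \ S, adjInd H a l :=
      Finset.sum_congr rfl fun l _ => adjInd_comm H l a
    have e2 : 0 ≤ ∑ l ∈ S, adjInd H a l := Finset.sum_nonneg fun l _ => adjInd_nonneg H a l
    have e3 : ∑ l ∈ S, adjInd H a l ≤ 10 := by
      calc _ ≤ ∑ l ∈ S, (1 : ℝ) := Finset.sum_le_sum fun l _ => adjInd_le_one H a l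
        _ = S.card := by simp
        _ ≤ 10 := hSc'
    have e4 := abs_le.1 (hR.dev a (hS ha))
    rw [e1, adjInd_comm H b a]
    have e5 := adjInd_nonneg H a b
    have e6 := adjInd_le_one H a b
    have e7 : L ^ 100 * (adjInd H a b * F H) - D * F H -
        ((L ^ 100 - S.card) * adjInd H a b - ∑ l ∈ U \ S, adjInd H a l) * F H =
        (S.card * adjInd H a b + (∑ l ∈ U \ S, adjInd H a l - D)) * F H := by ring
    rw [e7, abs_mul]
    have e8 : 0 ≤ S.card * adjInd H a b := by positivity
    have e9 : S.card * adjInd H a b ≤ 10 := by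
      calc _ ≤ (10 : ℝ) * 1 := by gcongr
        _ = 10 := by norm_num
    have e10 : |(S.card * adjInd H a b + (∑ l ∈ U \ S, adjInd H a l - D))| ≤ L ^ 51 + 20 := by
      rw [abs_le]
      constructor <;> linarith
    calc _ ≤ (L ^ 51 + 20) * 1 := by
          gcongr
          exact hF1 H hH
      _ = _ := by ring
  have htot : |L ^ 100 * (∑ H ∈ Ω, adjInd H a b * F H) - D * ∑ H ∈ Ω, F H| ≤
      Ω.card * L ^ 58 := by
    have t1 : ((U \ S).card : ℝ) * (Ω.card / L ^ 43) ≤ Ω.card * L ^ 57 := by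
      calc _ ≤ L ^ 100 * (Ω.card / L ^ 43) := by
            have : (0 : ℝ) ≤ S.card := by positivity
            gcongr
            linarith
        _ = _ := by field_simp
    have t2 := abs_le.1 hdiff
    have t3 := abs_le.1 (hsum.trans t1)
    have t4 : L ^ 57 + (L ^ 51 + 20) ≤ L ^ 58 := by
      have k1 := mul_pow_le_pow hL (show 57 < 58 by norm_num)
      have k2 := mul_pow_le_pow hL (show 51 < 57 by norm_num)
      have k3 : 1 ≤ L ^ 51 := one_le_pow₀ (by linarith)
      linarith
    have t5 : Ω.card * (L ^ 57 + (L ^ 51 + 20)) ≤ Ω.card * L ^ 58 := by gcongr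
    rw [abs_le]
    constructor <;> linarith
  have hfac : L ^ 100 * (∑ H ∈ Ω, adjInd H a b * F H) - D * ∑ H ∈ Ω, F H =
      L ^ 100 * (∑ H ∈ Ω, adjInd H a b * F H - D / L ^ 100 * ∑ H ∈ Ω, F H) := by
    field_simp
  rw [hfac, abs_mul, abs_of_pos (by positivity)] at htot
  refine le_of_mul_le_mul_left ?_ (show 0 < L ^ 58 by positivity)
  calc _ = L ^ 100 * |∑ H ∈ Ω, adjInd H a b * F H - D / L ^ 100 * ∑ H ∈ Ω, F H| := by ring
    _ ≤ _ := htot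
    _ = _ := by ring

/-- The sum comparing the symmetric differences of `a` and `l` with `b`. -/
def compSum (U : Finset V) (H : SimpleGraph V) (a l b : V) : ℝ :=
  ∑ w ∈ U \ {a, l, b}, (adjInd H a w - adjInd H l w) * (1 - 2 * adjInd H b w)

theorem abs_symDist_sub_le (H : SimpleGraph V) {a l b : V} (ha : a ∈ U) (hl : l ∈ U)
    (hab : a ≠ b) (hal : a ≠ l) (hlb : l ≠ b) :
    |symDist U H a b - symDist U H l b| ≤ |compSum U H a l b| + 1 := by
  have e1 : symDist U H a b = (adjInd H a l - adjInd H b l) ^ 2 +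
      ∑ w ∈ U \ {a, l, b}, (adjInd H a w - adjInd H b w) ^ 2 := by
    rw [symDist, show U \ {a, b} = insert l (U \ {a, l, b}) from ?_,
      Finset.sum_insert (by simp)]
    ext x
    simp only [Finset.mem_sdiff, Finset.mem_insert, Finset.mem_singleton, not_or]
    by_cases hx : x = l
    · subst hx; simp [hl, hal.symm, hlb]
    · tauto
  have e2 : symDist U H l b = (adjInd H l a - adjInd H b a) ^ 2 +
      ∑ w ∈ U \ {a, l, b}, (adjInd H l w - adjInd H b w) ^ 2 := by
    rw [symDist, show U \ {l, b} = insert a (U \ {a, l, b}) from ?_,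
      Finset.sum_insert (by simp)]
    ext x
    simp only [Finset.mem_sdiff, Finset.mem_insert, Finset.mem_singleton, not_or]
    by_cases hx : x = a
    · subst hx; simp [ha, hal, hab]
    · tauto
  have e3 : ∑ w ∈ U \ {a, l, b}, (adjInd H a w - adjInd H b w) ^ 2 -
      ∑ w ∈ U \ {a, l, b}, (adjInd H l w - adjInd H b w) ^ 2 = compSum U H a l b := by
    rw [compSum, ← Finset.sum_sub_distrib]
    refine Finset.sum_congr rfl fun w _ => ?_
    rcases adjInd_eq_zero_or_one H a w with h | h <;>
      rcases adjInd_eq_zero_or_one H l w with h' | h' <;> simp [h, h'] <;> ring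
  have e4 : symDist U H a b - symDist U H l b = compSum U H a l b +
      ((adjInd H a l - adjInd H b l) ^ 2 - (adjInd H l a - adjInd H b a) ^ 2) := by
    rw [e1, e2, ← e3]; ring
  rw [e4]
  refine (abs_add_le _ _).trans ?_
  gcongr
  have g1 := sq_adjInd_sub_le_one H a b l
  have g2 := sq_adjInd_sub_le_one H l b a
  rw [abs_le]
  constructor <;> linarith [sq_nonneg (adjInd H a l - adjInd H b l),
    sq_nonneg (adjInd H l a - adjInd H b a)]

theorem NearRegular.sum_compSum_sq (hR : NearRegular U d Ω L D) {a l b : V} (ha : a ∈ U)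
    (hl : l ∈ U) (hab : a ≠ b) (hal : a ≠ l) (hlb : l ≠ b) :
    ∑ H ∈ Ω, compSum U H a l b ^ 2 ≤ Ω.card * L ^ 158 := by
  have hL := hR.large
  have hL0 : 0 < L := by linarith
  have hT : ∀ (H : SimpleGraph V) (w : V), |1 - 2 * adjInd H b w| ≤ 1 := by
    intro H w
    rcases adjInd_eq_zero_or_one H b w with h | h <;> norm_num [h]
  have hX : ∀ (H : SimpleGraph V) (w : V), |adjInd H a w - adjInd H l w| ≤ 1 := by
    intro H w
    rw [← sq_le_one_iff_abs_le_one]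
    exact sq_adjInd_sub_le_one H a l w
  have hbd : ∀ w ∈ U \ {a, l, b}, ∀ w' ∈ U \ {a, l, b},
      ∑ H ∈ Ω, ((adjInd H a w - adjInd H l w) * (1 - 2 * adjInd H b w)) *
        ((adjInd H a w' - adjInd H l w') * (1 - 2 * adjInd H b w')) ≤
      Ω.card / L ^ 43 + if w = w' then (Ω.card : ℝ) else 0 := by
    intro w hw w' hw'
    simp only [Finset.mem_sdiff, Finset.mem_insert, Finset.mem_singleton, not_or] at hw hw'
    by_cases hww : w = w'
    · rw [if_pos hww]
      have : ∑ H ∈ Ω, ((adjInd H a w - adjInd H l w) * (1 - 2 * adjInd H b w)) *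
        ((adjInd H a w' - adjInd H l w') * (1 - 2 * adjInd H b w')) ≤ Ω.card • (1 : ℝ) := by
        refine Finset.sum_le_card_nsmul _ _ _ fun H _ => ?_
        refine (le_abs_self _).trans ?_
        rw [abs_mul, abs_mul, abs_mul]
        exact mul_le_one₀ (mul_le_one₀ (hX _ _) (abs_nonneg _) (hT _ _)) (by positivity)
          (mul_le_one₀ (hX _ _) (abs_nonneg _) (hT _ _))
      rw [nsmul_eq_mul, mul_one] at this
      have : (0 : ℝ) ≤ Ω.card / L ^ 43 := by positivity
      linarith
    · rw [if_neg hww, add_zero, le_div_iff₀ (by positivity), mul_comm]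
      have key := hR.abs_sum_sub_mul_le (Q := {w'}) ha hl hw.1 hal (Ne.symm hw.2.1)
        (Ne.symm hw.2.2.1) (by
          intro x hx
          rw [Finset.mem_singleton] at hx
          subst hx
          simp only [Finset.mem_sdiff, Finset.mem_insert, Finset.mem_singleton, not_or]
          exact ⟨hw'.1, hw'.2.1, hw'.2.2.1, Ne.symm hww⟩) (by simp)
        (fun H => (1 - 2 * adjInd H b w) *
          ((adjInd H a w' - adjInd H l w') * (1 - 2 * adjInd H b w'))) (by
          intro H _
          rw [abs_mul, abs_mul]
          exact mul_le_one₀ (hT _ _) (by positivity)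
            (mul_le_one₀ (hX _ _) (abs_nonneg _) (hT _ _))) (by
          intro H _ u hu _ _ _ _
          simp only [Finset.mem_sdiff, Finset.mem_insert, Finset.mem_singleton, not_or] at hu
          rw [adjInd_toggle_of_not, adjInd_toggle_of_not, adjInd_toggle_of_not,
            adjInd_toggle_of_not]
          all_goals
            rintro (⟨h | h, h' | h'⟩ | ⟨h | h, h' | h'⟩) <;> first
              | exact hab h.symm | exact hlb h.symm | exact hw.2.1 h' | exact hw.2.2.1 h'
              | exact hw'.2.1 h' | exact hw'.2.2.1 h' | exact hww h'.symm | exact hu.2 h'.symm)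
      refine le_trans ?_ key
      gcongr
      refine le_trans (le_of_eq ?_) (le_abs_self _)
      exact Finset.sum_congr rfl fun H _ => by ring
  calc ∑ H ∈ Ω, compSum U H a l b ^ 2 = ∑ w ∈ U \ {a, l, b}, ∑ w' ∈ U \ {a, l, b},
      ∑ H ∈ Ω, ((adjInd H a w - adjInd H l w) * (1 - 2 * adjInd H b w)) *
        ((adjInd H a w' - adjInd H l w') * (1 - 2 * adjInd H b w')) := by
        simp_rw [compSum, sq, Finset.sum_mul_sum]
        rw [Finset.sum_comm]
        exact Finset.sum_congr rfl fun w _ => Finset.sum_comm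
    _ ≤ ∑ w ∈ U \ {a, l, b}, ∑ w' ∈ U \ {a, l, b},
        (Ω.card / L ^ 43 + if w = w' then (Ω.card : ℝ) else 0) :=
        Finset.sum_le_sum fun w hw => Finset.sum_le_sum fun w' hw' => hbd w hw w' hw'
    _ ≤ ∑ w ∈ U, ∑ w' ∈ U, (Ω.card / L ^ 43 + if w = w' then (Ω.card : ℝ) else 0) := by
        refine (Finset.sum_le_sum fun w _ => Finset.sum_le_sum_of_subset_of_nonneg
          Finset.sdiff_subset fun _ _ _ => by positivity).trans
          (Finset.sum_le_sum_of_subset_of_nonneg Finset.sdiff_subset fun _ _ _ =>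
            Finset.sum_nonneg fun _ _ => by positivity)
    _ = Ω.card * (L ^ 157 + L ^ 100) := by
        simp only [Finset.sum_add_distrib, Finset.sum_const, nsmul_eq_mul, Finset.sum_ite_eq]
        rw [Finset.sum_ite_mem, Finset.inter_self, Finset.sum_const, nsmul_eq_mul, hR.card]
        field_simp
    _ ≤ Ω.card * L ^ 158 := by
        have k1 := mul_pow_le_pow hL (show 157 < 158 by norm_num)
        have k2 := mul_pow_le_pow hL (show 100 < 157 by norm_num)
        have : 0 ≤ L ^ 100 := by positivity
        gcongr
        linarith

theorem NearRegular.sum_abs_compSum (hR : NearRegular U d Ω L D) {a l b : V} (ha : a ∈ U)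
    (hl : l ∈ U) (hab : a ≠ b) (hal : a ≠ l) (hlb : l ≠ b) :
    ∑ H ∈ Ω, |compSum U H a l b| ≤ Ω.card * L ^ 79 := by
  have hL0 : 0 < L := by linarith [hR.large]
  have h1 := hR.sum_compSum_sq ha hl hab hal hlb
  have h2 : ∀ H ∈ Ω, |compSum U H a l b| ≤
      compSum U H a l b ^ 2 / (2 * L ^ 79) + L ^ 79 / 2 := by
    intro H _
    have hp : 0 < L ^ 79 := by positivity
    rw [← sub_nonneg, ← sq_abs]
    have : |compSum U H a l b| ^ 2 / (2 * L ^ 79) + L ^ 79 / 2 - |compSum U H a l b| =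
        (|compSum U H a l b| - L ^ 79) ^ 2 / (2 * L ^ 79) := by field_simp; ring
    rw [this]
    positivity
  refine (Finset.sum_le_sum h2).trans ?_
  rw [Finset.sum_add_distrib, ← Finset.sum_div, Finset.sum_const, nsmul_eq_mul]
  have h3 : (∑ H ∈ Ω, compSum U H a l b ^ 2) / (2 * L ^ 79) ≤ Ω.card * L ^ 79 / 2 := by
    rw [div_le_iff₀ (by positivity)]
    refine h1.trans (le_of_eq ?_)
    ring
  linarith

theorem NearRegular.sum_symDist (hR : NearRegular U d Ω L D) {H : SimpleGraph V} (hH : H ∈ Ω)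
    {b : V} (hb : b ∈ U) :
    ∑ l ∈ U \ {b}, symDist U H l b =
      L ^ 100 * D + (L ^ 100 - 2) * d b - 2 * ∑ w ∈ U, adjInd H b w * d w := by
  have hdeg := hR.switch.deg H hH
  have hbU : ({b} : Finset V) ⊆ U := by simpa using hb
  have hdeg' : ∀ w ∈ U, ∑ l ∈ U \ {b}, adjInd H w l = d w - adjInd H w b := by
    intro w hw
    rw [← hdeg w hw, ← Finset.sum_sdiff hbU]
    simp
  have hd' : ∑ l ∈ U \ {b}, d l = L ^ 100 * D - d b := by
    rw [← hR.mean, ← Finset.sum_sdiff hbU]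
    simp
  have e1 : ∀ l ∈ U \ {b}, symDist U H l b =
      (∑ w ∈ U \ {b}, (adjInd H l w + adjInd H b w - 2 * (adjInd H b w * adjInd H w l))) -
        adjInd H b l := by
    intro l hl
    simp only [Finset.mem_sdiff, Finset.mem_singleton] at hl
    have : U \ {b} = insert l (U \ {l, b}) := by
      ext x
      simp only [Finset.mem_sdiff, Finset.mem_insert, Finset.mem_singleton, not_or]
      by_cases hx : x = l
      · subst hx; simp [hl]
      · tauto
    rw [this, Finset.sum_insert (by simp), adjInd_self, symDist]
    have : ∑ w ∈ U \ {l, b}, (adjInd H l w - adjInd H b w) ^ 2 = ∑ w ∈ U \ {l, b},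
        (adjInd H l w + adjInd H b w - 2 * (adjInd H b w * adjInd H w l)) := by
      refine Finset.sum_congr rfl fun w _ => ?_
      rw [adjInd_comm H w l]
      rcases adjInd_eq_zero_or_one H l w with h | h <;>
        rcases adjInd_eq_zero_or_one H b w with h' | h' <;> (simp [h, h']; try norm_num)
    rw [this]
    ring
  have hcard : ((U \ {b}).card : ℝ) = L ^ 100 - 1 := by
    rw [Finset.card_sdiff_of_subset hbU, Nat.cast_sub (Finset.card_le_card hbU), hR.card]
    simp
  rw [Finset.sum_congr rfl e1, Finset.sum_sub_distrib, hdeg' b hb, adjInd_self]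
  have e2 : ∑ l ∈ U \ {b}, ∑ w ∈ U \ {b},
      (adjInd H l w + adjInd H b w - 2 * (adjInd H b w * adjInd H w l)) =
      (∑ l ∈ U \ {b}, (d l - adjInd H l b)) + (L ^ 100 - 1) * d b -
        2 * ∑ w ∈ U \ {b}, adjInd H b w * (d w - adjInd H w b) := by
    simp only [Finset.sum_sub_distrib, Finset.sum_add_distrib]
    congr 1
    · congr 1
      · rw [← Finset.sum_sub_distrib]
        exact Finset.sum_congr rfl fun l hl => hdeg' l (Finset.mem_sdiff.1 hl).1
      · rw [Finset.sum_const, nsmul_eq_mul, hcard, hdeg' b hb, adjInd_self, sub_zero]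
    · rw [Finset.sum_comm, Finset.mul_sum]
      refine Finset.sum_congr rfl fun w hw => ?_
      rw [← Finset.mul_sum, ← Finset.mul_sum, hdeg' w (Finset.mem_sdiff.1 hw).1]
  have e3 : ∑ l ∈ U \ {b}, (d l - adjInd H l b) = L ^ 100 * D - d b - d b := by
    rw [Finset.sum_sub_distrib, hd']
    congr 1
    rw [Finset.sum_congr rfl fun l _ => adjInd_comm H l b, hdeg' b hb, adjInd_self, sub_zero]
  have e4 : ∑ w ∈ U \ {b}, adjInd H b w * (d w - adjInd H w b) =
      ∑ w ∈ U, adjInd H b w * d w - d b := by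
    rw [← Finset.sum_sdiff (s₂ := U) hbU, Finset.sum_singleton, adjInd_self, zero_mul, add_zero]
    have : d b = ∑ w ∈ U \ {b}, adjInd H b w := by rw [hdeg' b hb, adjInd_self, sub_zero]
    conv_rhs => rw [this]
    rw [← Finset.sum_sub_distrib]
    refine Finset.sum_congr rfl fun w _ => ?_
    rw [adjInd_comm H w b]
    rcases adjInd_eq_zero_or_one H b w with h | h <;> simp [h]
  rw [e2, e3, e4]
  ring

/-- The typical size of a symmetric difference. -/
def symMean (L D : ℝ) : ℝ := 2 * D * (L ^ 100 - D) / L ^ 100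

theorem NearRegular.sum_abs_symDist_sub (hR : NearRegular U d Ω L D) {a b : V} (ha : a ∈ U)
    (hb : b ∈ U) (hab : a ≠ b) :
    ∑ H ∈ Ω, |symDist U H a b - symMean L D| ≤ Ω.card * L ^ 80 := by
  have hL := hR.large
  have hL0 : 0 < L := by linarith
  have hbU : ({a, b} : Finset V) ⊆ U := by
    intro x hx
    simp only [Finset.mem_insert, Finset.mem_singleton] at hx
    rcases hx with rfl | rfl <;> assumption
  have hins : U \ {b} = insert a (U \ {a, b}) := by
    ext x
    simp only [Finset.mem_sdiff, Finset.mem_insert, Finset.mem_singleton, not_or]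
    by_cases hx : x = a
    · subst hx; simp [ha, hab]
    · tauto
  have hcard : ((U \ {a, b}).card : ℝ) = L ^ 100 - 2 := by
    rw [Finset.card_sdiff_of_subset hbU, Nat.cast_sub (Finset.card_le_card hbU), hR.card,
      Finset.card_pair hab]
    simp
  have hp99 : 0 < L ^ 99 := by positivity
  have hp51 : 1 ≤ L ^ 51 := one_le_pow₀ (by linarith)
  have hD0 : 0 ≤ D := by linarith [hR.lower]
  have hD1 : D ≤ L ^ 100 := by linarith [hR.upper]
  have hdb := abs_le.1 (hR.dev b hb)
  have k1 := mul_pow_le_pow hL (show 51 < 100 by norm_num)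
  have hpt : ∀ H ∈ Ω, L ^ 100 * |symDist U H a b - symMean L D| ≤
      (∑ l ∈ U \ {a, b}, (|compSum U H a l b| + 1)) + L ^ 100 * L ^ 52 := by
    intro H hH
    have hs := hR.sum_symDist hH hb
    rw [hins, Finset.sum_insert (by simp)] at hs
    have hs0 := symDist_nonneg (U := U) H a b
    have hs1 : symDist U H a b ≤ L ^ 100 := by
      rw [← hR.card]
      calc symDist U H a b ≤ ∑ w ∈ U \ {a, b}, (1 : ℝ) :=
            Finset.sum_le_sum fun w _ => sq_adjInd_sub_le_one H a b w
        _ = (U \ {a, b}).card := by simp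
        _ ≤ U.card := by exact_mod_cast Finset.card_le_card Finset.sdiff_subset
    have hdiff : |∑ l ∈ U \ {a, b}, (symDist U H a b - symDist U H l b)| ≤
        ∑ l ∈ U \ {a, b}, (|compSum U H a l b| + 1) := by
      refine (Finset.abs_sum_le_sum_abs _ _).trans (Finset.sum_le_sum fun l hl => ?_)
      simp only [Finset.mem_sdiff, Finset.mem_insert, Finset.mem_singleton, not_or] at hl
      exact abs_symDist_sub_le H ha hl.1 hab (Ne.symm hl.2.1) hl.2.2
    rw [Finset.sum_sub_distrib, Finset.sum_const, nsmul_eq_mul, hcard] at hdiff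
    have hw : |∑ w ∈ U, adjInd H b w * d w - D * d b| ≤ L ^ 100 * L ^ 51 := by
      rw [← hR.switch.deg H hH b hb, Finset.mul_sum, ← Finset.sum_sub_distrib]
      refine (Finset.abs_sum_le_sum_abs _ _).trans ?_
      rw [← hR.card, ← nsmul_eq_mul]
      refine Finset.sum_le_card_nsmul _ _ _ fun w hw => ?_
      have : adjInd H b w * d w - D * adjInd H b w = adjInd H b w * (d w - D) := by ring
      rw [this, abs_mul, abs_of_nonneg (adjInd_nonneg H b w)]
      exact (mul_le_of_le_one_left (abs_nonneg _) (adjInd_le_one H b w)).trans (hR.dev w hw)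
    have hw' := abs_le.1 hw
    have hDd : |D * (d b - D)| ≤ L ^ 100 * L ^ 51 := by
      rw [abs_mul, abs_of_nonneg hD0]
      have := hR.dev b hb
      gcongr
    have hDd' := abs_le.1 hDd
    have hNd : |L ^ 100 * (d b - D)| ≤ L ^ 100 * L ^ 51 := by
      rw [abs_mul, abs_of_nonneg (by positivity)]
      have := hR.dev b hb
      gcongr
    have hNd' := abs_le.1 hNd
    have hK : L ^ 100 * symMean L D = 2 * D * (L ^ 100 - D) := by
      unfold symMean; field_simp
    have k2 := mul_pow_le_pow hL (show 51 < 52 by norm_num)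
    have k3 : L ^ 100 * (1000000 * L ^ 51) ≤ L ^ 100 * L ^ 52 := by gcongr
    have k4 : L ^ 100 * 1 ≤ L ^ 100 * L ^ 51 := by gcongr
    have hdiff' := abs_le.1 hdiff
    have hfin : |L ^ 100 * symDist U H a b - L ^ 100 * symMean L D| ≤
        (∑ l ∈ U \ {a, b}, (|compSum U H a l b| + 1)) + L ^ 100 * L ^ 52 := by
      rw [hK, abs_le]
      constructor <;> linarith
    rw [← mul_sub, abs_mul, abs_of_nonneg (by positivity)] at hfin
    exact hfin
  have hsum := Finset.sum_le_sum hpt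
  rw [← Finset.mul_sum, Finset.sum_add_distrib, Finset.sum_comm, Finset.sum_const,
    nsmul_eq_mul] at hsum
  have hb2 : ∑ l ∈ U \ {a, b}, ∑ H ∈ Ω, (|compSum U H a l b| + 1) ≤
      L ^ 100 * (Ω.card * (L ^ 79 + 1)) := by
    calc _ ≤ ∑ l ∈ U \ {a, b}, (Ω.card * (L ^ 79 + 1) : ℝ) := by
          refine Finset.sum_le_sum fun l hl => ?_
          simp only [Finset.mem_sdiff, Finset.mem_insert, Finset.mem_singleton, not_or] at hl
          rw [Finset.sum_add_distrib, Finset.sum_const, nsmul_eq_mul, mul_add]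
          gcongr
          exact hR.sum_abs_compSum ha hl.1 hab (Ne.symm hl.2.1) hl.2.2
      _ = (U \ {a, b}).card * (Ω.card * (L ^ 79 + 1) : ℝ) := by simp
      _ ≤ _ := by
          gcongr
          linarith
  refine le_of_mul_le_mul_left (hsum.trans ((add_le_add_left hb2 _).trans ?_))
    (show 0 < L ^ 100 by positivity)
  have k5 : L ^ 79 + 1 + L ^ 52 ≤ L ^ 80 := by
    have k1 := mul_pow_le_pow hL (show 79 < 80 by norm_num)
    have k2 := mul_pow_le_pow hL (show 52 < 79 by norm_num)
    have k3 : 1 ≤ L ^ 52 := one_le_pow₀ (by linarith)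
    linarith
  calc _ = L ^ 100 * (Ω.card * (L ^ 79 + 1 + L ^ 52)) := by ring
    _ ≤ _ := by gcongr

end Concentration

section EdgeProbability

set_option linter.unusedSectionVars false

variable {V : Type*} [DecidableEq V] {U : Finset V} {d : V → ℝ} {Ω : Finset (SimpleGraph V)}
  {L D : ℝ}

/-- A polynomial in the four edges of the four-cycle `a b a' l`. -/
def cycleWeight (H : SimpleGraph V) (a a' b l : V) : ℝ :=
  (adjInd H a b - adjInd H a' b) ^ 2 * (1 - adjInd H a l - adjInd H a' l) +
    (adjInd H a l - adjInd H a' l) ^ 2 * (1 - adjInd H a b - adjInd H a' b)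

theorem one_sub_sub_eq_zero {H : SimpleGraph V} {a b a' b' : V}
    (h : adjInd H a b ≠ adjInd H a' b') : 1 - adjInd H a b - adjInd H a' b' = 0 := by
  rcases adjInd_eq_zero_or_one H a b with h1 | h1 <;>
    rcases adjInd_eq_zero_or_one H a' b' with h2 | h2 <;> simp_all

/-- The switchings on a pair preserve the vanishing of `1 - h - h'` at every other vertex. -/
theorem one_sub_sub_toggle {H : SimpleGraph V} {a a' b l u : V} (hal : a ≠ l) (hal' : a' ≠ l)
    (hbl : b ≠ l) (h : adjInd H a l ≠ adjInd H a' l) :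
    1 - adjInd (toggle H a a' b u) a l - adjInd (toggle H a a' b u) a' l = 0 := by
  have h0 := one_sub_sub_eq_zero h
  by_cases hul : l = u
  · rw [adjInd_toggle_of H hal (by tauto), adjInd_toggle_of H hal' (by tauto)]
    linarith
  · rw [adjInd_toggle_of_not H, adjInd_toggle_of_not H, h0]
    all_goals
      rintro (⟨-, h' | h'⟩ | ⟨-, h' | h'⟩)
      exacts [hbl h'.symm, hul h', hal h'.symm, hal' h'.symm]

theorem symDist_toggle_of_eq (H : SimpleGraph V) {a a' b l u : V} (haa : a ≠ a') (hab : a ≠ b)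
    (hal : a ≠ l) (hab' : a' ≠ b) (hal' : a' ≠ l) (hbl : b ≠ l) (ha : a ∈ U) (ha' : a' ∈ U)
    (hul : u ≠ l) (h1 : H.Adj a b) (h2 : ¬ H.Adj a' b)
    (hz : adjInd H a l = adjInd H a' l) :
    symDist U (toggle H a a' b u) b l = symDist U H b l := by
  have hsub : ({a, a'} : Finset V) ⊆ U \ {b, l} := by
    intro x hx
    simp only [Finset.mem_insert, Finset.mem_singleton, Finset.mem_sdiff, not_or] at hx ⊢
    rcases hx with rfl | rfl
    · exact ⟨ha, hab, hal⟩
    · exact ⟨ha', hab', hal'⟩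
  have hl : ∀ z, adjInd (toggle H a a' b u) l z = adjInd H l z := by
    intro z
    refine adjInd_toggle_of_not H ?_
    rintro (⟨h | h, -⟩ | ⟨h | h, -⟩)
    exacts [hal h.symm, hal' h.symm, hbl h.symm, hul h.symm]
  have hb : ∀ z, z ≠ a → z ≠ a' → adjInd (toggle H a a' b u) b z = adjInd H b z := by
    intro z hz hz'
    refine adjInd_toggle_of_not H ?_
    rintro (⟨h | h, -⟩ | ⟨-, h | h⟩)
    exacts [hab h.symm, hab' h.symm, hz h, hz' h]
  rw [symDist, symDist, ← Finset.sum_sdiff hsub, ← Finset.sum_sdiff hsub (f := fun w =>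
    (adjInd H b w - adjInd H l w) ^ 2), Finset.sum_pair haa, Finset.sum_pair haa]
  congr 1
  · refine Finset.sum_congr rfl fun z hz => ?_
    simp only [Finset.mem_sdiff, Finset.mem_insert, Finset.mem_singleton, not_or] at hz
    rw [hl, hb z hz.2.1 hz.2.2]
  · rw [hl, hl, adjInd_toggle_of H hab.symm (by tauto), adjInd_toggle_of H hab'.symm (by tauto),
      adjInd_comm H b a, adjInd_comm H b a', adjInd_comm H l a, adjInd_comm H l a', hz]
    simp only [adjInd, h1, h2, if_true, if_false]
    ring

theorem SwitchFamily.sum_alternating (hΩ : SwitchFamily U d Ω) {a a' b l : V} (ha : a ∈ U)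
    (ha' : a' ∈ U) (hb : b ∈ U) (hl : l ∈ U) (haa : a ≠ a') (hab : a ≠ b)
    (hal : a ≠ l) (hab' : a' ≠ b) (hal' : a' ≠ l) (hbl : b ≠ l) :
    ∑ H ∈ Ω, (adjInd H a b - adjInd H a l - adjInd H a' b + adjInd H a' l) =
      (d b - d l) * (d a - d a') *
        ∑ H ∈ Ω, cycleWeight H a a' b l / (symDist U H b l * symDist U H a a') := by
  have e1 := hΩ.sum_sub_eq hb hl ha hbl hab.symm hal.symm (fun _ => 1) (by intros; rfl)
  have e2 := hΩ.sum_sub_eq hb hl ha' hbl hab'.symm hal'.symm (fun _ => 1) (by intros; rfl)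
  have e3 := hΩ.sum_sub_eq ha ha' hb haa hab hab'
    (fun H => (1 - adjInd H a l - adjInd H a' l) / symDist U H b l) (by
      intro H hH u hu h1 h2 h3 g1 g2 g3 g4
      by_cases hz : adjInd H a l = adjInd H a' l
      · have hul : u ≠ l := by
          rintro rfl
          simp [adjInd, g3, g4] at hz
        rw [symDist_toggle_of_eq H haa hab hal hab' hal' hbl ha ha' hul g1 g2 hz,
          adjInd_toggle_of_not, adjInd_toggle_of_not]
        all_goals
          rintro (⟨h | h, h' | h'⟩ | ⟨h | h, h' | h'⟩) <;> first
            | exact hbl h'.symm | exact hul h'.symm | exact hal h'.symm | exact hal' h'.symm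
      · rw [one_sub_sub_eq_zero hz, one_sub_sub_toggle hal hal' hbl hz, zero_div, zero_div])
  have e4 := hΩ.sum_sub_eq ha ha' hl haa hal hal'
    (fun H => (1 - adjInd H a b - adjInd H a' b) / symDist U H b l) (by
      intro H hH u hu h1 h2 h3 g1 g2 g3 g4
      by_cases hz : adjInd H a b = adjInd H a' b
      · have hul : u ≠ b := by
          rintro rfl
          simp [adjInd, g3, g4] at hz
        rw [symDist_comm, symDist_toggle_of_eq H haa hal hab hal' hab' hbl.symm ha ha' hul g1 g2 hz,
          symDist_comm, adjInd_toggle_of_not, adjInd_toggle_of_not]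
        all_goals
          rintro (⟨h | h, h' | h'⟩ | ⟨h | h, h' | h'⟩) <;> first
            | exact hbl h' | exact hul h'.symm | exact hab h'.symm | exact hab' h'.symm
      · rw [one_sub_sub_eq_zero hz, one_sub_sub_toggle hab hab' hbl.symm hz, zero_div, zero_div])
  simp only [mul_one] at e1 e2
  have r1 : ∑ H ∈ Ω, (adjInd H a b - adjInd H a l - adjInd H a' b + adjInd H a' l) =
      (∑ H ∈ Ω, (adjInd H b a - adjInd H l a)) - ∑ H ∈ Ω, (adjInd H b a' - adjInd H l a') := by
    rw [← Finset.sum_sub_distrib]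
    refine Finset.sum_congr rfl fun H _ => ?_
    rw [adjInd_comm H b a, adjInd_comm H l a, adjInd_comm H b a', adjInd_comm H l a']
    ring
  have r2 : (∑ H ∈ Ω, (adjInd H b a - adjInd H l a) ^ 2 * ((d b - d l) / symDist U H b l)) -
      ∑ H ∈ Ω, (adjInd H b a' - adjInd H l a') ^ 2 * ((d b - d l) / symDist U H b l) =
      (d b - d l) *
      ((∑ H ∈ Ω, (adjInd H a b - adjInd H a' b) *
          ((1 - adjInd H a l - adjInd H a' l) / symDist U H b l)) +
        ∑ H ∈ Ω, (adjInd H a l - adjInd H a' l) *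
          ((1 - adjInd H a b - adjInd H a' b) / symDist U H b l)) := by
    rw [← Finset.sum_sub_distrib, ← Finset.sum_add_distrib, Finset.mul_sum]
    refine Finset.sum_congr rfl fun H _ => ?_
    rw [adjInd_comm H b a, adjInd_comm H l a, adjInd_comm H b a', adjInd_comm H l a']
    have : (adjInd H a b - adjInd H a l) ^ 2 - (adjInd H a' b - adjInd H a' l) ^ 2 =
        (adjInd H a b - adjInd H a' b) * (1 - adjInd H a l - adjInd H a' l) +
        (adjInd H a l - adjInd H a' l) * (1 - adjInd H a b - adjInd H a' b) := by
      rcases adjInd_eq_zero_or_one H a b with h1 | h1 <;>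
        rcases adjInd_eq_zero_or_one H a l with h2 | h2 <;>
        rcases adjInd_eq_zero_or_one H a' b with h3 | h3 <;>
        rcases adjInd_eq_zero_or_one H a' l with h4 | h4 <;> simp [h1, h2, h3, h4]
    linear_combination (d b - d l) / symDist U H b l * this
  rw [r1, e1, e2, r2, e3, e4, mul_assoc, ← Finset.sum_add_distrib]
  congr 1
  rw [Finset.mul_sum]
  refine Finset.sum_congr rfl fun H _ => ?_
  unfold cycleWeight
  rw [div_eq_mul_inv, div_eq_mul_inv, div_eq_mul_inv, div_eq_mul_inv, mul_inv]
  ring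

theorem abs_cycleWeight_le_one (H : SimpleGraph V) (a a' b l : V) :
    |cycleWeight H a a' b l| ≤ 1 := by
  unfold cycleWeight
  rcases adjInd_eq_zero_or_one H a b with h1 | h1 <;>
    rcases adjInd_eq_zero_or_one H a l with h2 | h2 <;>
    rcases adjInd_eq_zero_or_one H a' b with h3 | h3 <;>
    rcases adjInd_eq_zero_or_one H a' l with h4 | h4 <;> norm_num [h1, h2, h3, h4]

theorem symDist_eq_zero_or_one_le (H : SimpleGraph V) (v v' : V) :
    symDist U H v v' = 0 ∨ 1 ≤ symDist U H v v' := by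
  by_cases h : ∃ w ∈ U \ {v, v'}, (adjInd H v w - adjInd H v' w) ^ 2 ≠ 0
  · obtain ⟨w, hw, h⟩ := h
    right
    simp only [Finset.mem_sdiff, Finset.mem_insert, Finset.mem_singleton, not_or] at hw
    have h1 := sq_sub_le_symDist H hw.1 (Ne.symm hw.2.1) (Ne.symm hw.2.2)
    have h2 : (adjInd H v w - adjInd H v' w) ^ 2 = 1 := by
      rcases adjInd_eq_zero_or_one H v w with h1 | h1 <;>
        rcases adjInd_eq_zero_or_one H v' w with h2 | h2 <;> simp_all
    linarith
  · push Not at h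
    exact Or.inl (Finset.sum_eq_zero h)

theorem symDist_le_card (H : SimpleGraph V) (v v' : V) : symDist U H v v' ≤ U.card := by
  calc symDist U H v v' ≤ ∑ w ∈ U \ {v, v'}, (1 : ℝ) :=
        Finset.sum_le_sum fun w _ => sq_adjInd_sub_le_one H v v' w
    _ = (U \ {v, v'}).card := by simp
    _ ≤ U.card := by exact_mod_cast Finset.card_le_card Finset.sdiff_subset

theorem NearRegular.sum_cycleWeight (hR : NearRegular U d Ω L D) {a a' b l : V} (ha : a ∈ U)
    (ha' : a' ∈ U) (hb : b ∈ U) (hl : l ∈ U) (haa : a ≠ a') (hab : a ≠ b)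
    (hal : a ≠ l) (hab' : a' ≠ b) (hal' : a' ≠ l) (hbl : b ≠ l) {p : ℝ} (hp : p = D / L ^ 100) :
    |∑ H ∈ Ω, cycleWeight H a a' b l - 4 * p * (1 - p) * (1 - 2 * p) * Ω.card| ≤
      52 * (Ω.card / L ^ 42) := by
  have hL := hR.large
  have hL0 : 0 < L := by linarith
  have hp99 : 0 < L ^ 99 := by positivity
  have hp0 : 0 ≤ p := by
    rw [hp]
    have : 0 ≤ D := by linarith [hR.lower]
    positivity
  have hp1 : p ≤ 1 := by
    rw [hp, div_le_one (by positivity)]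
    linarith [hR.upper]
  set S : Finset V := {a, a', b, l} with hS
  have hSU : S ⊆ U := by
    intro x hx
    simp only [hS, Finset.mem_insert, Finset.mem_singleton] at hx
    rcases hx with rfl | rfl | rfl | rfl <;> assumption
  have hSc : S.card ≤ 10 := by
    refine (Finset.card_le_four).trans (by norm_num)
  set η : ℝ := Ω.card / L ^ 42 with hη
  have hη0 : 0 ≤ η := by positivity
  have dec : ∀ {x y : V}, x ∈ S → y ∈ S → x ≠ y → ∀ F : SimpleGraph V → ℝ,
      (∀ H ∈ Ω, |F H| ≤ 1) →
      (∀ H ∈ Ω, ∀ l ∈ U \ S, ∀ u ∈ U \ S, l ≠ u → F (toggle H y l x u) = F H) →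
      |∑ H ∈ Ω, adjInd H x y * F H - p * ∑ H ∈ Ω, F H| ≤ η := by
    intro x y hx hy hxy F hF1 hF
    rw [hη, le_div_iff₀ (by positivity), mul_comm, hp]
    exact hR.decorrelate hSU hSc hx hy hxy F hF1 hF
  have inv : ∀ {x y x' y' : V}, x' ∈ S → y' ∈ S → ¬ (x' = x ∧ y' = y) → ¬ (x' = y ∧ y' = x) →
      ∀ H : SimpleGraph V, ∀ l ∈ U \ S, ∀ u ∈ U \ S,
      adjInd (toggle H y l x u) x' y' = adjInd H x' y' := by
    intro x y x' y' hx' hy' h1 h2 H l hl u hu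
    refine adjInd_toggle_of_not H ?_
    have hl' := (Finset.mem_sdiff.1 hl).2
    have hu' := (Finset.mem_sdiff.1 hu).2
    rintro (⟨h | h, h' | h'⟩ | ⟨h | h, h' | h'⟩)
    · exact h2 ⟨h, h'⟩
    · exact hu' (h' ▸ hy')
    · exact hl' (h ▸ hx')
    · exact hl' (h ▸ hx')
    · exact h1 ⟨h, h'⟩
    · exact hl' (h' ▸ hy')
    · exact hu' (h ▸ hx')
    · exact hu' (h ▸ hx')
  have a1 : ∀ (H : SimpleGraph V) (x y : V), |adjInd H x y| ≤ 1 := fun H x y => by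
    rw [abs_of_nonneg (adjInd_nonneg H x y)]; exact adjInd_le_one H x y
  have a2 : ∀ (H : SimpleGraph V) (x y x' y' : V), |adjInd H x y * adjInd H x' y'| ≤ 1 :=
    fun H x y x' y' => by
      rw [abs_mul]; exact mul_le_one₀ (a1 _ _ _) (abs_nonneg _) (a1 _ _ _)
  have one : ∀ {x y : V}, x ∈ S → y ∈ S → x ≠ y →
      |∑ H ∈ Ω, adjInd H x y - p * Ω.card| ≤ η := by
    intro x y hx hy hxy
    have := dec hx hy hxy (fun _ => 1) (by simp) (by simp)
    simpa using this
  have two : ∀ {x y x' y' : V}, x ∈ S → y ∈ S → x ≠ y → x' ∈ S → y' ∈ S → x' ≠ y' →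
      ¬ (x' = x ∧ y' = y) → ¬ (x' = y ∧ y' = x) →
      |∑ H ∈ Ω, adjInd H x y * adjInd H x' y' - p ^ 2 * Ω.card| ≤ 2 * η := by
    intro x y x' y' hx hy hxy hx' hy' hxy' n1 n2
    have g1 := dec hx hy hxy (fun H => adjInd H x' y') (fun H _ => a1 H _ _)
      (fun H _ l hl u hu _ => inv hx' hy' n1 n2 H l hl u hu)
    have g2 := one hx' hy' hxy'
    have g3 : |p * (∑ H ∈ Ω, adjInd H x' y' - p * Ω.card)| ≤ η := by
      rw [abs_mul, abs_of_nonneg hp0]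
      exact (mul_le_of_le_one_left (abs_nonneg _) hp1).trans g2
    rw [abs_le] at *
    constructor <;> linarith
  have three : ∀ {x y x' y' x'' y'' : V}, x ∈ S → y ∈ S → x ≠ y → x' ∈ S → y' ∈ S → x' ≠ y' →
      x'' ∈ S → y'' ∈ S → x'' ≠ y'' →
      ¬ (x' = x ∧ y' = y) → ¬ (x' = y ∧ y' = x) → ¬ (x'' = x ∧ y'' = y) → ¬ (x'' = y ∧ y'' = x) →
      ¬ (x'' = x' ∧ y'' = y') → ¬ (x'' = y' ∧ y'' = x') →
      |∑ H ∈ Ω, adjInd H x y * (adjInd H x' y' * adjInd H x'' y'') - p ^ 3 * Ω.card| ≤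
        3 * η := by
    intro x y x' y' x'' y'' hx hy hxy hx' hy' hxy' hx'' hy'' hxy'' n1 n2 n3 n4 n5 n6
    have g1 := dec hx hy hxy (fun H => adjInd H x' y' * adjInd H x'' y'') (fun H _ => a2 H _ _ _ _)
      (fun H _ l hl u hu _ => by
        rw [inv hx' hy' n1 n2 H l hl u hu, inv hx'' hy'' n3 n4 H l hl u hu])
    have g2 := two hx' hy' hxy' hx'' hy'' hxy'' n5 n6
    have g3 : |p * (∑ H ∈ Ω, adjInd H x' y' * adjInd H x'' y'' - p ^ 2 * Ω.card)| ≤ 2 * η := by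
      rw [abs_mul, abs_of_nonneg hp0]
      exact (mul_le_of_le_one_left (abs_nonneg _) hp1).trans g2
    rw [abs_le] at *
    constructor <;> linarith
  have ma : a ∈ S := by simp [hS]
  have ma' : a' ∈ S := by simp [hS]
  have mb : b ∈ S := by simp [hS]
  have ml : l ∈ S := by simp [hS]
  have x1 := abs_le.1 (one ma mb hab)
  have x2 := abs_le.1 (one ma' mb hab')
  have x3 := abs_le.1 (one ma ml hal)
  have x4 := abs_le.1 (one ma' ml hal')
  have haa' := haa.symm
  have hbl' := hbl.symm
  have y1 := abs_le.1 (two ma mb hab ma' mb hab' (by tauto) (by tauto))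
  have y2 := abs_le.1 (two ma mb hab ma ml hal (by tauto) (by tauto))
  have y3 := abs_le.1 (two ma mb hab ma' ml hal' (by tauto) (by tauto))
  have y4 := abs_le.1 (two ma' mb hab' ma ml hal (by tauto) (by tauto))
  have y5 := abs_le.1 (two ma' mb hab' ma' ml hal' (by tauto) (by tauto))
  have y6 := abs_le.1 (two ma ml hal ma' ml hal' (by tauto) (by tauto))
  have z1 := abs_le.1 (three ma mb hab ma' mb hab' ma ml hal (by tauto) (by tauto) (by tauto)
    (by tauto) (by tauto) (by tauto))
  have z2 := abs_le.1 (three ma mb hab ma' mb hab' ma' ml hal' (by tauto) (by tauto) (by tauto)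
    (by tauto) (by tauto) (by tauto))
  have z3 := abs_le.1 (three ma mb hab ma ml hal ma' ml hal' (by tauto) (by tauto) (by tauto)
    (by tauto) (by tauto) (by tauto))
  have z4 := abs_le.1 (three ma' mb hab' ma ml hal ma' ml hal' (by tauto) (by tauto) (by tauto)
    (by tauto) (by tauto) (by tauto))
  have hexp : ∑ H ∈ Ω, cycleWeight H a a' b l =
      (∑ H ∈ Ω, adjInd H a b) + (∑ H ∈ Ω, adjInd H a' b) + (∑ H ∈ Ω, adjInd H a l) +
      (∑ H ∈ Ω, adjInd H a' l) - 2 * ((∑ H ∈ Ω, adjInd H a b * adjInd H a' b) +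
      (∑ H ∈ Ω, adjInd H a b * adjInd H a l) + (∑ H ∈ Ω, adjInd H a b * adjInd H a' l) +
      (∑ H ∈ Ω, adjInd H a' b * adjInd H a l) + (∑ H ∈ Ω, adjInd H a' b * adjInd H a' l) +
      (∑ H ∈ Ω, adjInd H a l * adjInd H a' l)) + 2 *
      ((∑ H ∈ Ω, adjInd H a b * (adjInd H a' b * adjInd H a l)) +
      (∑ H ∈ Ω, adjInd H a b * (adjInd H a' b * adjInd H a' l)) +
      (∑ H ∈ Ω, adjInd H a b * (adjInd H a l * adjInd H a' l)) +
      (∑ H ∈ Ω, adjInd H a' b * (adjInd H a l * adjInd H a' l))) := by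
    simp only [← Finset.sum_add_distrib, Finset.mul_sum, ← Finset.sum_sub_distrib]
    refine Finset.sum_congr rfl fun H _ => ?_
    unfold cycleWeight
    rcases adjInd_eq_zero_or_one H a b with h1 | h1 <;>
      rcases adjInd_eq_zero_or_one H a l with h2 | h2 <;>
      rcases adjInd_eq_zero_or_one H a' b with h3 | h3 <;>
      rcases adjInd_eq_zero_or_one H a' l with h4 | h4 <;> norm_num [h1, h2, h3, h4]
  have hk : 4 * p * (1 - p) * (1 - 2 * p) * Ω.card =
      4 * (p * Ω.card) - 12 * (p ^ 2 * Ω.card) + 8 * (p ^ 3 * Ω.card) := by ring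
  rw [hexp, hk, abs_le]
  constructor <;> linarith
theorem NearRegular.le_mul_sub (hR : NearRegular U d Ω L D) :
    L ^ 198 ≤ D * (L ^ 100 - D) := by
  have hL0 : 0 < L := by linarith [hR.large]
  calc L ^ 198 = L ^ 99 * L ^ 99 := by ring
    _ ≤ D * (L ^ 100 - D) :=
      mul_le_mul hR.lower hR.upper (by positivity) ((by positivity : 0 ≤ L ^ 99).trans hR.lower)

theorem NearRegular.pow_le_symMean (hR : NearRegular U d Ω L D) : L ^ 98 ≤ symMean L D := by
  have hL0 : 0 < L := by linarith [hR.large]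
  rw [symMean, le_div_iff₀ (by positivity)]
  have := hR.le_mul_sub
  have h2 : 0 ≤ L ^ 198 := by positivity
  calc L ^ 98 * L ^ 100 = L ^ 198 := by ring
    _ ≤ 2 * D * (L ^ 100 - D) := by linarith

theorem NearRegular.symMean_le (hR : NearRegular U d Ω L D) : symMean L D ≤ L ^ 100 := by
  have hL0 : 0 < L := by linarith [hR.large]
  rw [symMean, div_le_iff₀ (by positivity)]
  nlinarith [sq_nonneg (L ^ 100 - 2 * D), sq_nonneg (L ^ 100)]

theorem abs_div_sub_div_le {c s s' K M N : ℝ} (hM : 0 < M) (hc : |c| ≤ 1) (hs : M ≤ s)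
    (hs' : M ≤ s') (hK : 0 < K) (hsN : s ≤ N) (hKN : K ≤ N) :
    |c / (s * s') - c / K ^ 2| ≤ N * (|s - K| + |s' - K|) / (M ^ 2 * K ^ 2) := by
  have s0 : 0 < s := hM.trans_le hs
  have s0' : 0 < s' := hM.trans_le hs'
  have e : c / (s * s') - c / K ^ 2 = c * (K * (K - s) + s * (K - s')) / (s * s' * K ^ 2) := by
    field_simp
    ring
  have h1 : |K * (K - s) + s * (K - s')| ≤ N * (|s - K| + |s' - K|) := by
    calc |K * (K - s) + s * (K - s')| ≤ |K * (K - s)| + |s * (K - s')| := abs_add_le _ _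
      _ = K * |s - K| + s * |s' - K| := by
        rw [abs_mul, abs_mul, abs_of_pos hK, abs_of_pos s0, abs_sub_comm, abs_sub_comm K s']
      _ ≤ N * |s - K| + N * |s' - K| := by gcongr
      _ = _ := by ring
  rw [e, abs_div, abs_mul, abs_of_pos (show 0 < s * s' * K ^ 2 by positivity)]
  have h2 : M ^ 2 * K ^ 2 ≤ s * s' * K ^ 2 := by
    rw [sq M]
    gcongr
  exact div_le_div₀ (by have := abs_nonneg (s - K); have := abs_nonneg (s' - K); nlinarith)
    ((mul_le_of_le_one_left (abs_nonneg _) hc).trans h1) (by positivity) h2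

theorem abs_div_le_one_of_symDist {c : ℝ} (hc : |c| ≤ 1) (H : SimpleGraph V) (a a' b l : V) :
    |c / (symDist U H b l * symDist U H a a')| ≤ 1 := by
  rcases symDist_eq_zero_or_one_le (U := U) H b l with h | h
  · simp [h]
  rcases symDist_eq_zero_or_one_le (U := U) H a a' with h' | h'
  · simp [h']
  rw [abs_div]
  refine div_le_one_of_le₀ (hc.trans ?_) (abs_nonneg _)
  rw [abs_of_nonneg (by positivity)]
  nlinarith

set_option maxRecDepth 4000 in
theorem NearRegular.sum_cycleWeight_div (hR : NearRegular U d Ω L D) {a a' b l : V} (ha : a ∈ U)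
    (ha' : a' ∈ U) (hb : b ∈ U) (hl : l ∈ U) (haa : a ≠ a') (hab : a ≠ b)
    (hal : a ≠ l) (hab' : a' ≠ b) (hal' : a' ≠ l) (hbl : b ≠ l) :
    |∑ H ∈ Ω, cycleWeight H a a' b l / (symDist U H b l * symDist U H a a') -
      (1 - 2 * (D / L ^ 100)) / (D * (L ^ 100 - D)) * Ω.card| ≤ Ω.card / L ^ 205 := by
  have hL := hR.large
  have hL0 : 0 < L := by linarith
  obtain ⟨K, hK⟩ : ∃ K, K = symMean L D := ⟨_, rfl⟩
  have hK98 : L ^ 98 ≤ K := hK ▸ hR.pow_le_symMean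
  have hKN : K ≤ L ^ 100 := hK ▸ hR.symMean_le
  have hK0 : 0 < K := (by positivity : 0 < L ^ 98).trans_le hK98
  have hQ := hR.le_mul_sub
  have hQ0 : 0 < D * (L ^ 100 - D) := (by positivity : 0 < L ^ 198).trans_le hQ
  have hD0 : 0 < D := (by positivity : 0 < L ^ 99).trans_le hR.lower
  have hND : 0 < L ^ 100 - D := (by positivity : 0 < L ^ 99).trans_le hR.upper
  have hW := hR.sum_cycleWeight ha ha' hb hl haa hab hal hab' hal' hbl rfl
  set p := D / L ^ 100 with hp
  have hκ : (1 - 2 * p) / (D * (L ^ 100 - D)) = 4 * p * (1 - p) * (1 - 2 * p) / K ^ 2 := by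
    have e1 : 4 * p * (1 - p) = 4 * (D * (L ^ 100 - D)) / (L ^ 100) ^ 2 := by
      rw [hp]; field_simp
    rw [e1, hK, symMean]
    field_simp
    ring
  have hterm : ∀ H ∈ Ω, |cycleWeight H a a' b l / (symDist U H b l * symDist U H a a') -
      cycleWeight H a a' b l / K ^ 2| ≤
      L ^ 100 * (|symDist U H b l - K| + |symDist U H a a' - K|) / ((L ^ 95) ^ 2 * K ^ 2) +
      2 * (if symDist U H b l < L ^ 95 then 1 else 0) +
      2 * (if symDist U H a a' < L ^ 95 then 1 else 0) := by
    intro H hH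
    have hc := abs_cycleWeight_le_one H a a' b l
    by_cases hg : L ^ 95 ≤ symDist U H b l ∧ L ^ 95 ≤ symDist U H a a'
    · have h1 := abs_div_sub_div_le (by positivity) hc hg.1 hg.2 hK0
        ((symDist_le_card H b l).trans_eq hR.card) hKN
      rw [if_neg (by linarith [hg.1]), if_neg (by linarith [hg.2])]
      linarith
    · have h1 := abs_div_le_one_of_symDist (U := U) hc H a a' b l
      have h2 : |cycleWeight H a a' b l / K ^ 2| ≤ 1 := by
        rw [abs_div]
        refine div_le_one_of_le₀ (hc.trans ?_) (abs_nonneg _)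
        rw [abs_of_pos (by positivity)]
        refine one_le_pow₀ (le_trans (one_le_pow₀ (by linarith : (1 : ℝ) ≤ L)) hK98)
      have h3 : 0 ≤ L ^ 100 * (|symDist U H b l - K| + |symDist U H a a' - K|) /
          ((L ^ 95) ^ 2 * K ^ 2) := by positivity
      have h4 := abs_sub (cycleWeight H a a' b l / (symDist U H b l * symDist U H a a'))
        (cycleWeight H a a' b l / K ^ 2)
      have h5 : symDist U H b l < L ^ 95 ∨ symDist U H a a' < L ^ 95 := by
        by_contra! h
        exact hg h
      generalize L ^ 100 * (|symDist U H b l - K| + |symDist U H a a' - K|) /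
          ((L ^ 95) ^ 2 * K ^ 2) = z at h3 ⊢
      rcases h5 with h5 | h5
      · rw [if_pos h5]
        split_ifs <;> linarith
      · rw [if_pos h5]
        split_ifs <;> linarith
  have hsum := (Finset.abs_sum_le_sum_abs _ _).trans (Finset.sum_le_sum hterm)
  simp only [Finset.sum_sub_distrib, Finset.sum_add_distrib, ← Finset.mul_sum,
    ← Finset.sum_div, Finset.sum_boole] at hsum
  have b1 := hR.card_lowSet_le hb hl hbl
  have b2 := hR.card_lowSet_le ha ha' haa
  have b3 := hR.sum_abs_symDist_sub hb hl hbl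
  have b4 := hR.sum_abs_symDist_sub ha ha' haa
  rw [← hK] at b3 b4
  unfold lowSet at b1 b2
  set n0 : ℝ := (Ω.card : ℝ) with hn0
  have hn00 : 0 ≤ n0 := by positivity
  set c1 : ℝ := ((Ω.filter fun H => symDist U H b l < L ^ 95).card : ℝ) with hc1
  set c2 : ℝ := ((Ω.filter fun H => symDist U H a a' < L ^ 95).card : ℝ) with hc2
  have b1' : c1 ≤ n0 / L ^ 600 := by rw [le_div_iff₀ (by positivity)]; linarith
  have b2' : c2 ≤ n0 / L ^ 600 := by rw [le_div_iff₀ (by positivity)]; linarith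
  have b5 : L ^ 100 * (∑ H ∈ Ω, |symDist U H b l - K| + ∑ H ∈ Ω, |symDist U H a a' - K|) /
      ((L ^ 95) ^ 2 * K ^ 2) ≤ n0 * (2 / L ^ 206) := by
    calc _ ≤ L ^ 100 * (n0 * L ^ 80 + n0 * L ^ 80) / ((L ^ 95) ^ 2 * (L ^ 98) ^ 2) := by
          gcongr
      _ = n0 * (2 / L ^ 206) := by field_simp; ring
  have b6 : |(∑ H ∈ Ω, cycleWeight H a a' b l) / K ^ 2 -
      (1 - 2 * p) / (D * (L ^ 100 - D)) * n0| ≤ n0 * (52 / L ^ 238) := by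
    rw [hκ, show (∑ H ∈ Ω, cycleWeight H a a' b l) / K ^ 2 -
      4 * p * (1 - p) * (1 - 2 * p) / K ^ 2 * n0 = (∑ H ∈ Ω, cycleWeight H a a' b l -
      4 * p * (1 - p) * (1 - 2 * p) * n0) / K ^ 2 by ring, abs_div,
      abs_of_pos (show 0 < K ^ 2 by positivity)]
    calc _ ≤ 52 * (n0 / L ^ 42) / (L ^ 98) ^ 2 := by gcongr
      _ = n0 * (52 / L ^ 238) := by field_simp
  have hfin : 2 / L ^ 206 + 52 / L ^ 238 + 4 / L ^ 600 ≤ 1 / L ^ 205 := by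
    rw [show 2 / L ^ 206 + 52 / L ^ 238 + 4 / L ^ 600 =
      (2 * L ^ 394 + 52 * L ^ 362 + 4) / L ^ 600 by field_simp,
      show 1 / L ^ 205 = L ^ 395 / L ^ 600 by field_simp]
    gcongr
    have q1 := mul_pow_le_pow hL (show 394 < 395 by norm_num)
    have q2 := mul_pow_le_pow hL (show 362 < 395 by norm_num)
    have q3 := mul_pow_le_pow hL (show 0 < 395 by norm_num)
    have : 0 ≤ L ^ 395 := by positivity
    linarith
  have hfin' : n0 * (2 / L ^ 206) + n0 * (52 / L ^ 238) + 4 * (n0 / L ^ 600) ≤ n0 / L ^ 205 := by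
    have := mul_le_mul_of_nonneg_left hfin hn00
    calc _ = n0 * (2 / L ^ 206 + 52 / L ^ 238 + 4 / L ^ 600) := by ring
      _ ≤ _ := this
      _ = _ := by ring
  rw [abs_le] at hsum b6 ⊢
  constructor <;> linarith

end EdgeProbability

section EdgeProbabilityEstimate

set_option linter.unusedSectionVars false

variable {V : Type*} [DecidableEq V] {U : Finset V} {d : V → ℝ} {Ω : Finset (SimpleGraph V)}
  {L D : ℝ}

theorem sum_sdiff_pair {a b : V} (ha : a ∈ U) (hb : b ∈ U) (hab : a ≠ b) (f : V → ℝ) :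
    ∑ w ∈ U \ {a, b}, f w = ∑ w ∈ U, f w - f a - f b := by
  have hbU : ({a, b} : Finset V) ⊆ U := by
    intro x hx
    simp only [Finset.mem_insert, Finset.mem_singleton] at hx
    rcases hx with rfl | rfl <;> assumption
  rw [← Finset.sum_sdiff hbU, Finset.sum_pair hab]
  ring

theorem sum_sum_erase (W : Finset V) (f : V → V → ℝ) :
    ∑ l ∈ W, ∑ a' ∈ W.erase l, f l a' = ∑ l ∈ W, ∑ a' ∈ W, f l a' - ∑ l ∈ W, f l l := by
  rw [← Finset.sum_sub_distrib]
  exact Finset.sum_congr rfl fun l hl => Finset.sum_erase_eq_sub hl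

theorem SwitchFamily.sum_sum_alternating (hΩ : SwitchFamily U d Ω) {H : SimpleGraph V}
    (hH : H ∈ Ω) {a b : V} (ha : a ∈ U) (hb : b ∈ U) (hab : a ≠ b) :
    ∑ l ∈ U \ {a, b}, ∑ a' ∈ (U \ {a, b}).erase l,
      (adjInd H a b - adjInd H a l - adjInd H a' b + adjInd H a' l) =
      ((U.card : ℝ) - 1) * ((U.card : ℝ) - 2) * adjInd H a b -
        ((U.card : ℝ) - 1) * (d a + d b) + ∑ v ∈ U, d v := by
  have hdeg := hΩ.deg H hH
  set W := U \ {a, b} with hW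
  have hcard : (W.card : ℝ) = U.card - 2 := by
    have := sum_sdiff_pair ha hb hab (fun _ => (1 : ℝ))
    simp only [Finset.sum_const, nsmul_eq_mul, mul_one] at this
    rw [hW, this]; ring
  have r1 : ∑ l ∈ W, adjInd H a l = d a - adjInd H a b := by
    rw [hW, sum_sdiff_pair ha hb hab, hdeg a ha, adjInd_self]; ring
  have r2 : ∑ l ∈ W, adjInd H l b = d b - adjInd H a b := by
    rw [Finset.sum_congr rfl fun l _ => adjInd_comm H l b, hW, sum_sdiff_pair ha hb hab,
      hdeg b hb, adjInd_self, adjInd_comm H b a]; ring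
  have r3 : ∑ l ∈ W, ∑ a' ∈ W, adjInd H a' l =
      ∑ v ∈ U, d v - 2 * d a - 2 * d b + 2 * adjInd H a b := by
    have : ∀ l ∈ W, ∑ a' ∈ W, adjInd H a' l = d l - adjInd H a l - adjInd H l b := by
      intro l hl
      rw [hW, Finset.sum_congr rfl fun a' _ => adjInd_comm H a' l, sum_sdiff_pair ha hb hab,
        hdeg l (Finset.mem_sdiff.1 hl).1, adjInd_comm H l a]
    rw [Finset.sum_congr rfl this, Finset.sum_sub_distrib, Finset.sum_sub_distrib, r1, r2, hW,
      sum_sdiff_pair ha hb hab]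
    ring
  rw [sum_sum_erase]
  simp only [Finset.sum_add_distrib, Finset.sum_sub_distrib, Finset.sum_const, nsmul_eq_mul,
    ← Finset.mul_sum, adjInd_self, add_zero]
  rw [r1, r2, r3, hcard]
  ring

theorem abs_sum_sum_erase_sub_le {W : Finset V} {E G : V → V → ℝ} {c r N : ℝ}
    (hN : (W.card : ℝ) ≤ N) (hr : 0 ≤ r)
    (h : ∀ l ∈ W, ∀ a' ∈ W.erase l, |E l a' - c * G l a'| ≤ r) :
    |∑ l ∈ W, ∑ a' ∈ W.erase l, E l a' - c * ∑ l ∈ W, ∑ a' ∈ W.erase l, G l a'| ≤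
      N * (N * r) := by
  have hN0 : 0 ≤ N := (Nat.cast_nonneg _).trans hN
  simp only [Finset.mul_sum (a := c), ← Finset.sum_sub_distrib]
  calc _ ≤ ∑ l ∈ W, ∑ a' ∈ W.erase l, r := by
        refine (Finset.abs_sum_le_sum_abs _ _).trans (Finset.sum_le_sum fun l hl => ?_)
        refine (Finset.abs_sum_le_sum_abs _ _).trans (Finset.sum_le_sum fun a' ha' => ?_)
        exact h l hl a' ha'
    _ ≤ ∑ l ∈ W, N * r := by
        refine Finset.sum_le_sum fun l hl => ?_
        rw [Finset.sum_const, nsmul_eq_mul]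
        refine mul_le_mul_of_nonneg_right (le_trans ?_ hN) hr
        exact_mod_cast Finset.card_le_card (Finset.erase_subset _ _)
    _ ≤ N * (N * r) := by
        rw [Finset.sum_const, nsmul_eq_mul]
        exact mul_le_mul_of_nonneg_right hN (mul_nonneg hN0 hr)

set_option maxRecDepth 4000 in
theorem NearRegular.sum_sum_sub_mul_sub (hR : NearRegular U d Ω L D) {a b : V} (ha : a ∈ U)
    (hb : b ∈ U) (hab : a ≠ b) :
    |∑ l ∈ U \ {a, b}, ∑ a' ∈ (U \ {a, b}).erase l, (d b - d l) * (d a - d a')| ≤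
      L ^ 200 * (|d a - D| * |d b - D|) + 20 * L ^ 202 := by
  have hL := hR.large
  have hL0 : 0 < L := by linarith
  have hcU := hR.card
  set W := U \ {a, b} with hW
  have hcard : (W.card : ℝ) = U.card - 2 := by
    have := sum_sdiff_pair ha hb hab (fun _ => (1 : ℝ))
    simp only [Finset.sum_const, nsmul_eq_mul, mul_one] at this
    rw [hW, this]; ring
  have r0 : ∑ l ∈ W, d l = L ^ 100 * D - d a - d b := by
    rw [hW, sum_sdiff_pair ha hb hab, hR.mean]
  set x := d a - D with hx
  set y := d b - D with hy
  have e : ∑ l ∈ W, ∑ a' ∈ W.erase l, (d b - d l) * (d a - d a') =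
      ((L ^ 100 - 1) * y + x) * ((L ^ 100 - 1) * x + y) -
        ∑ l ∈ W, (d b - d l) * (d a - d l) := by
    rw [sum_sum_erase]
    congr 1
    rw [← Finset.sum_mul_sum, Finset.sum_sub_distrib, Finset.sum_sub_distrib, r0]
    simp only [Finset.sum_const, nsmul_eq_mul, hcard, hcU, hx, hy]
    ring
  have hdiag : |∑ l ∈ W, (d b - d l) * (d a - d l)| ≤ L ^ 100 * (2 * L ^ 51 * (2 * L ^ 51)) := by
    calc |∑ l ∈ W, (d b - d l) * (d a - d l)| ≤ ∑ l ∈ W, |(d b - d l) * (d a - d l)| :=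
          Finset.abs_sum_le_sum_abs _ _
      _ ≤ ∑ l ∈ W, 2 * L ^ 51 * (2 * L ^ 51) := by
        refine Finset.sum_le_sum fun l hl => ?_
        have hlU := (Finset.mem_sdiff.1 hl).1
        rw [abs_mul]
        exact mul_le_mul (hR.abs_sub_le hb hlU) (hR.abs_sub_le ha hlU) (abs_nonneg _)
          (by positivity)
      _ ≤ _ := by
        rw [Finset.sum_const, nsmul_eq_mul]
        refine mul_le_mul_of_nonneg_right ?_ (by positivity)
        rw [hcard, hcU]; linarith
  have hxx : |x| ≤ L ^ 51 := hR.dev a ha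
  have hyy : |y| ≤ L ^ 51 := hR.dev b hb
  have hN1 : (1 : ℝ) ≤ L ^ 100 := one_le_pow₀ (by linarith)
  have hmain : |((L ^ 100 - 1) * y + x) * ((L ^ 100 - 1) * x + y)| ≤
      L ^ 200 * (|x| * |y|) + 3 * (L ^ 100 * (L ^ 51 * L ^ 51)) := by
    have h1 : ((L ^ 100 - 1) * y + x) * ((L ^ 100 - 1) * x + y) =
        ((L ^ 100 - 1) ^ 2 + 1) * (x * y) + (L ^ 100 - 1) * (x * x + y * y) := by ring
    have hxy : |x * y| = |x| * |y| := abs_mul _ _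
    have h2 : |x * x + y * y| ≤ 2 * (L ^ 51 * L ^ 51) := by
      have := mul_le_mul hxx hxx (abs_nonneg _) (by positivity)
      have := mul_le_mul hyy hyy (abs_nonneg _) (by positivity)
      rw [abs_mul_abs_self] at *
      rw [abs_of_nonneg (by nlinarith)]
      linarith
    have hp : 0 ≤ L ^ 51 * L ^ 51 := by positivity
    calc _ ≤ |((L ^ 100 - 1) ^ 2 + 1) * (x * y)| + |(L ^ 100 - 1) * (x * x + y * y)| := by
          rw [h1]; exact abs_add_le _ _
      _ = ((L ^ 100 - 1) ^ 2 + 1) * (|x| * |y|) + (L ^ 100 - 1) * |x * x + y * y| := by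
        rw [abs_mul, hxy, abs_mul (L ^ 100 - 1), abs_of_nonneg (by positivity : 0 ≤ (L ^ 100 - 1) ^ 2 + 1),
          abs_of_nonneg (by linarith : 0 ≤ L ^ 100 - 1)]
      _ ≤ L ^ 200 * (|x| * |y|) + L ^ 100 * (2 * (L ^ 51 * L ^ 51)) := by
        refine add_le_add (mul_le_mul_of_nonneg_right ?_ (by positivity))
          (mul_le_mul (by linarith) h2 (abs_nonneg _) (by linarith))
        rw [show L ^ 200 = L ^ 100 * L ^ 100 by ring]
        nlinarith
      _ ≤ _ := by nlinarith
  rw [e]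
  refine (abs_sub _ _).trans ?_
  have e3 : L ^ 100 * (2 * L ^ 51 * (2 * L ^ 51)) = 4 * L ^ 202 := by ring
  have e4 : 3 * (L ^ 100 * (L ^ 51 * L ^ 51)) = 3 * L ^ 202 := by ring
  rw [e3] at hdiag
  rw [e4] at hmain
  have : 0 ≤ L ^ 202 := by positivity
  linarith

set_option maxRecDepth 4000 in
/-- The probability of an edge in a near-regular switching family. -/
theorem NearRegular.abs_sum_adjInd_sub_le (hR : NearRegular U d Ω L D) {a b : V} (ha : a ∈ U)
    (hb : b ∈ U) (hab : a ≠ b) :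
    |L ^ 200 * ∑ H ∈ Ω, adjInd H a b - Ω.card * (L ^ 100 * (d a + d b - D))| ≤
      Ω.card * (6 * L ^ 100 + L ^ 200 * (|d a - D| * |d b - D|) / (D * (L ^ 100 - D))) := by
  have hL := hR.large
  have hL0 : 0 < L := by linarith
  have hcU := hR.card
  have hD0 : 0 < D := (by positivity : 0 < L ^ 99).trans_le hR.lower
  have hND : 0 < L ^ 100 - D := (by positivity : 0 < L ^ 99).trans_le hR.upper
  have hQ := hR.le_mul_sub
  set Q := D * (L ^ 100 - D) with hQd
  have hQ0 : 0 < Q := by positivity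
  set W := U \ {a, b} with hW
  set n0 : ℝ := (Ω.card : ℝ) with hn0
  have hn00 : 0 ≤ n0 := by positivity
  set κ := (1 - 2 * (D / L ^ 100)) / Q with hκ
  have hκ1 : |κ| ≤ 1 / Q := by
    rw [hκ, abs_div, abs_of_pos hQ0]
    gcongr
    have h1 : 0 ≤ D / L ^ 100 := by positivity
    have h2 : D / L ^ 100 ≤ 1 := by
      rw [div_le_one (by positivity)]; linarith
    rw [abs_le]; constructor <;> linarith
  have hcard : (W.card : ℝ) ≤ L ^ 100 := by
    rw [← hcU]; exact_mod_cast Finset.card_le_card Finset.sdiff_subset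
  have htot : ∑ l ∈ W, ∑ a' ∈ W.erase l,
      ∑ H ∈ Ω, (adjInd H a b - adjInd H a l - adjInd H a' b + adjInd H a' l) =
      (L ^ 100 - 1) * (L ^ 100 - 2) * ∑ H ∈ Ω, adjInd H a b -
        n0 * ((L ^ 100 - 1) * (d a + d b)) + n0 * (L ^ 100 * D) := by
    calc _ = ∑ H ∈ Ω, ∑ l ∈ W, ∑ a' ∈ W.erase l,
        (adjInd H a b - adjInd H a l - adjInd H a' b + adjInd H a' l) := by
          rw [Finset.sum_comm]
          refine Finset.sum_congr rfl fun l _ => ?_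
          rw [Finset.sum_comm]
      _ = ∑ H ∈ Ω, ((L ^ 100 - 1) * (L ^ 100 - 2) * adjInd H a b -
        (L ^ 100 - 1) * (d a + d b) + L ^ 100 * D) := by
          refine Finset.sum_congr rfl fun H hH => ?_
          rw [hW, hR.switch.sum_sum_alternating hH ha hb hab, hcU, hR.mean]
      _ = _ := by
          rw [Finset.sum_add_distrib, Finset.sum_sub_distrib, ← Finset.mul_sum]
          simp only [Finset.sum_const, nsmul_eq_mul, hn0]
  have hterm : ∀ l ∈ W, ∀ a' ∈ W.erase l,
      |∑ H ∈ Ω, (adjInd H a b - adjInd H a l - adjInd H a' b + adjInd H a' l) -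
        n0 * κ * ((d b - d l) * (d a - d a'))| ≤ n0 * (4 / L ^ 103) := by
    intro l hl a' ha'
    have ha'W := Finset.mem_of_mem_erase ha'
    have hne := Finset.ne_of_mem_erase ha'
    simp only [hW, Finset.mem_sdiff, Finset.mem_insert, Finset.mem_singleton, not_or] at hl ha'W
    rw [hR.switch.sum_alternating ha ha'W.1 hb hl.1 (Ne.symm ha'W.2.1) hab (Ne.symm hl.2.1)
      ha'W.2.2 hne (Ne.symm hl.2.2)]
    have h1 := hR.sum_cycleWeight_div ha ha'W.1 hb hl.1 (Ne.symm ha'W.2.1) hab (Ne.symm hl.2.1)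
      ha'W.2.2 hne (Ne.symm hl.2.2)
    rw [← hQd, ← hκ, ← hn0] at h1
    have h2 := mul_le_mul (hR.abs_sub_le hb hl.1) (hR.abs_sub_le ha ha'W.1) (abs_nonneg _)
          (by positivity)
    rw [← abs_mul] at h2
    rw [show ∀ z : ℝ, (d b - d l) * (d a - d a') * z - n0 * κ * ((d b - d l) * (d a - d a')) =
      (d b - d l) * (d a - d a') * (z - κ * n0) by intro z; ring, abs_mul]
    calc _ ≤ 2 * L ^ 51 * (2 * L ^ 51) * (n0 / L ^ 205) :=
          mul_le_mul h2 h1 (abs_nonneg _) (by positivity)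
      _ = n0 * (4 / L ^ 103) := by field_simp; ring
  have hsum : |∑ l ∈ W, ∑ a' ∈ W.erase l,
      ∑ H ∈ Ω, (adjInd H a b - adjInd H a l - adjInd H a' b + adjInd H a' l) -
      n0 * κ * ∑ l ∈ W, ∑ a' ∈ W.erase l, (d b - d l) * (d a - d a')| ≤ n0 * (4 * L ^ 97) := by
    have hc : 0 ≤ n0 * (4 / L ^ 103) := by positivity
    refine (abs_sum_sum_erase_sub_le hcard hc hterm).trans_eq ?_
    field_simp
  have hdev := hR.sum_sum_sub_mul_sub ha hb hab
  rw [← hW] at hdev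
  rw [htot] at hsum
  have hdev' : |n0 * κ * ∑ l ∈ W, ∑ a' ∈ W.erase l, (d b - d l) * (d a - d a')| ≤
      n0 * (L ^ 200 * (|d a - D| * |d b - D|) / Q) + n0 * (20 * L ^ 4) := by
    rw [abs_mul, abs_mul, abs_of_nonneg hn00]
    calc _ ≤ n0 * (1 / Q) * (L ^ 200 * (|d a - D| * |d b - D|) + 20 * L ^ 202) := by gcongr
      _ = n0 * (L ^ 200 * (|d a - D| * |d b - D|) / Q) + n0 * (20 * L ^ 202 / Q) := by ring
      _ ≤ n0 * (L ^ 200 * (|d a - D| * |d b - D|) / Q) + n0 * (20 * L ^ 202 / L ^ 198) := by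
        gcongr
      _ = _ := by
        congr 2
        field_simp
  set S := ∑ H ∈ Ω, adjInd H a b with hS
  have hS0 : 0 ≤ S := Finset.sum_nonneg fun H _ => adjInd_nonneg H a b
  have hS1 : S ≤ n0 := by
    rw [hS, hn0]
    calc _ ≤ ∑ H ∈ Ω, (1 : ℝ) := Finset.sum_le_sum fun H _ => adjInd_le_one H a b
      _ = _ := by simp
  have hda := abs_le.1 (hR.dev a ha)
  have hdb := abs_le.1 (hR.dev b hb)
  have q0 := mul_pow_le_pow hL (show 0 < 100 by norm_num)
  have q1 := mul_pow_le_pow hL (show 51 < 99 by norm_num)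
  have q2 := mul_pow_le_pow hL (show 97 < 100 by norm_num)
  have q3 := mul_pow_le_pow hL (show 4 < 100 by norm_num)
  have q4 := hR.lower
  have q5 := hR.upper
  have p1 : 0 ≤ L ^ 51 := by positivity
  have p2 : 0 ≤ L ^ 97 := by positivity
  have p3 : 0 ≤ L ^ 4 := by positivity
  have m1 : 0 ≤ n0 * (d a + d b) := mul_nonneg hn00 (by linarith)
  have m2 : n0 * (d a + d b) ≤ n0 * (2 * L ^ 100) :=
    mul_le_mul_of_nonneg_left (by linarith) hn00
  have m3 : (3 * L ^ 100 - 2) * S ≤ n0 * (3 * L ^ 100) := by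
    calc _ ≤ (3 * L ^ 100) * S := mul_le_mul_of_nonneg_right (by linarith) hS0
      _ ≤ (3 * L ^ 100) * n0 := by gcongr
      _ = _ := by ring
  have m4 : 0 ≤ (3 * L ^ 100 - 2) * S := mul_nonneg (by linarith) hS0
  have m5 : n0 * (4 * L ^ 97) + n0 * (20 * L ^ 4) ≤ n0 * L ^ 100 := by
    rw [← mul_add]
    exact mul_le_mul_of_nonneg_left (by linarith) hn00
  have e1 : L ^ 200 * S - n0 * (L ^ 100 * (d a + d b - D)) =
      ((L ^ 100 - 1) * (L ^ 100 - 2) * S - n0 * ((L ^ 100 - 1) * (d a + d b)) +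
        n0 * (L ^ 100 * D)) + (3 * L ^ 100 - 2) * S - n0 * (d a + d b) := by ring
  rw [e1, mul_add]
  rw [abs_le] at *
  constructor <;> linarith

end EdgeProbabilityEstimate

section EdgePossible

set_option linter.unusedSectionVars false

variable {V : Type*} [DecidableEq V] {U : Finset V} {d : V → ℝ} {Ω : Finset (SimpleGraph V)}
  {L D : ℝ}

set_option maxRecDepth 4000 in
theorem NearRegular.exists_adj_and_not_adj (hR : NearRegular U d Ω L D) (hne : Ω.Nonempty)
    {a b : V} (ha : a ∈ U) (hb : b ∈ U) (hab : a ≠ b) :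
    (∃ H ∈ Ω, H.Adj a b) ∧ ∃ H ∈ Ω, ¬ H.Adj a b := by
  have hL := hR.large
  have hL0 : 0 < L := by linarith
  have hn0 : (0 : ℝ) < Ω.card := by exact_mod_cast hne.card_pos
  have h := hR.abs_sum_adjInd_sub_le ha hb hab
  have hQ := hR.le_mul_sub
  have hda := hR.dev a ha
  have hdb := hR.dev b hb
  have hx : L ^ 200 * (|d a - D| * |d b - D|) / (D * (L ^ 100 - D)) ≤ L ^ 104 := by
    have hQ0 : 0 < D * (L ^ 100 - D) := (by positivity : 0 < L ^ 198).trans_le hQ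
    calc _ ≤ L ^ 200 * (L ^ 51 * L ^ 51) / L ^ 198 := by gcongr
      _ = L ^ 104 := by field_simp
  have hda' := abs_le.1 hda
  have hdb' := abs_le.1 hdb
  have q1 := mul_pow_le_pow hL (show 151 < 199 by norm_num)
  have q2 := mul_pow_le_pow hL (show 104 < 199 by norm_num)
  have q3 := mul_pow_le_pow hL (show 100 < 199 by norm_num)
  have p0 : 0 < L ^ 199 := by positivity
  have p1 : 0 ≤ L ^ 151 := by positivity
  have p2 : 0 ≤ L ^ 104 := by positivity
  have p3 : 0 < L ^ 100 := by positivity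
  have lo : L ^ 199 - 2 * L ^ 151 ≤ L ^ 100 * (d a + d b - D) := by
    calc L ^ 199 - 2 * L ^ 151 = L ^ 100 * (L ^ 99 - 2 * L ^ 51) := by ring
      _ ≤ _ := mul_le_mul_of_nonneg_left (by linarith [hR.lower]) p3.le
  have up : L ^ 100 * (d a + d b - D) ≤ L ^ 200 - L ^ 199 + 2 * L ^ 151 := by
    calc _ ≤ L ^ 100 * (L ^ 100 - L ^ 99 + 2 * L ^ 51) :=
          mul_le_mul_of_nonneg_left (by linarith [hR.upper]) p3.le
      _ = _ := by ring
  have h1 := abs_le.1 (h.trans (mul_le_mul_of_nonneg_left (add_le_add_right hx (6 * L ^ 100))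
    hn0.le))
  constructor
  · by_contra! hc
    have hz : ∑ H ∈ Ω, adjInd H a b = 0 :=
      Finset.sum_eq_zero fun H hH => by simp [adjInd, hc H hH]
    rw [hz, mul_zero] at h1
    have h2 : (Ω.card : ℝ) * (L ^ 100 * (d a + d b - D)) ≤ Ω.card * (6 * L ^ 100 + L ^ 104) := by
      linarith [h1.1]
    have := le_of_mul_le_mul_left h2 hn0
    linarith
  · by_contra! hc
    have hz : ∑ H ∈ Ω, adjInd H a b = Ω.card := by
      rw [Finset.sum_congr rfl fun H hH => show adjInd H a b = 1 by simp [adjInd, hc H hH]]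
      simp
    rw [hz] at h1
    have h2 : (Ω.card : ℝ) * (L ^ 200 - L ^ 100 * (d a + d b - D)) ≤
        Ω.card * (6 * L ^ 100 + L ^ 104) := by
      linarith [h1.2]
    have := le_of_mul_le_mul_left h2 hn0
    linarith

end EdgePossible

section DegreeFamily

set_option linter.unusedSectionVars false

variable {V : Type*} [Fintype V] [DecidableEq V]

theorem sum_adjInd_toggle (H : SimpleGraph V) {v v' w u : V} (hvv : v ≠ v') (hwu : w ≠ u)
    (hvw : v ≠ w) (hvu : v ≠ u) (hvw' : v' ≠ w) (hvu' : v' ≠ u) (h1 : H.Adj v w)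
    (h2 : ¬ H.Adj v' w) (h3 : ¬ H.Adj v u) (h4 : H.Adj v' u) (x : V) :
    ∑ y, adjInd (toggle H v v' w u) x y = ∑ y, adjInd H x y := by
  have a1 : adjInd H v w = 1 := by simp [adjInd, h1]
  have a2 : adjInd H v' w = 0 := by simp [adjInd, h2]
  have a3 : adjInd H v u = 0 := by simp [adjInd, h3]
  have a4 : adjInd H v' u = 1 := by simp [adjInd, h4]
  have pair : ∀ {x p q : V}, p ≠ q → adjInd (toggle H v v' w u) x p = 1 - adjInd H x p →
      adjInd (toggle H v v' w u) x q = 1 - adjInd H x q → adjInd H x p + adjInd H x q = 1 →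
      (∀ y, y ≠ p → y ≠ q → adjInd (toggle H v v' w u) x y = adjInd H x y) →
      ∑ y, adjInd (toggle H v v' w u) x y = ∑ y, adjInd H x y := by
    intro x p q hpq e1 e2 e3 e4
    rw [← Finset.sum_sdiff (Finset.subset_univ {p, q}),
      ← Finset.sum_sdiff (f := fun y => adjInd H x y) (Finset.subset_univ {p, q}),
      Finset.sum_pair hpq, Finset.sum_pair hpq, e1, e2]
    congr 1
    · refine Finset.sum_congr rfl fun y hy => ?_
      simp only [Finset.mem_sdiff, Finset.mem_insert, Finset.mem_singleton, not_or] at hy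
      exact e4 y hy.2.1 hy.2.2
    · linarith
  by_cases xv : x = v
  · subst xv
    exact pair hwu (adjInd_toggle_of H hvw (by tauto)) (adjInd_toggle_of H hvu (by tauto))
      (by rw [a1, a3]; norm_num) fun y hy hy' => adjInd_toggle_of_not H (by tauto)
  by_cases xv' : x = v'
  · subst xv'
    exact pair hwu (adjInd_toggle_of H hvw' (by tauto)) (adjInd_toggle_of H hvu' (by tauto))
      (by rw [a2, a4]; norm_num) fun y hy hy' => adjInd_toggle_of_not H (by tauto)
  by_cases xw : x = w
  · subst xw
    exact pair hvv (adjInd_toggle_of H hvw.symm (by tauto))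
      (adjInd_toggle_of H hvw'.symm (by tauto))
      (by rw [adjInd_comm, a1, adjInd_comm, a2]; norm_num)
      fun y hy hy' => adjInd_toggle_of_not H (by tauto)
  by_cases xu : x = u
  · subst xu
    exact pair hvv (adjInd_toggle_of H hvu.symm (by tauto))
      (adjInd_toggle_of H hvu'.symm (by tauto))
      (by rw [adjInd_comm, a3, adjInd_comm, a4]; norm_num)
      fun y hy hy' => adjInd_toggle_of_not H (by tauto)
  exact Finset.sum_congr rfl fun y _ => adjInd_toggle_of_not H (by tauto)

/-- The graph of edges of `H` that are not inside `U`. -/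
def offGraph (U : Finset V) (H : SimpleGraph V) : SimpleGraph V where
  Adj x y := H.Adj x y ∧ ¬ (x ∈ U ∧ y ∈ U)
  symm := ⟨fun _ _ h => ⟨h.1.symm, fun h' => h.2 h'.symm⟩⟩
  loopless := ⟨fun _ h => h.1.ne rfl⟩

/-- The graphs with degrees `d` whose edges not inside `U` are those of `K`. -/
def degFamily (U : Finset V) (d : V → ℝ) (K : SimpleGraph V) : Finset (SimpleGraph V) :=
  Finset.univ.filter fun H => (∀ v, ∑ w, adjInd H v w = d v) ∧ offGraph U H = K

theorem adjInd_offGraph {U : Finset V} (H : SimpleGraph V) {x y : V} (h : ¬ (x ∈ U ∧ y ∈ U)) :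
    adjInd (offGraph U H) x y = adjInd H x y := by
  have : (offGraph U H).Adj x y ↔ H.Adj x y := ⟨And.left, fun g => ⟨g, h⟩⟩
  simp [adjInd, this]

theorem switchFamily_degFamily (U : Finset V) (d : V → ℝ) (K : SimpleGraph V) :
    SwitchFamily U (fun v => d v - ∑ w ∈ Uᶜ, adjInd K v w) (degFamily U d K) where
  closed := by
    intro H hH v hv v' hv' w hw u hu hvv hwu hvw hvu hvw' hvu' h1 h2 h3 h4
    simp only [degFamily, Finset.mem_filter, Finset.mem_univ, true_and] at hH ⊢
    refine ⟨fun x => ?_, ?_⟩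
    · rw [sum_adjInd_toggle H hvv hwu hvw hvu hvw' hvu' h1 h2 h3 h4, hH.1]
    · rw [← hH.2]
      ext x y
      simp only [offGraph, and_congr_left_iff]
      intro hxy
      have : ¬ (((x = v ∨ x = v') ∧ (y = w ∨ y = u)) ∨ ((x = w ∨ x = u) ∧ (y = v ∨ y = v'))) := by
        have m1 : ∀ z, z = v ∨ z = v' → z ∈ U := by rintro z (rfl | rfl) <;> assumption
        have m2 : ∀ z, z = w ∨ z = u → z ∈ U := by rintro z (rfl | rfl) <;> assumption
        rintro (⟨g, g'⟩ | ⟨g, g'⟩)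
        exacts [hxy ⟨m1 x g, m2 y g'⟩, hxy ⟨m2 x g, m1 y g'⟩]
      have e := adjInd_toggle_of_not H this
      unfold adjInd at e
      split_ifs at e <;> simp_all
  deg := by
    intro H hH v hv
    simp only [degFamily, Finset.mem_filter, Finset.mem_univ, true_and] at hH
    rw [← hH.1 v, ← Finset.sum_add_sum_compl U, ← hH.2, add_sub_assoc, left_eq_add, sub_eq_zero]
    refine Finset.sum_congr rfl fun w hw => (adjInd_offGraph H ?_).symm
    rw [Finset.mem_compl] at hw
    tauto

/-- The numerical conditions making degrees within `R` of `c` near-regular on `N` vertices. -/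
def Admissible (N c R : ℝ) : Prop :=
  ∃ L : ℝ, 1000000 ≤ L ∧ N = L ^ 100 ∧ 2 * R ≤ L ^ 51 ∧ L ^ 99 + R ≤ c ∧
    L ^ 99 + R ≤ L ^ 100 - c

theorem Admissible.nearRegular {N c R : ℝ} (hA : Admissible N c R) {U : Finset V}
    (hU : (U.card : ℝ) = N) {d : V → ℝ} {Ω : Finset (SimpleGraph V)} (hΩ : SwitchFamily U d Ω)
    (hd : ∀ v ∈ U, |d v - c| ≤ R) :
    ∃ L : ℝ, L ^ 100 = N ∧ NearRegular U d Ω L ((∑ v ∈ U, d v) / N) := by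
  obtain ⟨L, hL, hN, h1, h2, h3⟩ := hA
  have hL0 : 0 < L := by linarith
  have hN0 : 0 < N := by rw [hN]; positivity
  have hD : |(∑ v ∈ U, d v) / N - c| ≤ R := by
    have : (∑ v ∈ U, d v) / N - c = (∑ v ∈ U, (d v - c)) / N := by
      rw [Finset.sum_sub_distrib, Finset.sum_const, nsmul_eq_mul, hU]
      field_simp
    rw [this, abs_div, abs_of_pos hN0, div_le_iff₀ hN0]
    calc _ ≤ ∑ v ∈ U, |d v - c| := Finset.abs_sum_le_sum_abs _ _
      _ ≤ ∑ v ∈ U, R := Finset.sum_le_sum hd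
      _ = R * N := by rw [Finset.sum_const, nsmul_eq_mul, hU]; ring
  have hD' := abs_le.1 hD
  refine ⟨L, hN.symm, hΩ, hL, by rw [hU, hN], fun v hv => ?_, by linarith, by linarith, ?_⟩
  · have := abs_le.1 (hd v hv)
    rw [abs_le]
    constructor <;> linarith
  · rw [← hN]
    field_simp

end DegreeFamily

section Existence

set_option linter.unusedSectionVars false

variable {V : Type*} [Fintype V] [DecidableEq V]

/-- The integer vector `d` is the degree sequence of some graph. -/
def Graphical (d : V → ℤ) : Prop :=
  ∃ H : SimpleGraph V, ∀ v, ∑ w, adjInd H v w = (d v : ℝ)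

theorem sum_adjInd_eq_degree (H : SimpleGraph V) (v : V) :
    ∑ w, adjInd H v w = (H.degree v : ℝ) := by
  simp only [adjInd, Finset.sum_boole]
  congr 2
  ext w
  simp

theorem Graphical.even_sum {d : V → ℤ} (h : Graphical d) : Even (∑ v, d v) := by
  obtain ⟨H, hH⟩ := h
  have h1 : ∀ v, (H.degree v : ℤ) = d v := fun v => by
    have := (sum_adjInd_eq_degree H v).symm.trans (hH v)
    exact_mod_cast this
  have h2 := H.sum_degrees_eq_twice_card_edges
  rw [← Finset.sum_congr rfl fun v _ => h1 v]
  have h3 : ∑ v, (H.degree v : ℤ) = 2 * (H.edgeFinset.card : ℤ) := by exact_mod_cast h2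
  rw [h3]
  exact even_two_mul _

/-- The graph obtained from `H` by complementing the pair `a b`. -/
def flipEdge (H : SimpleGraph V) (a b : V) : SimpleGraph V where
  Adj x y := x ≠ y ∧ Xor (H.Adj x y) ((x = a ∧ y = b) ∨ (x = b ∧ y = a))
  symm := ⟨by
    rintro x y ⟨hxy, h⟩
    refine ⟨hxy.symm, ?_⟩
    rw [H.adj_comm]
    have : ((y = a ∧ x = b) ∨ (y = b ∧ x = a)) ↔ ((x = a ∧ y = b) ∨ (x = b ∧ y = a)) := by tauto
    rwa [this]⟩
  loopless := ⟨fun _ h => h.1 rfl⟩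

theorem adjInd_flipEdge (H : SimpleGraph V) {a b : V} (hab : a ≠ b) (x y : V) :
    adjInd (flipEdge H a b) x y = adjInd H x y + (1 - 2 * adjInd H a b) *
      ((if x = a then 1 else 0) * (if y = b then 1 else 0) +
        (if x = b then 1 else 0) * (if y = a then 1 else 0)) := by
  by_cases h : (x = a ∧ y = b) ∨ (x = b ∧ y = a)
  · have hxy : x ≠ y := by rintro rfl; rcases h with ⟨rfl, h⟩ | ⟨rfl, h⟩ <;> tauto
    have h1 : (flipEdge H a b).Adj x y ↔ ¬ H.Adj x y := by
      simp only [flipEdge, Xor]; tauto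
    have h2 : adjInd (flipEdge H a b) x y = 1 - adjInd H x y := by
      unfold adjInd; by_cases g : H.Adj x y <;> simp [h1, g]
    rw [h2]
    rcases h with ⟨rfl, rfl⟩ | ⟨rfl, rfl⟩
    · simp [hab]; ring
    · simp [hab.symm, adjInd_comm H y x]; ring
  · have h1 : (flipEdge H a b).Adj x y ↔ H.Adj x y := by
      have : H.Adj x y → x ≠ y := fun g => g.ne
      simp only [flipEdge, Xor]; tauto
    have h2 : adjInd (flipEdge H a b) x y = adjInd H x y := by
      simp only [adjInd, h1]
    rw [h2]
    by_cases g1 : x = a <;> by_cases g2 : x = b <;> by_cases g3 : y = a <;> by_cases g4 : y = b <;>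
      simp_all

theorem sum_adjInd_flipEdge (H : SimpleGraph V) {a b : V} (hab : a ≠ b) (x : V) :
    ∑ y, adjInd (flipEdge H a b) x y = ∑ y, adjInd H x y + (1 - 2 * adjInd H a b) *
      ((if x = a then 1 else 0) + (if x = b then 1 else 0)) := by
  simp only [adjInd_flipEdge H hab, Finset.sum_add_distrib, ← Finset.mul_sum]
  simp

theorem Graphical.add_single_add_single {c R : ℝ} (hA : Admissible (Fintype.card V) c R)
    {d : V → ℤ} (h : Graphical d) (hd : ∀ v, |(d v : ℝ) - c| ≤ R) {a b : V} (hab : a ≠ b)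
    {s : ℤ} (hs : s = 1 ∨ s = -1) :
    Graphical (d + s • (Pi.single a 1 + Pi.single b 1)) := by
  obtain ⟨H, hH⟩ := h
  have hsw := switchFamily_degFamily Finset.univ (fun v => (d v : ℝ)) (offGraph Finset.univ H)
  simp only [Finset.compl_univ, Finset.sum_empty, sub_zero] at hsw
  obtain ⟨L, -, hR⟩ := hA.nearRegular (U := Finset.univ) (by simp) hsw fun v _ => hd v
  have hne : (degFamily Finset.univ (fun v => (d v : ℝ)) (offGraph Finset.univ H)).Nonempty :=
    ⟨H, by simp [degFamily, hH]⟩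
  have key : ∀ H' : SimpleGraph V, H' ∈ degFamily Finset.univ (fun v => (d v : ℝ))
      (offGraph Finset.univ H) → 1 - 2 * adjInd H' a b = s →
      Graphical (d + s • (Pi.single a 1 + Pi.single b 1)) := by
    intro H' hH' hs'
    refine ⟨flipEdge H' a b, fun v => ?_⟩
    have := (Finset.mem_filter.1 hH').2.1 v
    rw [sum_adjInd_flipEdge H' hab, this, hs']
    simp [Pi.single_apply, mul_add]
  obtain ⟨⟨H1, h1, h1'⟩, H2, h2, h2'⟩ :=
    hR.exists_adj_and_not_adj hne (Finset.mem_univ a) (Finset.mem_univ b) hab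
  rcases hs with rfl | rfl
  · exact key H2 h2 (by simp [adjInd, h2'])
  · exact key H1 h1 (by simp [adjInd, h1']; norm_num)

theorem abs_smul_single_add_single_le {a b : V} (hab : a ≠ b) {s : ℤ} (hs : s = 1 ∨ s = -1)
    (v : V) : |(((s • (Pi.single a 1 + Pi.single b 1) : V → ℤ) v : ℤ) : ℝ)| ≤ 1 := by
  rcases hs with rfl | rfl <;> by_cases h1 : v = a <;> by_cases h2 : v = b <;>
    simp_all

theorem Graphical.add_single {c R : ℝ} (hA : Admissible (Fintype.card V) c (R + 2))
    (hV : 4 ≤ Fintype.card V) {d : V → ℤ} (h : Graphical d) (hd : ∀ v, |(d v : ℝ) - c| ≤ R)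
    (a b : V) {s t : ℤ} (hs : s = 1 ∨ s = -1) (ht : t = 1 ∨ t = -1) :
    Graphical (d + s • Pi.single a 1 + t • Pi.single b 1) := by
  obtain ⟨x, hx⟩ : ∃ x, x ∉ ({a, b} : Finset V) := by
    by_contra! hc
    have := Finset.card_le_card (fun x _ => hc x : (Finset.univ : Finset V) ⊆ {a, b})
    have := Finset.card_le_two (a := a) (b := b)
    rw [Finset.card_univ] at *
    omega
  obtain ⟨y, hy⟩ : ∃ y, y ∉ ({a, b, x} : Finset V) := by
    by_contra! hc
    have := Finset.card_le_card (fun y _ => hc y : (Finset.univ : Finset V) ⊆ {a, b, x})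
    have := Finset.card_le_three (a := a) (b := b) (c := x)
    rw [Finset.card_univ] at *
    omega
  simp only [Finset.mem_insert, Finset.mem_singleton, not_or] at hx hy
  have step : ∀ {d' : V → ℤ} {p q : V} {r : ℤ} {R' : ℝ}, Graphical d' →
      (∀ v, |(d' v : ℝ) - c| ≤ R') → R' ≤ R + 2 → p ≠ q → (r = 1 ∨ r = -1) →
      Graphical (d' + r • (Pi.single p 1 + Pi.single q 1)) ∧
      ∀ v, |(((d' + r • (Pi.single p 1 + Pi.single q 1) : V → ℤ) v : ℤ) : ℝ) - c| ≤ R' + 1 := by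
    intro d' p q r R' hd' hb hR' hpq hr
    refine ⟨hd'.add_single_add_single hA (fun v => (hb v).trans hR') hpq hr, fun v => ?_⟩
    have h1 := abs_smul_single_add_single_le hpq hr v
    have h2 := hb v
    rw [Pi.add_apply, Int.cast_add]
    rw [abs_le] at *
    constructor <;> linarith
  have hns : -s = 1 ∨ -s = -1 := by rcases hs with rfl | rfl <;> simp
  have s1 := step h hd (by linarith) (Ne.symm hx.1) hs
  by_cases hst : t = s
  · subst hst
    have s2 := step s1.1 s1.2 (by linarith) (Ne.symm hy.2.1) ht
    have s3 := step s2.1 s2.2 (by linarith) (Ne.symm hy.2.2) hns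
    convert s3.1 using 1
    module
  · have e : t = -s := by rcases hs with rfl | rfl <;> rcases ht with rfl | rfl <;> simp_all
    subst e
    have s2 := step s1.1 s1.2 (by linarith) (Ne.symm hx.2) hns
    convert s2.1 using 1
    module

theorem exists_move_toward {c R : ℝ} {h d : V → ℤ} (hh : ∀ v, |(h v : ℝ) - c| ≤ R)
    (hd : ∀ v, |(d v : ℝ) - c| ≤ R) (hne : h ≠ d) :
    ∃ (a : V) (s : ℤ), (s = 1 ∨ s = -1) ∧
      (∀ v, |(((h + s • Pi.single a 1 : V → ℤ) v : ℤ) : ℝ) - c| ≤ R) ∧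
      ∑ v, (d v - (h + s • Pi.single a 1 : V → ℤ) v).natAbs + 1 = ∑ v, (d v - h v).natAbs ∧
      ∑ v, (h + s • Pi.single a 1 : V → ℤ) v = ∑ v, h v + s := by
  obtain ⟨a, ha⟩ := Function.ne_iff.1 hne
  have main : ∀ s : ℤ, (s = 1 ∧ h a < d a ∨ s = -1 ∧ d a < h a) →
      (∀ v, |(((h + s • Pi.single a 1 : V → ℤ) v : ℤ) : ℝ) - c| ≤ R) ∧
      ∑ v, (d v - (h + s • Pi.single a 1 : V → ℤ) v).natAbs + 1 = ∑ v, (d v - h v).natAbs ∧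
      ∑ v, (h + s • Pi.single a 1 : V → ℤ) v = ∑ v, h v + s := by
    intro s hs
    have hv : ∀ v, (h + s • Pi.single a 1 : V → ℤ) v = h v + if v = a then s else 0 := by
      intro v; simp [Pi.single_apply]
    simp only [hv]
    refine ⟨fun v => ?_, ?_, ?_⟩
    · by_cases hva : v = a
      · subst hva
        have h1 := abs_le.1 (hh v)
        have h2 := abs_le.1 (hd v)
        rw [if_pos rfl, Int.cast_add, abs_le]
        rcases hs with ⟨rfl, h3⟩ | ⟨rfl, h3⟩
        · have : (h v : ℝ) + 1 ≤ d v := by exact_mod_cast h3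
          push_cast
          constructor <;> linarith
        · have : (d v : ℝ) + 1 ≤ h v := by exact_mod_cast h3
          push_cast
          constructor <;> linarith
      · simpa [hva] using hh v
    · rw [← Finset.add_sum_erase _ _ (Finset.mem_univ a),
        ← Finset.add_sum_erase _ (fun v => (d v - h v).natAbs) (Finset.mem_univ a), if_pos rfl,
        Finset.sum_congr rfl fun v hv => by rw [if_neg (Finset.ne_of_mem_erase hv), add_zero]]
      rcases hs with ⟨rfl, h3⟩ | ⟨rfl, h3⟩ <;> omega
    · simp [Finset.sum_add_distrib]
  rcases lt_or_gt_of_ne ha with g | g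
  · exact ⟨a, 1, Or.inl rfl, main 1 (Or.inl ⟨rfl, g⟩)⟩
  · exact ⟨a, -1, Or.inr rfl, main (-1) (Or.inr ⟨rfl, g⟩)⟩

theorem Graphical.of_graphical {c R : ℝ} (hA : Admissible (Fintype.card V) c (R + 2))
    (hV : 4 ≤ Fintype.card V) {d : V → ℤ} (hd : ∀ v, |(d v : ℝ) - c| ≤ R)
    (heven : Even (∑ v, d v)) (k : ℕ) {h : V → ℤ} (hk : ∑ v, (d v - h v).natAbs = k)
    (hG : Graphical h) (hh : ∀ v, |(h v : ℝ) - c| ≤ R) : Graphical d := by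
  induction k using Nat.strong_induction_on generalizing h with
  | _ k ih =>
    by_cases hne : h = d
    · exact hne ▸ hG
    obtain ⟨a, s, hs, hb1, hΦ1, hS1⟩ := exists_move_toward hh hd hne
    have hne' : h + s • Pi.single a 1 ≠ d := by
      intro he
      rw [he] at hS1
      have h1 := hG.even_sum
      rw [hS1, Int.even_add] at heven
      rcases hs with rfl | rfl <;> simp_all
    obtain ⟨b, t, ht, hb2, hΦ2, -⟩ := exists_move_toward hb1 hd hne'
    exact ih _ (by omega) rfl (hG.add_single hA hV hh a b hs ht) hb2

end Existence

section CirculantExistence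

/-- An almost regular graph. -/
def sumGraph (n k : ℕ) [NeZero n] : SimpleGraph (Fin n) where
  Adj i j := i ≠ j ∧ ((i + j : Fin n) : ℕ) < k
  symm := ⟨fun _ _ h => ⟨h.1.symm, by rw [add_comm]; exact h.2⟩⟩
  loopless := ⟨fun _ h => h.1 rfl⟩

theorem sum_adjInd_sumGraph {n k : ℕ} [NeZero n] (hk : k ≤ n) (i : Fin n) :
    ∑ j, adjInd (sumGraph n k) i j = k ∨ ∑ j, adjInd (sumGraph n k) i j = (k : ℝ) - 1 := by
  have h1 : ∑ j : Fin n, (if ((i + j : Fin n) : ℕ) < k then (1 : ℝ) else 0) = k := by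
    refine (Equiv.sum_comp (Equiv.addLeft i)
      (fun j : Fin n => if (j : ℕ) < k then (1 : ℝ) else 0)).trans ?_
    rw [Fin.sum_univ_eq_sum_range (fun j => if j < k then (1 : ℝ) else 0) n, Finset.sum_boole]
    congr 1
    rw [show (Finset.range n).filter (fun j => j < k) = Finset.range k by
      ext j; simp only [Finset.mem_filter, Finset.mem_range]; omega]
    simp
  have h2 : ∑ j, adjInd (sumGraph n k) i j =
      ∑ j : Fin n, (if ((i + j : Fin n) : ℕ) < k then (1 : ℝ) else 0) -
        if ((i + i : Fin n) : ℕ) < k then (1 : ℝ) else 0 := by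
    rw [← Finset.add_sum_erase _ _ (Finset.mem_univ i),
      ← Finset.add_sum_erase _ (fun j : Fin n => if ((i + j : Fin n) : ℕ) < k then (1 : ℝ) else 0)
        (Finset.mem_univ i), adjInd_self, zero_add, add_sub_cancel_left]
    refine Finset.sum_congr rfl fun j hj => ?_
    have : i ≠ j := (Finset.ne_of_mem_erase hj).symm
    simp [adjInd, sumGraph, this]
  rw [h2, h1]
  split_ifs
  · right; rfl
  · left; ring

theorem exists_graph_of_admissible {n : ℕ} (hn : 4 ≤ n) {d : Fin n → ℕ} {c R : ℝ} (hR1 : 1 ≤ R)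
    (hA : Admissible n c (R + 2)) (hd : ∀ v, |(d v : ℝ) - c| ≤ R) (heven : Even (∑ v, d v)) :
    ∃ H : SimpleGraph (Fin n), ∀ v, ∑ w, adjInd H v w = (d v : ℝ) := by
  have hne : NeZero n := ⟨by omega⟩
  obtain ⟨hc0, hcn⟩ : 0 ≤ c ∧ c < n := by
    obtain ⟨L, hL, h1, h2, h3, h4⟩ := hA
    have : 0 < L ^ 99 := by positivity
    constructor <;> linarith
  obtain ⟨k, hk⟩ : ∃ k : ℕ, k = ⌊c⌋₊ + 1 := ⟨_, rfl⟩
  have hk1 : (k : ℝ) - 1 ≤ c := by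
    rw [hk]; push_cast; linarith [Nat.floor_le hc0]
  have hk2 : c ≤ k := by
    rw [hk]; push_cast; exact (Nat.lt_floor_add_one c).le
  have hkn : k ≤ n := by
    have : ⌊c⌋₊ < n := (Nat.floor_lt hc0).2 hcn
    omega
  have hdeg := sum_adjInd_sumGraph hkn
  have hG : Graphical (fun v => (((sumGraph n k).degree v : ℕ) : ℤ)) :=
    ⟨sumGraph n k, fun v => by rw [sum_adjInd_eq_degree]; simp⟩
  have := Graphical.of_graphical (V := Fin n) (c := c) (R := R) (by simpa using hA)
    (by simpa using hn) (d := fun v => (d v : ℤ)) (by simpa using hd) (by exact_mod_cast heven) _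
    rfl hG (fun v => by
      have h1 : ((((sumGraph n k).degree v : ℕ) : ℤ) : ℝ) = ∑ j, adjInd (sumGraph n k) v j := by
        rw [sum_adjInd_eq_degree]; simp
      rw [h1, abs_le]
      rcases hdeg v with g | g <;> rw [g] <;> constructor <;> linarith)
  simpa [Graphical] using this

end CirculantExistence

section AgreeFamily

set_option linter.unusedSectionVars false

variable {V : Type*} [Fintype V] [DecidableEq V]

/-- The graphs with degrees `d` which agree with `Y` inside `M`, except perhaps at `a b`. -/
def agreeFamily (M : Finset V) (d : V → ℝ) (Y : SimpleGraph V) (a b : V) :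
    Finset (SimpleGraph V) :=
  Finset.univ.filter fun H => (∀ v, ∑ w, adjInd H v w = d v) ∧
    ∀ x ∈ M, ∀ y ∈ M, ¬ (x = a ∧ y = b) → ¬ (x = b ∧ y = a) → (H.Adj x y ↔ Y.Adj x y)

/-- The degree into the complement of `M \ {a, b}`. -/
def restDeg (M : Finset V) (d : V → ℝ) (Y : SimpleGraph V) (a b v : V) : ℝ :=
  d v - ∑ w ∈ M \ {a, b}, adjInd Y v w

/-- The number of vertices outside `M \ {a, b}`. -/
def restCard (M : Finset V) : ℝ := (Fintype.card V : ℝ) - M.card + 2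

/-- The mean degree inside the complement of `M \ {a, b}`. -/
def restMean (M : Finset V) (d : V → ℝ) (Y : SimpleGraph V) (a b : V) : ℝ :=
  (∑ v, d v - 2 * ∑ v ∈ M \ {a, b}, d v +
    ∑ v ∈ M \ {a, b}, ∑ w ∈ M \ {a, b}, adjInd Y v w) / restCard M

theorem filter_agreeFamily (M : Finset V) (d : V → ℝ) (Y : SimpleGraph V) (a b : V)
    {H₀ : SimpleGraph V} (h₀ : H₀ ∈ agreeFamily M d Y a b) :
    (agreeFamily M d Y a b).filter (fun H => offGraph (M \ {a, b})ᶜ H =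
      offGraph (M \ {a, b})ᶜ H₀) = degFamily (M \ {a, b})ᶜ d (offGraph (M \ {a, b})ᶜ H₀) := by
  ext H
  simp only [agreeFamily, degFamily, Finset.mem_filter, Finset.mem_univ, true_and] at h₀ ⊢
  constructor
  · rintro ⟨⟨h1, -⟩, h2⟩
    exact ⟨h1, h2⟩
  · rintro ⟨h1, h2⟩
    refine ⟨⟨h1, fun x hx y hy hab hba => ?_⟩, h2⟩
    rw [← h₀.2 x hx y hy hab hba]
    have h3 : (offGraph (M \ {a, b})ᶜ H).Adj x y ↔ (offGraph (M \ {a, b})ᶜ H₀).Adj x y := by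
      rw [h2]
    by_cases hxy : x = y
    · subst hxy; simp
    have : ¬ (x ∈ (M \ {a, b})ᶜ ∧ y ∈ (M \ {a, b})ᶜ) := by
      simp only [Finset.mem_compl, Finset.mem_sdiff, Finset.mem_insert, Finset.mem_singleton]
      rintro ⟨g1, g2⟩
      have g3 : x = a ∨ x = b := by tauto
      have g4 : y = a ∨ y = b := by tauto
      rcases g3 with rfl | rfl <;> rcases g4 with rfl | rfl <;> tauto
    exact ⟨fun h => (h3.1 ⟨h, this⟩).1, fun h => (h3.2 ⟨h, this⟩).1⟩

theorem adjInd_eq_of_mem_agreeFamily {M : Finset V} {d : V → ℝ} {Y : SimpleGraph V} {a b : V}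
    {H : SimpleGraph V} (hH : H ∈ agreeFamily M d Y a b) {x y : V} (hx : x ∈ M)
    (hy : y ∈ M \ {a, b}) : adjInd H x y = adjInd Y x y := by
  simp only [Finset.mem_sdiff, Finset.mem_insert, Finset.mem_singleton] at hy
  have := (Finset.mem_filter.1 hH).2.2 x hx y hy.1 (by tauto) (by tauto)
  simp [adjInd, this]

variable {M : Finset V} {d : V → ℝ} {Y : SimpleGraph V} {a b : V} {c R : ℝ}

theorem card_compl_sdiff_pair (ha : a ∈ M) (hb : b ∈ M) (hab : a ≠ b) :
    (((M \ {a, b})ᶜ.card : ℕ) : ℝ) = restCard M := by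
  have h1 : ({a, b} : Finset V) ⊆ M := by
    intro x hx
    simp only [Finset.mem_insert, Finset.mem_singleton] at hx
    rcases hx with rfl | rfl <;> assumption
  have h2 := Finset.card_sdiff_add_card_eq_card h1
  rw [Finset.card_pair hab] at h2
  have h3 := Finset.card_compl_add_card (M \ {a, b})
  rw [restCard, ← h3, ← h2]
  push_cast
  ring

theorem sum_restDeg {H : SimpleGraph V} (hH : H ∈ agreeFamily M d Y a b) :
    ∑ v ∈ (M \ {a, b})ᶜ, (d v - ∑ w ∈ M \ {a, b}, adjInd H v w) =
      ∑ v, d v - 2 * ∑ v ∈ M \ {a, b}, d v +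
        ∑ v ∈ M \ {a, b}, ∑ w ∈ M \ {a, b}, adjInd Y v w := by
  have hd := (Finset.mem_filter.1 hH).2.1
  have h1 : ∑ v ∈ M \ {a, b}, ∑ w ∈ M \ {a, b}, adjInd Y v w =
      ∑ v ∈ M \ {a, b}, ∑ w ∈ M \ {a, b}, adjInd H v w :=
    Finset.sum_congr rfl fun v hv => Finset.sum_congr rfl fun w hw =>
      (adjInd_eq_of_mem_agreeFamily hH (Finset.mem_sdiff.1 hv).1 hw).symm
  have h2 : ∑ v ∈ M \ {a, b}, d v = ∑ v ∈ M \ {a, b}, ∑ w ∈ M \ {a, b}, adjInd H v w +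
      ∑ v ∈ (M \ {a, b})ᶜ, ∑ w ∈ M \ {a, b}, adjInd H v w := by
    rw [Finset.sum_comm (s := (M \ {a, b})ᶜ), ← Finset.sum_add_distrib]
    refine Finset.sum_congr rfl fun v _ => ?_
    rw [← hd v, ← Finset.sum_add_sum_compl (M \ {a, b})]
    congr 1
    exact Finset.sum_congr rfl fun w _ => adjInd_comm H v w
  rw [Finset.sum_sub_distrib, ← Finset.sum_add_sum_compl (M \ {a, b}) d, h1]
  linarith

theorem nearRegular_agreeFamily (hA : Admissible (restCard M) c R)
    (hd : ∀ v, |d v - c| + M.card ≤ R) (ha : a ∈ M) (hb : b ∈ M) (hab : a ≠ b)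
    {H₀ : SimpleGraph V} (h₀ : H₀ ∈ agreeFamily M d Y a b) :
    ∃ L d', NearRegular (M \ {a, b})ᶜ d' (degFamily (M \ {a, b})ᶜ d (offGraph (M \ {a, b})ᶜ H₀)) L
      (restMean M d Y a b) ∧ L ^ 100 = restCard M ∧ d' a = restDeg M d Y a b a ∧
        d' b = restDeg M d Y a b b := by
  have hd' : ∀ v ∈ (M \ {a, b})ᶜ, ∑ w ∈ (M \ {a, b})ᶜᶜ,
      adjInd (offGraph (M \ {a, b})ᶜ H₀) v w = ∑ w ∈ M \ {a, b}, adjInd H₀ v w := by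
    intro v _
    rw [compl_compl]
    refine Finset.sum_congr rfl fun w hw => adjInd_offGraph _ fun h => ?_
    exact (Finset.mem_compl.1 h.2) hw
  obtain ⟨L, hL, h⟩ := hA.nearRegular (card_compl_sdiff_pair ha hb hab)
    (switchFamily_degFamily (M \ {a, b})ᶜ d (offGraph (M \ {a, b})ᶜ H₀)) fun v hv => by
      rw [hd' v hv]
      have h1 : ∑ w ∈ M \ {a, b}, adjInd H₀ v w ≤ M.card :=
        calc _ ≤ ∑ w ∈ M \ {a, b}, (1 : ℝ) := Finset.sum_le_sum fun w _ => adjInd_le_one _ _ _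
          _ ≤ M.card := by
            rw [Finset.sum_const, nsmul_eq_mul, mul_one]
            exact_mod_cast Finset.card_le_card Finset.sdiff_subset
      have h2 : 0 ≤ ∑ w ∈ M \ {a, b}, adjInd H₀ v w :=
        Finset.sum_nonneg fun w _ => adjInd_nonneg _ _ _
      have h3 := hd v
      have h4 := abs_le.1 (le_refl |d v - c|)
      rw [abs_le]
      constructor <;> linarith
  have ha' : a ∈ (M \ {a, b})ᶜ := by simp
  have hb' : b ∈ (M \ {a, b})ᶜ := by simp
  refine ⟨L, fun v => d v - ∑ w ∈ (M \ {a, b})ᶜᶜ, adjInd (offGraph (M \ {a, b})ᶜ H₀) v w,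
    ?_, hL, ?_, ?_⟩
  · convert h using 2
    rw [Finset.sum_congr rfl fun v hv => by rw [hd' v hv], sum_restDeg h₀]
    rfl
  · simp only [hd' a ha', restDeg]
    rw [Finset.sum_congr rfl fun w hw => adjInd_eq_of_mem_agreeFamily h₀ ha hw]
  · simp only [hd' b hb', restDeg]
    rw [Finset.sum_congr rfl fun w hw => adjInd_eq_of_mem_agreeFamily h₀ hb hw]

theorem sum_agreeFamily (f : SimpleGraph V → ℝ) :
    ∑ H ∈ agreeFamily M d Y a b, f H =
      ∑ K ∈ (agreeFamily M d Y a b).image (offGraph (M \ {a, b})ᶜ),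
        ∑ H ∈ degFamily (M \ {a, b})ᶜ d K, f H := by
  rw [← Finset.sum_fiberwise_of_maps_to (g := offGraph (M \ {a, b})ᶜ)
    (fun H hH => Finset.mem_image_of_mem _ hH)]
  refine Finset.sum_congr rfl fun K hK => ?_
  obtain ⟨H₀, h₀, rfl⟩ := Finset.mem_image.1 hK
  rw [filter_agreeFamily M d Y a b h₀]

theorem abs_sum_adjInd_agreeFamily_sub_le (hA : Admissible (restCard M) c R)
    (hd : ∀ v, |d v - c| + M.card ≤ R) (ha : a ∈ M) (hb : b ∈ M) (hab : a ≠ b) :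
    |restCard M ^ 2 * ∑ H ∈ agreeFamily M d Y a b, adjInd H a b -
      (agreeFamily M d Y a b).card * (restCard M *
        (restDeg M d Y a b a + restDeg M d Y a b b - restMean M d Y a b))| ≤
      (agreeFamily M d Y a b).card * (6 * restCard M + restCard M ^ 2 *
        (|restDeg M d Y a b a - restMean M d Y a b| * |restDeg M d Y a b b - restMean M d Y a b|) /
          (restMean M d Y a b * (restCard M - restMean M d Y a b))) := by
  have hcard : ((agreeFamily M d Y a b).card : ℝ) = ∑ H ∈ agreeFamily M d Y a b, (1 : ℝ) := by simp
  rw [hcard, sum_agreeFamily, sum_agreeFamily, Finset.mul_sum, Finset.sum_mul, Finset.sum_mul,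
    ← Finset.sum_sub_distrib]
  refine (Finset.abs_sum_le_sum_abs _ _).trans (Finset.sum_le_sum fun K hK => ?_)
  obtain ⟨H₀, h₀, rfl⟩ := Finset.mem_image.1 hK
  obtain ⟨L, d', hR, hL, h1, h2⟩ := nearRegular_agreeFamily hA hd ha hb hab h₀
  have := hR.abs_sum_adjInd_sub_le (a := a) (b := b) (by simp) (by simp) hab
  rw [show L ^ 200 = (L ^ 100) ^ 2 by ring, hL, h1, h2] at this
  simpa using this

theorem exists_adj_of_mem_agreeFamily (hA : Admissible (restCard M) c R)
    (hd : ∀ v, |d v - c| + M.card ≤ R) (ha : a ∈ M) (hb : b ∈ M) (hab : a ≠ b)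
    (hne : (agreeFamily M d Y a b).Nonempty) :
    (∃ H ∈ agreeFamily M d Y a b, H.Adj a b) ∧ ∃ H ∈ agreeFamily M d Y a b, ¬ H.Adj a b := by
  obtain ⟨H₀, h₀⟩ := hne
  obtain ⟨L, d', hR, -⟩ := nearRegular_agreeFamily hA hd ha hb hab h₀
  have hf := filter_agreeFamily M d Y a b h₀
  have hne : (degFamily (M \ {a, b})ᶜ d (offGraph (M \ {a, b})ᶜ H₀)).Nonempty :=
    ⟨H₀, by rw [← hf]; simp [h₀]⟩
  obtain ⟨⟨H₁, h₁, h₁'⟩, H₂, h₂, h₂'⟩ :=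
    hR.exists_adj_and_not_adj hne (a := a) (b := b) (by simp) (by simp) hab
  rw [← hf, Finset.mem_filter] at h₁ h₂
  exact ⟨⟨H₁, h₁.1, h₁'⟩, H₂, h₂.1, h₂'⟩

end AgreeFamily

section LogRatioEstimate

theorem abs_log_one_add_sub_le {t : ℝ} (ht : |t| ≤ 1 / 2) : |Real.log (1 + t) - t| ≤ 2 * t ^ 2 := by
  have h := abs_le.1 ht
  have h0 : 0 < 1 + t := by linarith
  have h1 := Real.log_le_sub_one_of_pos h0
  have h2 := Real.one_sub_inv_le_log_of_pos h0
  have h3 : t - 2 * t ^ 2 ≤ 1 - (1 + t)⁻¹ := by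
    rw [le_sub_iff_add_le, ← le_sub_iff_add_le', inv_le_iff_one_le_mul₀ h0]
    nlinarith [mul_nonneg (sq_nonneg t) (by linarith : 0 ≤ 1 + 2 * t)]
  rw [abs_le]
  constructor <;> nlinarith [sq_nonneg t]

theorem abs_log_add_sub_le {l A z : ℝ} (hA : 0 < A) (hl : 2 * A ≤ l) (hz : |z| ≤ A) :
    |Real.log (l + z) - Real.log l - z / l| ≤ z ^ 2 / (2 * A ^ 2) := by
  have hl0 : 0 < l := by linarith
  have h1 : |z / l| ≤ 1 / 2 := by
    rw [abs_div, abs_of_pos hl0, div_le_iff₀ hl0]; linarith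
  have h2 := abs_log_one_add_sub_le h1
  have h3 : 0 < 1 + z / l := by linarith [(abs_le.1 h1).1]
  have h4 : Real.log (l + z) = Real.log l + Real.log (1 + z / l) := by
    rw [← Real.log_mul hl0.ne' h3.ne']
    congr 1
    field_simp
  rw [h4, add_sub_cancel_left]
  refine h2.trans ?_
  rw [div_pow, mul_div_assoc', div_le_div_iff₀ (by positivity) (by positivity)]
  have h5 : (2 * A) ^ 2 ≤ l ^ 2 := by gcongr
  nlinarith [mul_le_mul_of_nonneg_left h5 (sq_nonneg z)]

/-- Linearization of the log-odds. -/
theorem abs_log_odds_sub_le {l A z : ℝ} (hl0 : 0 < l) (hl1 : l < 1) (hA : A = l * (1 - l) / 2)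
    (hz : |z| ≤ A) :
    |Real.log (l + z) - Real.log (1 - l - z) - (Real.log l - Real.log (1 - l)) - z / (2 * A)| ≤
      z ^ 2 / A ^ 2 := by
  have h1 : 0 < 1 - l := by linarith
  have hA0 : 0 < A := by rw [hA]; positivity
  have e1 := abs_log_add_sub_le hA0 (by nlinarith : 2 * A ≤ l) hz
  have e2 := abs_log_add_sub_le hA0 (by nlinarith : 2 * A ≤ 1 - l) (by rwa [abs_neg] : |-z| ≤ A)
  have e3 : z / (2 * A) = z / l - -z / (1 - l) := by
    rw [hA]; field_simp; ring
  have e4 : z ^ 2 / A ^ 2 = z ^ 2 / (2 * A ^ 2) + (-z) ^ 2 / (2 * A ^ 2) := by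
    field_simp; ring
  rw [e3, e4]
  rw [abs_le] at *
  rw [← sub_eq_add_neg] at e2
  constructor <;> linarith

/-- The mean degree after deletion of a small vertex set is within a factor of the original. -/
theorem le_mean_mul_sub_mean {n m l A κ S e N D : ℝ} (hl0 : 0 < l) (hl1 : l < 1)
    (hA : A = l * (1 - l) / 2) (hm : 2 ≤ m) (hmκ : m ^ 2 ≤ κ) (hκ : 1000000 * κ ≤ A * n)
    (hS : |S| ≤ κ) (he0 : 0 ≤ e) (hem : e ≤ m ^ 2) (hN : N = n - m + 2)
    (hD : N * D = n * (l * (n - 1)) - 2 * ((m - 2) * (l * (n - 1)) + S) + e) :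
    A * n ^ 2 ≤ D * (N - D) := by
  have h1 : 0 < 1 - l := by linarith
  have hA0 : 0 < A := by rw [hA]; positivity
  have hA1 : A ≤ 1 / 8 := by rw [hA]; nlinarith [sq_nonneg (2 * l - 1)]
  have hκ4 : 4 ≤ κ := by nlinarith
  have hn0 : 0 < n := by
    by_contra h
    nlinarith [mul_nonneg hA0.le (by linarith : 0 ≤ -n)]
  have hn : 8000000 * κ ≤ n := by nlinarith
  have hmκ' : m ≤ κ := by nlinarith
  have hS' := abs_le.1 hS
  have hNn : N ≤ n := by linarith
  have hN0 : 0 < N := by linarith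
  have hAl : 2 * A ≤ l := by nlinarith
  have hAl' : 2 * A ≤ 1 - l := by nlinarith
  have b1 : 1000000 * κ * n ≤ l / 2 * n ^ 2 := by
    nlinarith [mul_le_mul_of_nonneg_right hκ hn0.le, mul_le_mul_of_nonneg_right hAl (sq_nonneg n)]
  have b2 : 1000000 * κ * n ≤ (1 - l) / 2 * n ^ 2 := by
    nlinarith [mul_le_mul_of_nonneg_right hκ hn0.le, mul_le_mul_of_nonneg_right hAl' (sq_nonneg n)]
  have b3 : κ ≤ κ * n := by nlinarith
  have b4 : m * n ≤ κ * n := by gcongr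
  have b5 : 2 * n ≤ m * n := by gcongr
  have d1 : 9 / 10 * l * n ^ 2 ≤ N * D := by
    have g1 : (n - 2 * (m - 2)) * (n - 1) ≥ n ^ 2 - 3 * κ * n := by linarith
    have g2 := mul_le_mul_of_nonneg_left g1 hl0.le
    have g3 : l * (κ * n) ≤ κ * n := mul_le_of_le_one_left (by positivity) hl1.le
    rw [hD]
    linarith
  have d2 : 9 / 10 * (1 - l) * n ^ 2 ≤ N * (N - D) := by
    have g1 : (n - 2 * (m - 2)) * (n - 1) ≤ n ^ 2 := by linarith
    have g2 := mul_le_mul_of_nonneg_left g1 hl0.le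
    have g3 : n ^ 2 - 2 * κ * n ≤ N ^ 2 := by
      have : N ^ 2 = n ^ 2 - 2 * (m * n) + 4 * n + (m - 2) ^ 2 := by rw [hN]; ring
      linarith [sq_nonneg (m - 2)]
    rw [mul_sub N, hD]
    linarith
  have p1 : 0 ≤ l * n ^ 2 := by positivity
  have p2 : 0 ≤ (1 - l) * n ^ 2 := by positivity
  have d3 := mul_le_mul d1 d2 (by linarith) (by linarith)
  have d4 : N ^ 2 * (A * n ^ 2) ≤ N ^ 2 * (D * (N - D)) := by
    have q1 : N ^ 2 ≤ n ^ 2 := by gcongr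
    have q2 := mul_le_mul_of_nonneg_right q1 (by positivity : 0 ≤ A * n ^ 2)
    have q3 : 0 ≤ A * n ^ 4 := by positivity
    have q4 : 9 / 10 * l * n ^ 2 * (9 / 10 * (1 - l) * n ^ 2) = 81 / 50 * (A * n ^ 4) := by
      rw [hA]; ring
    have q5 : N * D * (N * (N - D)) = N ^ 2 * (D * (N - D)) := by ring
    have q6 : n ^ 2 * (A * n ^ 2) = A * n ^ 4 := by ring
    linarith
  exact le_of_mul_le_mul_left d4 (by positivity)

theorem edge_probability_identity {n m l S e N D δ δ' x x' W : ℝ} (hN0 : N ≠ 0) (hn0 : n ≠ 0)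
    (hN : N = n - m + 2)
    (hD : N * D = n * (l * (n - 1)) - 2 * ((m - 2) * (l * (n - 1)) + S) + e)
    (hW : W = δ + δ' - x - x' + l * (2 * m - 5)) :
    ((l * (n - 1) + δ - x) + (l * (n - 1) + δ' - x') - D) / N - l -
      (δ + δ' - x - x' + 2 * l * m) / n = W * (m - 2) / (n * N) - 5 * l / n +
        ((m - 2) * (m - 3) * l + 2 * S - e) / N ^ 2 := by
  have h1 : (l * (n - 1) + δ - x) + (l * (n - 1) + δ' - x') - D =
      l * N + W + ((m - 2) * (m - 3) * l + 2 * S - e) / N := by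
    have : D = (n * (l * (n - 1)) - 2 * ((m - 2) * (l * (n - 1)) + S) + e) / N := by
      rw [eq_div_iff hN0, mul_comm, hD]
    rw [this, hW, sub_eq_iff_eq_add, add_assoc, ← add_div]
    have h2 : (m - 2) * (m - 3) * l + 2 * S - e +
        (n * (l * (n - 1)) - 2 * ((m - 2) * (l * (n - 1)) + S) + e) =
        l * (N - 1) * N := by rw [hN]; ring
    rw [h2, mul_div_cancel_right₀ _ hN0, hN]
    ring
  have h2 : W * (m - 2) / (n * N) = W / N - W / n := by
    rw [show m - 2 = n - N by rw [hN]; ring]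
    field_simp
  have h3 : (δ + δ' - x - x' + 2 * l * m) / n = W / n + 5 * l / n := by
    rw [hW, ← add_div]; congr 1; ring
  rw [h1, h2, h3, add_div, add_div, mul_div_cancel_right₀ _ hN0, div_div, ← pow_two]
  ring

set_option maxHeartbeats 1000000 in
/-- The estimate of the edge probability, in terms of the original parameters. -/
theorem abs_edge_probability_sub_le {n m l A κ S e N D δ δ' x x' p : ℝ} (hl0 : 0 < l) (hl1 : l < 1)
    (hA : A = l * (1 - l) / 2) (hm : 2 ≤ m) (hmκ : m ^ 2 ≤ κ) (hκ : 1000000 * κ ≤ A * n)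
    (hS : |S| ≤ κ) (he0 : 0 ≤ e) (hem : e ≤ m ^ 2) (hN : N = n - m + 2)
    (hD : N * D = n * (l * (n - 1)) - 2 * ((m - 2) * (l * (n - 1)) + S) + e)
    (hδ : m * |δ| ≤ κ) (hδ' : m * |δ'| ≤ κ) (hx0 : 0 ≤ x) (hxm : x ≤ m) (hx0' : 0 ≤ x')
    (hxm' : x' ≤ m)
    (hp : |p - ((l * (n - 1) + δ - x) + (l * (n - 1) + δ' - x') - D) / N| ≤
      6 / N + |l * (n - 1) + δ - x - D| * |l * (n - 1) + δ' - x' - D| / (D * (N - D))) :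
    |p - l - (δ + δ' - x - x' + 2 * l * m) / n| ≤ 20 * κ / (n * m ^ 2) := by
  have hDN := le_mean_mul_sub_mean hl0 hl1 hA hm hmκ hκ hS he0 hem hN hD
  have h1 : 0 < 1 - l := by linarith
  have hA0 : 0 < A := by rw [hA]; positivity
  have hA1 : A ≤ 1 / 8 := by rw [hA]; nlinarith [sq_nonneg (2 * l - 1)]
  have hκ4 : 4 ≤ κ := by nlinarith
  have hn0 : 0 < n := by
    by_contra h
    nlinarith [mul_nonneg hA0.le (by linarith : 0 ≤ -n)]
  have hn : 8000000 * κ ≤ n := by nlinarith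
  have hmκ' : m ≤ κ := by nlinarith
  have hm0 : 0 < m := by linarith
  have hS' := abs_le.1 hS
  have hN2 : n / 2 ≤ N := by linarith
  have hN0 : 0 < N := by linarith
  have hln : l * (n - 1) ≤ n := by nlinarith
  have hln0 : 0 ≤ l * (n - 1) := mul_nonneg hl0.le (by linarith)
  have hmm : m ≤ κ / m := by rw [le_div_iff₀ hm0]; linarith
  have hδ1 : |δ| ≤ κ / m := by rw [le_div_iff₀ hm0]; linarith
  have hδ1' : |δ'| ≤ κ / m := by rw [le_div_iff₀ hm0]; linarith
  have hDd : |l * (n - 1) - D| ≤ 3 * m := by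
    have g : l * (n - 1) - D = ((m - 2) * (l * (n - 1)) + 2 * S - e) / N := by
      rw [eq_div_iff hN0.ne']
      have : D * N = _ := (mul_comm D N).trans hD
      rw [sub_mul, this, hN]; ring
    rw [g, abs_div, abs_of_pos hN0, div_le_iff₀ hN0]
    have g1 : (m - 2) * (l * (n - 1)) ≤ m * n :=
      mul_le_mul (by linarith) hln hln0 hm0.le
    have g2 : 0 ≤ (m - 2) * (l * (n - 1)) := mul_nonneg (by linarith) hln0
    have g3 : 3 * κ ≤ m * n / 2 := by nlinarith
    have g4 : m * (n / 2) ≤ m * N := by gcongr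
    rw [abs_le]
    constructor <;> linarith
  have dev : ∀ {δ x : ℝ}, |δ| ≤ κ / m → 0 ≤ x → x ≤ m →
      |l * (n - 1) + δ - x - D| ≤ 5 * (κ / m) := by
    intro δ x hδ hx0 hxm
    rw [abs_le] at *
    constructor <;> linarith
  have r1 : |l * (n - 1) + δ - x - D| * |l * (n - 1) + δ' - x' - D| / (D * (N - D)) ≤
      κ / (n * m ^ 2) := by
    have g1 : |l * (n - 1) + δ - x - D| * |l * (n - 1) + δ' - x' - D| ≤
        (5 * (κ / m)) * (5 * (κ / m)) :=
      mul_le_mul (dev hδ1 hx0 hxm) (dev hδ1' hx0' hxm') (abs_nonneg _) (by positivity)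
    calc _ ≤ (5 * (κ / m)) * (5 * (κ / m)) / (A * n ^ 2) := by gcongr
      _ = κ / (n * m ^ 2) * (25 * κ / (A * n)) := by field_simp; ring
      _ ≤ κ / (n * m ^ 2) * 1 := by
        gcongr
        rw [div_le_one (by positivity)]
        linarith
      _ = _ := mul_one _
  have small : ∀ {c : ℝ}, 0 ≤ c → c / n ≤ c * κ / (n * m ^ 2) := by
    intro c hc
    rw [div_le_div_iff₀ hn0 (by positivity)]
    nlinarith [mul_le_mul_of_nonneg_left hmκ (mul_nonneg hc hn0.le)]
  have r2 : 6 / N ≤ 12 * κ / (n * m ^ 2) := by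
    refine le_trans ?_ (small (by norm_num))
    rw [div_le_div_iff₀ hN0 hn0]
    linarith
  obtain ⟨W, hW⟩ : ∃ W, W = δ + δ' - x - x' + l * (2 * m - 5) := ⟨_, rfl⟩
  have hWb : |W| ≤ 6 * (κ / m) := by
    have g1 : l * m ≤ m := mul_le_of_le_one_left hm0.le hl1.le
    have g2 : l * 2 ≤ l * m := by gcongr
    rw [hW]
    rw [abs_le] at *
    constructor <;> linarith
  have key : ((l * (n - 1) + δ - x) + (l * (n - 1) + δ' - x') - D) / N - l -
      (δ + δ' - x - x' + 2 * l * m) / n = W * (m - 2) / (n * N) - 5 * l / n +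
        ((m - 2) * (m - 3) * l + 2 * S - e) / N ^ 2 := by
    exact edge_probability_identity hN0.ne' hn0.ne' hN hD hW
  have k1 : |W * (m - 2) / (n * N)| ≤ κ / (n * m ^ 2) := by
    have g1 : |W * (m - 2)| ≤ 6 * κ := by
      rw [abs_mul, abs_of_nonneg (by linarith : 0 ≤ m - 2)]
      calc _ ≤ 6 * (κ / m) * m := by gcongr; linarith
        _ = 6 * κ := by field_simp
    rw [abs_div, abs_of_pos (by positivity : 0 < n * N)]
    calc _ ≤ 6 * κ / (n * N) := by gcongr
      _ = κ * 6 / (n * N) := by ring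
      _ ≤ κ / (n * m ^ 2) := by
        rw [div_le_div_iff₀ (by positivity) (by positivity)]
        have : 6 * m ^ 2 ≤ N := by linarith
        nlinarith [mul_le_mul_of_nonneg_left this (by positivity : 0 ≤ κ * n)]
  have k2 : 5 * l / n ≤ 5 * κ / (n * m ^ 2) := by
    refine le_trans ?_ (small (by norm_num))
    gcongr
    linarith
  have k2' : 0 ≤ 5 * l / n := by positivity
  have k3 : |((m - 2) * (m - 3) * l + 2 * S - e) / N ^ 2| ≤ κ / (n * m ^ 2) := by
    have g1 : |(m - 2) * (m - 3) * l| ≤ m ^ 2 := by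
      rw [abs_mul, abs_of_pos hl0]
      have : |(m - 2) * (m - 3)| ≤ m ^ 2 := by
        rw [abs_le]; constructor <;> nlinarith
      exact (mul_le_of_le_one_right (abs_nonneg _) hl1.le).trans this
    have g2 : |(m - 2) * (m - 3) * l + 2 * S - e| ≤ 4 * κ := by
      rw [abs_le] at *
      constructor <;> linarith
    rw [abs_div, abs_of_pos (by positivity : 0 < N ^ 2), div_le_div_iff₀ (by positivity) (by positivity)]
    calc _ ≤ 4 * κ * (n * m ^ 2) := by gcongr
      _ ≤ κ * N ^ 2 := by
        have q1 : n * m ^ 2 ≤ n * (n / 16) := by gcongr; linarith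
        have q2 : (n / 2) ^ 2 ≤ N ^ 2 := by gcongr
        nlinarith
  have tot : 20 * κ / (n * m ^ 2) = 12 * κ / (n * m ^ 2) + κ / (n * m ^ 2) + κ / (n * m ^ 2) +
    5 * κ / (n * m ^ 2) + κ / (n * m ^ 2) := by ring
  rw [tot]
  rw [abs_le] at hp k1 k3 ⊢
  constructor <;> linarith

set_option maxHeartbeats 1000000 in
/-- The estimate of the log-odds of an edge, in terms of the original parameters. -/
theorem abs_log_sub_log_sub_le {n m l A κ S e N D δ δ' x x' F₀ F₁ : ℝ} (hl0 : 0 < l) (hl1 : l < 1)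
    (hA : A = l * (1 - l) / 2) (hm : 2 ≤ m) (hmκ : m ^ 2 ≤ κ) (hκ : 1000000 * κ ≤ A * n)
    (hS : |S| ≤ κ) (he0 : 0 ≤ e) (hem : e ≤ m ^ 2) (hN : N = n - m + 2)
    (hD : N * D = n * (l * (n - 1)) - 2 * ((m - 2) * (l * (n - 1)) + S) + e)
    (hδ : m * |δ| ≤ κ) (hδ' : m * |δ'| ≤ κ) (hx0 : 0 ≤ x) (hxm : x ≤ m) (hx0' : 0 ≤ x')
    (hxm' : x' ≤ m) (hF₀ : 0 < F₀) (hF₁ : 0 < F₁)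
    (hF : |N ^ 2 * F₁ - (F₀ + F₁) * (N *
        ((l * (n - 1) + δ - x) + (l * (n - 1) + δ' - x') - D))| ≤
      (F₀ + F₁) * (6 * N + N ^ 2 * (|l * (n - 1) + δ - x - D| * |l * (n - 1) + δ' - x' - D|) /
        (D * (N - D)))) :
    |Real.log F₁ - Real.log F₀ - (Real.log l - Real.log (1 - l)) -
      (δ + δ' - x - x' + 2 * l * m) / (2 * (A * n))| ≤ 11 * κ / (A * n * m ^ 2) := by
  have hF0 : 0 < F₀ + F₁ := by linarith
  have hA0 : 0 < A := by rw [hA]; nlinarith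
  have hκ4 : 4 ≤ κ := by nlinarith
  have hn0 : 0 < n := by
    by_contra h
    nlinarith [mul_nonneg hA0.le (by linarith : 0 ≤ -n)]
  have hA1 : A ≤ 1 / 8 := by rw [hA]; nlinarith [sq_nonneg (2 * l - 1)]
  have hn : 8000000 * κ ≤ n := by nlinarith
  have hm0 : 0 < m := by linarith
  have hmκ' : m ≤ κ := by nlinarith
  have hN0 : 0 < N := by linarith
  have hp := abs_edge_probability_sub_le (p := F₁ / (F₀ + F₁)) hl0 hl1 hA hm hmκ hκ hS he0 hem hN hD
    hδ hδ' hx0 hxm hx0' hxm' (by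
      have g := div_le_div_of_nonneg_right hF (by positivity : 0 ≤ (F₀ + F₁) * N ^ 2)
      rw [← abs_of_pos (by positivity : 0 < (F₀ + F₁) * N ^ 2), ← abs_div,
        abs_of_pos (by positivity : 0 < (F₀ + F₁) * N ^ 2)] at g
      have g1 : (N ^ 2 * F₁ - (F₀ + F₁) * (N * ((l * (n - 1) + δ - x) + (l * (n - 1) + δ' - x') -
          D))) / ((F₀ + F₁) * N ^ 2) =
          F₁ / (F₀ + F₁) - ((l * (n - 1) + δ - x) + (l * (n - 1) + δ' - x') - D) / N := by
        field_simp
      have g2 : ∀ B C : ℝ, (F₀ + F₁) * (6 * N + N ^ 2 * B / C) / ((F₀ + F₁) * N ^ 2) =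
          6 / N + B / C := by
        intro B C
        rw [mul_div_mul_left _ _ hF0.ne', mul_div_assoc, add_div,
          mul_div_cancel_left₀ _ (by positivity)]
        congr 1
        field_simp
      rwa [g1, g2] at g)
  obtain ⟨z, hz⟩ : ∃ z, z = F₁ / (F₀ + F₁) - l := ⟨_, rfl⟩
  rw [← hz] at hp
  have hz0 : |(δ + δ' - x - x' + 2 * l * m) / n| ≤ 6 * (κ / m) / n := by
    rw [abs_div, abs_of_pos hn0]
    gcongr
    have hmm : m ≤ κ / m := by rw [le_div_iff₀ hm0]; linarith
    have hδ1 : |δ| ≤ κ / m := by rw [le_div_iff₀ hm0]; linarith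
    have hδ1' : |δ'| ≤ κ / m := by rw [le_div_iff₀ hm0]; linarith
    have g1 : l * m ≤ m := mul_le_of_le_one_left hm0.le hl1.le
    have g2 : 0 ≤ l * m := by positivity
    rw [abs_le] at *
    constructor <;> linarith
  have hzb : |z| ≤ 16 * (κ / (n * m)) := by
    have g1 : 20 * κ / (n * m ^ 2) ≤ 10 * (κ / (n * m)) := by
      rw [mul_div_assoc', div_le_div_iff₀ (by positivity) (by positivity)]
      have : 2 * m ≤ m ^ 2 := by nlinarith
      nlinarith [mul_le_mul_of_nonneg_left this (by positivity : 0 ≤ κ * n)]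
    have g2 : 6 * (κ / m) / n = 6 * (κ / (n * m)) := by field_simp
    rw [g2] at hz0
    rw [abs_le] at *
    constructor <;> linarith
  have hzA : |z| ≤ A := by
    refine hzb.trans ?_
    rw [mul_div_assoc', div_le_iff₀ (by positivity)]
    have : A * n * 1 ≤ A * n * m := by gcongr; linarith
    linarith
  have main := abs_log_odds_sub_le hl0 hl1 hA hzA
  have hq : z ^ 2 / A ^ 2 ≤ κ / (A * n * m ^ 2) := by
    have hz2 : z ^ 2 ≤ (16 * (κ / (n * m))) ^ 2 :=
      sq_le_sq' (by linarith [(abs_le.1 hzb).1]) (abs_le.1 hzb).2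
    calc z ^ 2 / A ^ 2 ≤ (16 * (κ / (n * m))) ^ 2 / A ^ 2 :=
          div_le_div_of_nonneg_right hz2 (by positivity)
      _ = κ / (A * n * m ^ 2) * (256 * κ / (A * n)) := by field_simp; ring
      _ ≤ κ / (A * n * m ^ 2) * 1 := by
        gcongr
        rw [div_le_one (by positivity)]
        linarith
      _ = _ := mul_one _
  have hlin : |z / (2 * A) - (δ + δ' - x - x' + 2 * l * m) / (2 * (A * n))| ≤
      10 * κ / (A * n * m ^ 2) := by
    have g1 : z / (2 * A) - (δ + δ' - x - x' + 2 * l * m) / (2 * (A * n)) =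
        (z - (δ + δ' - x - x' + 2 * l * m) / n) / (2 * A) := by field_simp
    rw [g1, abs_div, abs_of_pos (by positivity : 0 < 2 * A), div_le_iff₀ (by positivity)]
    refine hp.trans (le_of_eq ?_)
    field_simp
    ring
  have e1 : Real.log (l + z) = Real.log F₁ - Real.log (F₀ + F₁) := by
    rw [hz, add_sub_cancel, Real.log_div hF₁.ne' hF0.ne']
  have e2 : Real.log (1 - l - z) = Real.log F₀ - Real.log (F₀ + F₁) := by
    rw [hz, ← Real.log_div hF₀.ne' hF0.ne']
    congr 1
    field_simp
    ring
  rw [e1, e2] at main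
  have tot : 11 * κ / (A * n * m ^ 2) = 10 * κ / (A * n * m ^ 2) + κ / (A * n * m ^ 2) := by ring
  rw [tot]
  rw [abs_le] at *
  constructor <;> linarith

end LogRatioEstimate

section PairCount

variable {n : ℕ}

/-- The pairs of elements of `M`, in increasing order. -/
def pairsIn (M : Finset (Fin n)) : Finset (Fin n × Fin n) :=
  (M ×ˢ M).filter fun e => e.1 < e.2

theorem mem_pairsIn {M : Finset (Fin n)} {e : Fin n × Fin n} :
    e ∈ pairsIn M ↔ e.1 ∈ M ∧ e.2 ∈ M ∧ e.1 < e.2 := by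
  simp [pairsIn, and_assoc]

/-- The graph with edge set `T`. -/
def pairGraph (T : Finset (Fin n × Fin n)) : SimpleGraph (Fin n) where
  Adj x y := (x < y ∧ (x, y) ∈ T) ∨ (y < x ∧ (y, x) ∈ T)
  symm := ⟨fun _ _ h => h.symm⟩
  loopless := ⟨fun x h => by rcases h with h | h <;> exact lt_irrefl _ h.1⟩

/-- The degree of `v` in the graph with edge set `T`. -/
def pairDeg (T : Finset (Fin n × Fin n)) (v : Fin n) : ℝ :=
  ∑ e ∈ T, ((if e.1 = v then 1 else 0) + (if e.2 = v then 1 else 0))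

/-- The pairs in `M` that are edges of `H`. -/
def trace (M : Finset (Fin n)) (H : SimpleGraph (Fin n)) : Finset (Fin n × Fin n) :=
  (pairsIn M).filter fun e => H.Adj e.1 e.2

/-- The graphs with degrees `d` that induce the edge set `T` on `M`. -/
def extFamily (M : Finset (Fin n)) (d : Fin n → ℝ) (T : Finset (Fin n × Fin n)) :
    Finset (SimpleGraph (Fin n)) :=
  Finset.univ.filter fun H => (∀ v, ∑ w, adjInd H v w = d v) ∧ trace M H = T

theorem sum_adjInd_pairGraph {M : Finset (Fin n)} {T : Finset (Fin n × Fin n)}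
    (hT : T ⊆ pairsIn M) (v : Fin n) : ∑ w, adjInd (pairGraph T) v w = pairDeg T v := by
  have h1 : ∀ w, adjInd (pairGraph T) v w =
      ∑ e ∈ T, ((if e = (v, w) then 1 else 0) + (if e = (w, v) then 1 else 0)) := by
    intro w
    rw [Finset.sum_add_distrib, Finset.sum_ite_eq' T, Finset.sum_ite_eq' T]
    have h2 : ∀ x y : Fin n, (x, y) ∈ T → x < y := fun x y h => (mem_pairsIn.1 (hT h)).2.2
    by_cases g1 : (v, w) ∈ T
    · have g2 : (w, v) ∉ T := fun g => lt_asymm (h2 _ _ g) (h2 _ _ g1)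
      simp [adjInd, pairGraph, g1, g2, h2 _ _ g1]
    · by_cases g2 : (w, v) ∈ T
      · simp [adjInd, pairGraph, g1, g2, h2 _ _ g2]
      · simp [adjInd, pairGraph, g1, g2]
  simp only [h1]
  rw [Finset.sum_comm, pairDeg]
  refine Finset.sum_congr rfl fun e _ => ?_
  rw [Finset.sum_add_distrib]
  simp only [Prod.ext_iff]
  by_cases g1 : e.1 = v <;> by_cases g2 : e.2 = v <;> simp [g1, g2]

theorem sum_sdiff_adjInd_pairGraph {M : Finset (Fin n)} {T : Finset (Fin n × Fin n)}
    (hT : T ⊆ pairsIn M) {a b : Fin n} (hab : (a, b) ∉ T) (hba : (b, a) ∉ T) {v : Fin n}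
    (hv : v = a ∨ v = b) :
    ∑ w ∈ M \ {a, b}, adjInd (pairGraph T) v w = pairDeg T v := by
  rw [← sum_adjInd_pairGraph hT]
  refine Finset.sum_subset (Finset.subset_univ _) fun w _ hw => ?_
  simp only [Finset.mem_sdiff, Finset.mem_insert, Finset.mem_singleton] at hw
  have : ¬ (pairGraph T).Adj v w := by
    intro h
    have hwM : w ∈ M := by
      rcases h with h | h
      · exact (mem_pairsIn.1 (hT h.2)).2.1
      · exact (mem_pairsIn.1 (hT h.2)).1
    have h3 : w ≠ v := h.ne.symm
    have h4 : w = a ∨ w = b := by tauto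
    rcases hv with rfl | rfl <;> rcases h4 with rfl | rfl <;> rcases h with h | h <;> tauto
  simp [adjInd, this]

variable {M : Finset (Fin n)} {d : Fin n → ℝ} {T : Finset (Fin n × Fin n)} {a b : Fin n}

theorem mem_agreeFamily_pairGraph (hab : (a, b) ∈ pairsIn M)
    (H : SimpleGraph (Fin n)) : H ∈ agreeFamily M d (pairGraph T) a b ↔
      (∀ v, ∑ w, adjInd H v w = d v) ∧
        ∀ e ∈ pairsIn M, e ≠ (a, b) → (H.Adj e.1 e.2 ↔ e ∈ T) := by
  simp only [agreeFamily, Finset.mem_filter, Finset.mem_univ, true_and]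
  refine and_congr_right fun _ => ⟨fun h e he hne => ?_, fun h x hx y hy h1 h2 => ?_⟩
  · obtain ⟨h1, h2, h3⟩ := mem_pairsIn.1 he
    have h4 := (mem_pairsIn.1 hab).2.2
    rw [h e.1 h1 e.2 h2 (fun g => hne (Prod.ext g.1 g.2)) (fun g => by
      rw [g.1, g.2] at h3; exact lt_asymm h3 h4)]
    simp [pairGraph, h3, not_lt.2 h3.le]
  · rcases lt_trichotomy x y with g | g | g
    · rw [show H.Adj x y ↔ _ from h (x, y) (mem_pairsIn.2 ⟨hx, hy, g⟩) (by
        simpa [Prod.ext_iff] using h1)]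
      simp [pairGraph, g, not_lt.2 g.le]
    · subst g; simp
    · rw [H.adj_comm, show H.Adj y x ↔ _ from h (y, x) (mem_pairsIn.2 ⟨hy, hx, g⟩) (by
        rw [Ne, Prod.ext_iff]; tauto)]
      simp [pairGraph, g, not_lt.2 g.le]

theorem extFamily_eq_filter_not (hT : T ⊆ pairsIn M) (hab : (a, b) ∈ pairsIn M)
    (hab' : (a, b) ∉ T) : extFamily M d T =
      (agreeFamily M d (pairGraph T) a b).filter fun H => ¬ H.Adj a b := by
  ext H
  rw [Finset.mem_filter, mem_agreeFamily_pairGraph hab]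
  simp only [extFamily, Finset.mem_filter, Finset.mem_univ, true_and]
  rw [and_assoc]
  refine and_congr_right fun _ => ⟨?_, fun ⟨h1, h2⟩ => ?_⟩
  · rintro rfl
    refine ⟨fun e he _ => by simp [trace, he], fun h => hab' ?_⟩
    simp [trace, hab, h]
  · ext e
    simp only [trace, Finset.mem_filter]
    refine ⟨fun h => ?_, fun h => ⟨hT h, ?_⟩⟩
    · refine (h1 e h.1 ?_).1 h.2
      rintro rfl
      exact h2 h.2
    · refine (h1 e (hT h) ?_).2 h
      rintro rfl
      exact hab' h

theorem extFamily_insert_eq_filter (hT : T ⊆ pairsIn M) (hab : (a, b) ∈ pairsIn M) :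
    extFamily M d (insert (a, b) T) =
      (agreeFamily M d (pairGraph T) a b).filter fun H => H.Adj a b := by
  ext H
  rw [Finset.mem_filter, mem_agreeFamily_pairGraph hab]
  simp only [extFamily, Finset.mem_filter, Finset.mem_univ, true_and]
  rw [and_assoc]
  refine and_congr_right fun _ => ⟨fun h => ?_, fun ⟨h1, h2⟩ => ?_⟩
  · have h3 : ∀ e, e ∈ trace M H ↔ e = (a, b) ∨ e ∈ T := fun e => by rw [h, Finset.mem_insert]
    simp only [trace, Finset.mem_filter] at h3
    refine ⟨fun e he hne => ?_, ((h3 (a, b)).2 (Or.inl rfl)).2⟩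
    have := h3 e
    tauto
  · ext e
    simp only [trace, Finset.mem_filter, Finset.mem_insert]
    by_cases he : e = (a, b)
    · subst he; simp [hab, h2]
    · refine ⟨fun h => Or.inr ((h1 e h.1 he).1 h.2), fun h => ?_⟩
      have h' := h.resolve_left he
      exact ⟨hT h', (h1 e (hT h') he).2 h'⟩

theorem card_extFamily_add_card (hT : T ⊆ pairsIn M) (hab : (a, b) ∈ pairsIn M)
    (hab' : (a, b) ∉ T) : ((agreeFamily M d (pairGraph T) a b).card : ℝ) =
      (extFamily M d T).card + (extFamily M d (insert (a, b) T)).card := by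
  rw [extFamily_eq_filter_not hT hab hab', extFamily_insert_eq_filter hT hab,
    ← Finset.card_filter_add_card_filter_not (s := agreeFamily M d (pairGraph T) a b)
      (fun H => H.Adj a b)]
  push_cast
  ring

theorem sum_adjInd_agreeFamily (hT : T ⊆ pairsIn M) (hab : (a, b) ∈ pairsIn M) :
    ∑ H ∈ agreeFamily M d (pairGraph T) a b, adjInd H a b =
      (extFamily M d (insert (a, b) T)).card := by
  rw [extFamily_insert_eq_filter hT hab]
  simp only [adjInd, Finset.sum_boole]

theorem extFamily_nonempty_iff {c R : ℝ} (hA : Admissible (restCard M) c R)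
    (hd : ∀ v, |d v - c| + M.card ≤ R) (hT : T ⊆ pairsIn M) (hab : (a, b) ∈ pairsIn M)
    (hab' : (a, b) ∉ T) :
    (extFamily M d T).Nonempty ↔ (extFamily M d (insert (a, b) T)).Nonempty := by
  obtain ⟨ha, hb, hlt⟩ := mem_pairsIn.1 hab
  have key := exists_adj_of_mem_agreeFamily (Y := pairGraph T) hA hd ha hb hlt.ne
  rw [extFamily_eq_filter_not hT hab hab', extFamily_insert_eq_filter hT hab]
  constructor
  · rintro ⟨H, hH⟩
    obtain ⟨⟨H', h1, h2⟩, -⟩ := key ⟨H, (Finset.mem_filter.1 hH).1⟩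
    exact ⟨H', Finset.mem_filter.2 ⟨h1, h2⟩⟩
  · rintro ⟨H, hH⟩
    obtain ⟨-, H', h1, h2⟩ := key ⟨H, (Finset.mem_filter.1 hH).1⟩
    exact ⟨H', Finset.mem_filter.2 ⟨h1, h2⟩⟩

theorem extFamily_nonempty_of_exists {c R : ℝ} (hA : Admissible (restCard M) c R)
    (hd : ∀ v, |d v - c| + M.card ≤ R) (hex : ∃ H : SimpleGraph (Fin n), ∀ v, ∑ w, adjInd H v w = d v)
    (hT : T ⊆ pairsIn M) : (extFamily M d T).Nonempty := by
  have h1 : ∀ T, T ⊆ pairsIn M → ((extFamily M d T).Nonempty ↔ (extFamily M d ∅).Nonempty) := by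
    intro T
    induction T using Finset.induction_on with
    | empty => simp
    | insert e T he ih =>
      intro h
      have h2 := (Finset.subset_insert e T).trans h
      rw [← ih h2]
      exact (extFamily_nonempty_iff hA hd h2 (h (Finset.mem_insert_self e T)) he).symm
  obtain ⟨H, hH⟩ := hex
  rw [h1 T hT, ← h1 (trace M H) (Finset.filter_subset _ _)]
  exact ⟨H, by simp [extFamily, hH]⟩

end PairCount

section PathSum

variable {n : ℕ}

/-- The exponent in the probability that `T` is the edge set induced on `M`, where `δ` are the
degree deviations, `l` is the density and `B` stands for `A n`. -/
def devExponent (M : Finset (Fin n)) (δ : Fin n → ℝ) (l B : ℝ) (T : Finset (Fin n × Fin n)) : ℝ :=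
  (∑ v ∈ M, δ v * (pairDeg T v - l * (M.card - 1))) / (2 * B) -
    (∑ v ∈ M, (pairDeg T v - l * (M.card - 1)) ^ 2) / (4 * B)

theorem pairDeg_insert {T : Finset (Fin n × Fin n)} {a b : Fin n} (h : (a, b) ∉ T) (v : Fin n) :
    pairDeg (insert (a, b) T) v =
      pairDeg T v + ((if a = v then 1 else 0) + (if b = v then 1 else 0)) := by
  rw [pairDeg, Finset.sum_insert h, add_comm, pairDeg]

theorem devExponent_insert {M : Finset (Fin n)} {δ : Fin n → ℝ} {l B : ℝ}
    {T : Finset (Fin n × Fin n)} {a b : Fin n} (h : (a, b) ∉ T) (ha : a ∈ M) (hb : b ∈ M)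
    (hab : a ≠ b) (hB : B ≠ 0) :
    devExponent M δ l B (insert (a, b) T) - devExponent M δ l B T =
      (δ a + δ b - pairDeg T a - pairDeg T b + 2 * l * (M.card - 1) - 1) / (2 * B) := by
  have key : ∀ f : Fin n → ℝ → ℝ, ∑ v ∈ M, f v (pairDeg (insert (a, b) T) v) -
      ∑ v ∈ M, f v (pairDeg T v) = (f a (pairDeg T a + 1) - f a (pairDeg T a)) +
        (f b (pairDeg T b + 1) - f b (pairDeg T b)) := by
    intro f
    rw [← Finset.sum_sub_distrib, ← Finset.sum_subset (s₁ := {a, b}), Finset.sum_pair hab]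
    · simp [pairDeg_insert h, hab, hab.symm]
    · intro v hv
      simp only [Finset.mem_insert, Finset.mem_singleton] at hv
      rcases hv with rfl | rfl <;> assumption
    · intro v _ hv
      simp only [Finset.mem_insert, Finset.mem_singleton, not_or] at hv
      simp [pairDeg_insert h, Ne.symm hv.1, Ne.symm hv.2]
  have k1 := key fun v x => δ v * (x - l * (M.card - 1))
  have k2 := key fun v x => (x - l * (M.card - 1)) ^ 2
  unfold devExponent
  rw [sub_sub_sub_comm, ← sub_div, ← sub_div, k1, k2]
  field_simp
  ring

/-- The change of the number of extensions when a single edge is added. -/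
theorem abs_log_card_extFamily_insert_sub_le {M : Finset (Fin n)} {d : Fin n → ℝ}
    {l A κ c R : ℝ} (hadm : Admissible (restCard M) c R) (hdc : ∀ v, |d v - c| + M.card ≤ R)
    (hex : ∃ H : SimpleGraph (Fin n), ∀ v, ∑ w, adjInd H v w = d v)
    (hl0 : 0 < l) (hl1 : l < 1) (hA : A = l * (1 - l) / 2)
    (hsum : ∑ v, d v = n * (l * (n - 1))) (hmκ : (M.card : ℝ) ^ 2 ≤ κ)
    (hκ : 1000000 * κ ≤ A * n) (hδ : ∀ v ∈ M, M.card * |d v - l * (n - 1)| ≤ κ)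
    {T : Finset (Fin n × Fin n)} {e : Fin n × Fin n} (hT : T ⊆ pairsIn M) (he : e ∈ pairsIn M)
    (heT : e ∉ T) :
    |(Real.log (extFamily M d (insert e T)).card - Real.log (extFamily M d T).card) -
        (Real.log l - Real.log (1 - l)) -
        (devExponent M (fun v => d v - l * (n - 1)) l (A * n) (insert e T) -
          devExponent M (fun v => d v - l * (n - 1)) l (A * n) T)| ≤
      13 * κ / (A * n * M.card ^ 2) := by
  obtain ⟨a, b⟩ := e
  obtain ⟨ha, hb, hlt⟩ := mem_pairsIn.1 he
  have hab : a ≠ b := hlt.ne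
  have hba : (b, a) ∉ T := fun h => lt_asymm hlt (mem_pairsIn.1 (hT h)).2.2
  have hsub : ({a, b} : Finset (Fin n)) ⊆ M := by
    intro x hx
    simp only [Finset.mem_insert, Finset.mem_singleton] at hx
    rcases hx with rfl | rfl <;> assumption
  have hcard : (M \ {a, b}).card + 2 = M.card := by
    rw [← Finset.card_pair hab]; exact Finset.card_sdiff_add_card_eq_card hsub
  have hcard' : ((M \ {a, b}).card : ℝ) = M.card - 2 := by
    rw [← hcard]; push_cast; ring
  have hm : (2 : ℝ) ≤ M.card := by
    have : 2 ≤ M.card := by omega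
    exact_mod_cast this
  obtain ⟨m, hmM⟩ : ∃ m : ℝ, m = M.card := ⟨_, rfl⟩
  rw [← hmM] at hcard' hm hmκ hδ ⊢
  have hm0 : 0 < m := by linarith
  have hins : insert (a, b) T ⊆ pairsIn M := Finset.insert_subset he hT
  have hF₀ : (0 : ℝ) < (extFamily M d T).card := by
    exact_mod_cast (extFamily_nonempty_of_exists hadm hdc hex hT).card_pos
  have hF₁ : (0 : ℝ) < (extFamily M d (insert (a, b) T)).card := by
    exact_mod_cast (extFamily_nonempty_of_exists hadm hdc hex hins).card_pos
  have hdeg : ∀ v, v = a ∨ v = b → pairDeg T v = ∑ w ∈ M \ {a, b}, adjInd (pairGraph T) v w :=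
    fun v hv => (sum_sdiff_adjInd_pairGraph hT heT hba hv).symm
  have hdeg0 : ∀ v, v = a ∨ v = b → 0 ≤ pairDeg T v := fun v hv => by
    rw [hdeg v hv]; exact Finset.sum_nonneg fun w _ => adjInd_nonneg _ _ _
  have hle : ∀ v, ∑ w ∈ M \ {a, b}, adjInd (pairGraph T) v w ≤ m := fun v =>
    calc _ ≤ ∑ w ∈ M \ {a, b}, (1 : ℝ) := Finset.sum_le_sum fun w _ => adjInd_le_one _ _ _
      _ ≤ m := by rw [Finset.sum_const, nsmul_eq_mul, hcard']; linarith
  have hdegm : ∀ v, v = a ∨ v = b → pairDeg T v ≤ m := fun v hv => by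
    rw [hdeg v hv]; exact hle v
  have hS : |∑ v ∈ M \ {a, b}, (d v - l * (n - 1))| ≤ κ := by
    refine (Finset.abs_sum_le_sum_abs _ _).trans ?_
    calc _ ≤ ∑ v ∈ M \ {a, b}, κ / m := Finset.sum_le_sum fun v hv => by
          rw [le_div_iff₀ hm0, mul_comm]
          exact hδ v (Finset.mem_sdiff.1 hv).1
      _ = (m - 2) * (κ / m) := by rw [Finset.sum_const, nsmul_eq_mul, hcard']
      _ ≤ m * (κ / m) := by
        have : 0 ≤ κ := by nlinarith
        gcongr; linarith
      _ = κ := by field_simp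
  have hE0 : 0 ≤ ∑ v ∈ M \ {a, b}, ∑ w ∈ M \ {a, b}, adjInd (pairGraph T) v w :=
    Finset.sum_nonneg fun v _ => Finset.sum_nonneg fun w _ => adjInd_nonneg _ _ _
  have hEm : ∑ v ∈ M \ {a, b}, ∑ w ∈ M \ {a, b}, adjInd (pairGraph T) v w ≤ m ^ 2 :=
    calc _ ≤ ∑ v ∈ M \ {a, b}, m := Finset.sum_le_sum fun v _ => hle v
      _ = (m - 2) * m := by rw [Finset.sum_const, nsmul_eq_mul, hcard']
      _ ≤ m ^ 2 := by nlinarith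
  have hA0 : 0 < A := by rw [hA]; nlinarith
  have hB : 0 < A * n := by nlinarith
  have hn0 : (0 : ℝ) < n := by
    by_contra h
    nlinarith [mul_nonneg hA0.le (by linarith : 0 ≤ -(n : ℝ))]
  have hN : restCard M = n - m + 2 := by rw [restCard, Fintype.card_fin, hmM]
  have hN0 : restCard M ≠ 0 := by
    obtain ⟨L, hL, hN, -⟩ := hadm
    rw [hN]; positivity
  have hD : restCard M * restMean M d (pairGraph T) a b = n * (l * (n - 1)) -
      2 * ((m - 2) * (l * (n - 1)) + ∑ v ∈ M \ {a, b}, (d v - l * (n - 1))) +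
      ∑ v ∈ M \ {a, b}, ∑ w ∈ M \ {a, b}, adjInd (pairGraph T) v w := by
    rw [restMean, mul_div_cancel₀ _ hN0, hsum, Finset.sum_sub_distrib, Finset.sum_const,
      nsmul_eq_mul, hcard']
    ring
  have hrest : ∀ v, v = a ∨ v = b → restDeg M d (pairGraph T) a b v =
      l * (n - 1) + (d v - l * (n - 1)) - pairDeg T v := fun v hv => by
    rw [restDeg, hdeg v hv]; ring
  have hF := abs_sum_adjInd_agreeFamily_sub_le (Y := pairGraph T) hadm hdc ha hb hab
  rw [sum_adjInd_agreeFamily hT he, card_extFamily_add_card hT he heT, hrest a (Or.inl rfl),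
    hrest b (Or.inr rfl)] at hF
  have main := abs_log_sub_log_sub_le hl0 hl1 hA hm hmκ hκ hS hE0 hEm hN hD (hδ a ha) (hδ b hb)
    (hdeg0 a (Or.inl rfl)) (hdegm a (Or.inl rfl)) (hdeg0 b (Or.inr rfl)) (hdegm b (Or.inr rfl))
    hF₀ hF₁ hF
  rw [devExponent_insert heT ha hb hab hB.ne', ← hmM]
  have hdiff : |(2 * l + 1) / (2 * (A * n))| ≤ 2 * κ / (A * n * m ^ 2) := by
    rw [abs_of_nonneg (by positivity), div_le_div_iff₀ (by positivity) (by positivity)]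
    have h1 : (2 * l + 1) * m ^ 2 ≤ 3 * κ := by
      refine mul_le_mul (by linarith) hmκ (by positivity) (by norm_num)
    nlinarith [mul_le_mul_of_nonneg_right h1 hB.le]
  have e1 : (d a - l * (n - 1) + (d b - l * (n - 1)) - pairDeg T a - pairDeg T b +
      2 * l * (m - 1) - 1) / (2 * (A * n)) = (d a - l * (n - 1) + (d b - l * (n - 1)) -
        pairDeg T a - pairDeg T b + 2 * l * m) / (2 * (A * n)) -
          (2 * l + 1) / (2 * (A * n)) := by
    rw [← sub_div]; congr 1; ring
  have tot : 13 * κ / (A * n * m ^ 2) = 11 * κ / (A * n * m ^ 2) + 2 * κ / (A * n * m ^ 2) := by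
    ring
  rw [e1, tot]
  rw [abs_le] at main hdiff ⊢
  constructor <;> linarith

theorem card_pairsIn_le (M : Finset (Fin n)) : ((pairsIn M).card : ℝ) ≤ M.card ^ 2 := by
  have := Finset.card_filter_le (M ×ˢ M) fun e : Fin n × Fin n => e.1 < e.2
  rw [Finset.card_product] at this
  rw [pow_two]
  exact_mod_cast this

/-- The number of extensions of `T`, up to a factor which is the same for all `T`. -/
theorem abs_log_card_extFamily_sub_le {M : Finset (Fin n)} {d : Fin n → ℝ}
    {l A κ c R : ℝ} (hadm : Admissible (restCard M) c R) (hdc : ∀ v, |d v - c| + M.card ≤ R)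
    (hex : ∃ H : SimpleGraph (Fin n), ∀ v, ∑ w, adjInd H v w = d v)
    (hl0 : 0 < l) (hl1 : l < 1) (hA : A = l * (1 - l) / 2)
    (hsum : ∑ v, d v = n * (l * (n - 1))) (hmκ : (M.card : ℝ) ^ 2 ≤ κ)
    (hκ : 1000000 * κ ≤ A * n) (hδ : ∀ v ∈ M, M.card * |d v - l * (n - 1)| ≤ κ)
    {T : Finset (Fin n × Fin n)} (hT : T ⊆ pairsIn M) (hM : M.Nonempty) :
    |(Real.log (extFamily M d T).card - Real.log (extFamily M d ∅).card) -
        T.card * (Real.log l - Real.log (1 - l)) -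
        (devExponent M (fun v => d v - l * (n - 1)) l (A * n) T -
          devExponent M (fun v => d v - l * (n - 1)) l (A * n) ∅)| ≤ 13 * κ / (A * n) := by
  have h1 : ∀ T ⊆ pairsIn M, |(Real.log (extFamily M d T).card - Real.log (extFamily M d ∅).card) -
        T.card * (Real.log l - Real.log (1 - l)) -
        (devExponent M (fun v => d v - l * (n - 1)) l (A * n) T -
          devExponent M (fun v => d v - l * (n - 1)) l (A * n) ∅)| ≤
        T.card * (13 * κ / (A * n * M.card ^ 2)) := by
    intro T
    induction T using Finset.induction_on with
    | empty => simp
    | insert e T he ih =>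
      intro h
      have h2 := (Finset.subset_insert e T).trans h
      have h3 := abs_le.1 (ih h2)
      have h4 := abs_le.1 (abs_log_card_extFamily_insert_sub_le hadm hdc hex hl0 hl1 hA hsum hmκ hκ
        hδ h2 (h (Finset.mem_insert_self e T)) he)
      rw [Finset.card_insert_of_notMem he]
      push_cast
      rw [abs_le]
      constructor <;> linarith
  have hm0 : (0 : ℝ) < M.card := by exact_mod_cast hM.card_pos
  have hκ0 : 0 < κ := lt_of_lt_of_le (by positivity) hmκ
  have hB : 0 < A * n := by linarith
  refine (h1 T hT).trans ?_
  have h2 : (T.card : ℝ) ≤ M.card ^ 2 :=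
    (by exact_mod_cast Finset.card_le_card hT : (T.card : ℝ) ≤ (pairsIn M).card).trans
      (card_pairsIn_le M)
  calc _ ≤ (M.card : ℝ) ^ 2 * (13 * κ / (A * n * M.card ^ 2)) := by gcongr
    _ = 13 * κ / (A * n) := by field_simp

end PathSum

section BernoulliMean

variable {ι : Type*}

/-- The mean of `F T` when every element of `P` is put in `T` independently with
probability `l`. -/
def bernoulliMean (P : Finset ι) (l : ℝ) (F : Finset ι → ℝ) : ℝ :=
  ∑ T ∈ P.powerset, l ^ T.card * (1 - l) ^ (P.card - T.card) * F T

/-- A linear combination of the centred indicators of the elements of `P`. -/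
def centredSum (P : Finset ι) (l : ℝ) (c : ι → ℝ) (T : Finset ι) : ℝ :=
  ∑ e ∈ P, c e * ((if e ∈ T then 1 else 0) - l)

variable {P : Finset ι} {l : ℝ} {c : ι → ℝ}

theorem bernoulliMean_empty (F : Finset ι → ℝ) : bernoulliMean ∅ l F = F ∅ := by
  simp [bernoulliMean]

theorem bernoulliMean_congr {F F' : Finset ι → ℝ} (h : ∀ T ⊆ P, F T = F' T) :
    bernoulliMean P l F = bernoulliMean P l F' :=
  Finset.sum_congr rfl fun T hT => by rw [h T (Finset.mem_powerset.1 hT)]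

theorem bernoulliMean_mono (hl0 : 0 ≤ l) (hl1 : l ≤ 1) {F F' : Finset ι → ℝ}
    (h : ∀ T ⊆ P, F T ≤ F' T) : bernoulliMean P l F ≤ bernoulliMean P l F' :=
  Finset.sum_le_sum fun T hT => mul_le_mul_of_nonneg_left (h T (Finset.mem_powerset.1 hT))
    (mul_nonneg (pow_nonneg hl0 _) (pow_nonneg (sub_nonneg.2 hl1) _))

theorem bernoulliMean_add (F F' : Finset ι → ℝ) :
    bernoulliMean P l (fun T => F T + F' T) = bernoulliMean P l F + bernoulliMean P l F' := by
  simp only [bernoulliMean, mul_add, Finset.sum_add_distrib]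

theorem bernoulliMean_const_mul (a : ℝ) (F : Finset ι → ℝ) :
    bernoulliMean P l (fun T => a * F T) = a * bernoulliMean P l F := by
  rw [bernoulliMean, bernoulliMean, Finset.mul_sum]
  exact Finset.sum_congr rfl fun T _ => by ring

theorem bernoulliMean_sum {κ : Type*} (s : Finset κ) (F : κ → Finset ι → ℝ) :
    bernoulliMean P l (fun T => ∑ i ∈ s, F i T) = ∑ i ∈ s, bernoulliMean P l (F i) := by
  simp only [bernoulliMean, Finset.mul_sum]
  exact Finset.sum_comm

variable [DecidableEq ι]

theorem bernoulliMean_insert {e : ι} (he : e ∉ P) (F : Finset ι → ℝ) :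
    bernoulliMean (insert e P) l F =
      (1 - l) * bernoulliMean P l F + l * bernoulliMean P l fun T => F (insert e T) := by
  unfold bernoulliMean
  rw [Finset.sum_powerset_insert he, Finset.mul_sum, Finset.mul_sum,
    Finset.card_insert_of_notMem he]
  congr 1
  · refine Finset.sum_congr rfl fun T hT => ?_
    rw [Nat.succ_sub (Finset.card_le_card (Finset.mem_powerset.1 hT)), pow_succ]
    ring
  · refine Finset.sum_congr rfl fun T hT => ?_
    rw [Finset.card_insert_of_notMem fun h => he (Finset.mem_powerset.1 hT h),
      Nat.add_sub_add_right, pow_succ]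
    ring

theorem bernoulliMean_const (a : ℝ) : bernoulliMean P l (fun _ => a) = a := by
  induction P using Finset.induction_on with
  | empty => rw [bernoulliMean_empty]
  | insert e P he ih => rw [bernoulliMean_insert he, ih]; ring

theorem centredSum_insert_left {e : ι} (he : e ∉ P) {T : Finset ι} (hT : T ⊆ P) :
    centredSum (insert e P) l c T = centredSum P l c T - c e * l := by
  rw [centredSum, Finset.sum_insert he, if_neg fun h => he (hT h), centredSum]
  ring

theorem centredSum_insert_insert {e : ι} (he : e ∉ P) (T : Finset ι) :
    centredSum (insert e P) l c (insert e T) = centredSum P l c T + c e * (1 - l) := by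
  rw [centredSum, Finset.sum_insert he, if_pos (Finset.mem_insert_self e T), centredSum, add_comm]
  congr 1
  refine Finset.sum_congr rfl fun x hx => ?_
  have : x ≠ e := fun h => he (h ▸ hx)
  simp [Finset.mem_insert, this]

theorem bernoulliMean_comp_centredSum_insert {e : ι} (he : e ∉ P) (f : ℝ → ℝ) :
    bernoulliMean (insert e P) l (fun T => f (centredSum (insert e P) l c T)) =
      (1 - l) * bernoulliMean P l (fun T => f (centredSum P l c T - c e * l)) +
        l * bernoulliMean P l (fun T => f (centredSum P l c T + c e * (1 - l))) := by
  rw [bernoulliMean_insert he]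
  simp only [centredSum_insert_insert he]
  rw [bernoulliMean_congr fun T hT => by rw [centredSum_insert_left he hT]]

theorem bernoulliMean_centredSum : bernoulliMean P l (centredSum P l c) = 0 := by
  induction P using Finset.induction_on with
  | empty => simp [bernoulliMean_empty, centredSum]
  | insert e P he ih =>
    have := bernoulliMean_comp_centredSum_insert (l := l) (c := c) he fun x => x
    simp only [sub_eq_add_neg, bernoulliMean_add, bernoulliMean_const] at this
    rw [this, ih]
    ring

theorem bernoulliMean_centredSum_sq :
    bernoulliMean P l (fun T => centredSum P l c T ^ 2) = l * (1 - l) * ∑ e ∈ P, c e ^ 2 := by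
  induction P using Finset.induction_on with
  | empty => simp [bernoulliMean_empty, centredSum]
  | insert e P he ih =>
    have h1 : ∀ a : ℝ, bernoulliMean P l (fun T => (centredSum P l c T + a) ^ 2) =
        l * (1 - l) * ∑ e ∈ P, c e ^ 2 + a ^ 2 := by
      intro a
      have h2 : ∀ T, (centredSum P l c T + a) ^ 2 =
          centredSum P l c T ^ 2 + 2 * a * centredSum P l c T + a ^ 2 := fun T => by ring
      simp only [h2, bernoulliMean_add, bernoulliMean_const_mul, bernoulliMean_const]
      rw [bernoulliMean_centredSum, ih]
      ring
    have := bernoulliMean_comp_centredSum_insert (l := l) (c := c) he fun x => x ^ 2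
    simp only [sub_eq_add_neg _ (c e * l), h1] at this
    rw [this, Finset.sum_insert he]
    ring

theorem exp_le_one_add_add_sq {x : ℝ} (hx : |x| ≤ 1) : Real.exp x ≤ 1 + x + x ^ 2 := by
  have := (abs_le.1 (Real.abs_exp_sub_one_sub_id_le hx)).2
  linarith

theorem bernoulli_mgf_le (hl0 : 0 ≤ l) (hl1 : l ≤ 1) {t : ℝ} (ht : |t| ≤ 1) :
    (1 - l) * Real.exp (-(t * l)) + l * Real.exp (t * (1 - l)) ≤
      Real.exp (l * (1 - l) * t ^ 2) := by
  have h1 : Real.exp (-(t * l)) ≤ 1 + -(t * l) + (-(t * l)) ^ 2 := exp_le_one_add_add_sq <| by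
    rw [abs_neg, abs_mul, abs_of_nonneg hl0]
    exact mul_le_one₀ ht hl0 hl1
  have h2 : Real.exp (t * (1 - l)) ≤ 1 + t * (1 - l) + (t * (1 - l)) ^ 2 :=
    exp_le_one_add_add_sq <| by
      rw [abs_mul, abs_of_nonneg (sub_nonneg.2 hl1)]
      exact mul_le_one₀ ht (sub_nonneg.2 hl1) (by linarith)
  have h3 := mul_le_mul_of_nonneg_left h1 (sub_nonneg.2 hl1)
  have h4 := mul_le_mul_of_nonneg_left h2 hl0
  refine le_trans ?_ (Real.add_one_le_exp _)
  nlinarith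

theorem bernoulliMean_exp_centredSum_le (hl0 : 0 ≤ l) (hl1 : l ≤ 1) (hc : ∀ e ∈ P, |c e| ≤ 1) :
    bernoulliMean P l (fun T => Real.exp (centredSum P l c T)) ≤
      Real.exp (l * (1 - l) * ∑ e ∈ P, c e ^ 2) := by
  induction P using Finset.induction_on with
  | empty => simp [bernoulliMean_empty, centredSum]
  | insert e P he ih =>
    rw [bernoulliMean_comp_centredSum_insert he]
    simp only [sub_eq_add_neg _ (c e * l), Real.exp_add, mul_comm (Real.exp (centredSum _ _ _ _)),
      bernoulliMean_const_mul]
    rw [← mul_assoc, ← mul_assoc, ← add_mul, Finset.sum_insert he, mul_add, Real.exp_add]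
    refine mul_le_mul (bernoulli_mgf_le hl0 hl1 (hc e (Finset.mem_insert_self e P)))
      (ih fun x hx => hc x (Finset.mem_insert_of_mem hx)) ?_ (Real.exp_pos _).le
    refine (bernoulliMean_const (P := P) (l := l) 0).symm.le.trans
      (bernoulliMean_mono hl0 hl1 fun T _ => (Real.exp_pos _).le)

end BernoulliMean

section Normalization

variable {n : ℕ}

/-- The number of pairs in `M` that contain a given element of `M`. -/
theorem pairDeg_pairsIn {M : Finset (Fin n)} {v : Fin n} (hv : v ∈ M) :
    pairDeg (pairsIn M) v = M.card - 1 := by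
  rw [← sum_adjInd_pairGraph subset_rfl]
  have h1 : ∀ w, adjInd (pairGraph (pairsIn M)) v w = if w ∈ M.erase v then 1 else 0 := by
    intro w
    simp only [adjInd, pairGraph, mem_pairsIn, Finset.mem_erase]
    congr 1
    rw [eq_iff_iff]
    have := @lt_or_lt_iff_ne _ _ v w
    tauto
  simp only [h1, Finset.sum_boole, Finset.filter_univ_mem]
  rw [Finset.card_erase_of_mem hv, Nat.cast_sub (Finset.card_pos.2 ⟨v, hv⟩), Nat.cast_one]

theorem pairDeg_sub_eq_centredSum {M : Finset (Fin n)} {v : Fin n} (hv : v ∈ M) (l : ℝ)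
    {T : Finset (Fin n × Fin n)} (hT : T ⊆ pairsIn M) :
    pairDeg T v - l * (M.card - 1) = centredSum (pairsIn M) l
      (fun e => (if e.1 = v then 1 else 0) + (if e.2 = v then 1 else 0)) T := by
  rw [← pairDeg_pairsIn hv, pairDeg, pairDeg, centredSum, Finset.mul_sum,
    ← Finset.inter_eq_right.2 hT, ← Finset.filter_mem_eq_inter, Finset.sum_filter,
    ← Finset.sum_sub_distrib]
  refine Finset.sum_congr rfl fun e he => ?_
  simp only [Finset.mem_filter, he, true_and]
  split_ifs <;> ring

theorem sum_mul_pairDeg_sub {M : Finset (Fin n)} (δ : Fin n → ℝ) (l : ℝ)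
    {T : Finset (Fin n × Fin n)} (hT : T ⊆ pairsIn M) :
    ∑ v ∈ M, δ v * (pairDeg T v - l * (M.card - 1)) =
      centredSum (pairsIn M) l (fun e => δ e.1 + δ e.2) T := by
  rw [Finset.sum_congr rfl fun v hv => by rw [pairDeg_sub_eq_centredSum hv l hT]]
  simp only [centredSum, Finset.mul_sum]
  rw [Finset.sum_comm]
  refine Finset.sum_congr rfl fun e he => ?_
  obtain ⟨h1, h2, -⟩ := mem_pairsIn.1 he
  simp only [← mul_assoc, ← Finset.sum_mul, mul_add, mul_ite, mul_one, mul_zero,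
    Finset.sum_add_distrib, Finset.sum_ite_eq, h1, h2, if_true]

theorem bernoulliMean_devExponent {M : Finset (Fin n)} (δ : Fin n → ℝ) (l B : ℝ) :
    bernoulliMean (pairsIn M) l (devExponent M δ l B) =
      -(l * (1 - l) * (2 * (pairsIn M).card) / (4 * B)) := by
  have h1 : ∀ T ⊆ pairsIn M, devExponent M δ l B T =
      (2 * B)⁻¹ * centredSum (pairsIn M) l (fun e => δ e.1 + δ e.2) T +
        (-(4 * B)⁻¹) * ∑ v ∈ M, centredSum (pairsIn M) l
          (fun e => (if e.1 = v then 1 else 0) + (if e.2 = v then 1 else 0)) T ^ 2 := by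
    intro T hT
    rw [devExponent, sum_mul_pairDeg_sub δ l hT,
      Finset.sum_congr rfl fun v hv => by rw [pairDeg_sub_eq_centredSum hv l hT]]
    ring
  rw [bernoulliMean_congr h1, bernoulliMean_add, bernoulliMean_const_mul,
    bernoulliMean_const_mul, bernoulliMean_centredSum, bernoulliMean_sum]
  simp only [bernoulliMean_centredSum_sq]
  rw [← Finset.mul_sum, Finset.sum_comm]
  have h2 : ∀ e ∈ pairsIn M, ∑ v ∈ M,
      ((if e.1 = v then (1 : ℝ) else 0) + (if e.2 = v then 1 else 0)) ^ 2 = 2 := by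
    intro e he
    obtain ⟨h1, h2, h3⟩ := mem_pairsIn.1 he
    have h4 : ∀ v, ((if e.1 = v then (1 : ℝ) else 0) + (if e.2 = v then 1 else 0)) ^ 2 =
        (if e.1 = v then (1 : ℝ) else 0) + (if e.2 = v then 1 else 0) := by
      intro v
      by_cases g1 : e.1 = v
      · have g2 : e.2 ≠ v := fun g => h3.ne (g1.trans g.symm)
        simp [g1, g2]
      · by_cases g2 : e.2 = v <;> simp [g1, g2]
    simp only [h4, Finset.sum_add_distrib, Finset.sum_ite_eq, h1, h2, if_true]
    norm_num
  rw [Finset.sum_congr rfl h2, Finset.sum_const, nsmul_eq_mul]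
  ring

variable {M : Finset (Fin n)} {δ : Fin n → ℝ} {l A κ B : ℝ}

/-- The exponential corrections have mean close to `1`. -/
theorem abs_log_bernoulliMean_exp_devExponent_le (hl0 : 0 < l) (hl1 : l < 1)
    (hA : A = l * (1 - l) / 2) (hM : M.Nonempty) (hmκ : (M.card : ℝ) ^ 2 ≤ κ)
    (hκ : 2 * κ ≤ B) (hδ : ∀ v ∈ M, M.card * |δ v| ≤ κ) :
    0 < bernoulliMean (pairsIn M) l (fun T => Real.exp (devExponent M δ l B T)) ∧
    |Real.log (bernoulliMean (pairsIn M) l fun T => Real.exp (devExponent M δ l B T))| ≤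
      2 * κ / B := by
  have hm0 : (0 : ℝ) < M.card := by exact_mod_cast hM.card_pos
  have hκ0 : 0 < κ := lt_of_lt_of_le (by positivity) hmκ
  have hB : 0 < B := by linarith
  have hA8 : A ≤ 1 / 8 := by rw [hA]; nlinarith [sq_nonneg (2 * l - 1)]
  have hA0 : 0 ≤ A := by rw [hA]; nlinarith
  have hll : l * (1 - l) = 2 * A := by rw [hA]; ring
  have hP := card_pairsIn_le M
  obtain ⟨m, hm⟩ : ∃ m : ℝ, m = M.card := ⟨_, rfl⟩
  obtain ⟨p, hp⟩ : ∃ p : ℝ, p = (pairsIn M).card := ⟨_, rfl⟩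
  have hp0 : 0 ≤ p := by rw [hp]; exact Nat.cast_nonneg _
  have hm1 : 1 ≤ m := by rw [hm]; exact_mod_cast hM.card_pos
  rw [← hm] at hm0 hmκ hP
  rw [← hp] at hP
  simp only [← hm] at hδ
  obtain ⟨x, hx⟩ : ∃ x, x = κ / B := ⟨_, rfl⟩
  have hx0 : 0 < x := by rw [hx]; positivity
  have hx1 : x ≤ 1 / 2 := by rw [hx, div_le_iff₀ hB]; linarith
  have hlow : 1 - x ≤ bernoulliMean (pairsIn M) l (fun T => Real.exp (devExponent M δ l B T)) := by
    calc 1 - x ≤ bernoulliMean (pairsIn M) l (fun T => devExponent M δ l B T + 1) := by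
          rw [bernoulliMean_add, bernoulliMean_const, bernoulliMean_devExponent, hll, ← hp]
          have : 2 * A * (2 * p) / (4 * B) ≤ x := by
            rw [hx, div_le_div_iff₀ (by positivity) hB]
            have : A * p ≤ 1 * κ :=
              mul_le_mul (by linarith) (hP.trans hmκ) hp0 (by norm_num)
            nlinarith [mul_le_mul_of_nonneg_right this hB.le]
          linarith
      _ ≤ _ := bernoulliMean_mono hl0.le hl1.le fun T _ => Real.add_one_le_exp _
  have hup : bernoulliMean (pairsIn M) l (fun T => Real.exp (devExponent M δ l B T)) ≤
      Real.exp x := by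
    have ht : ∀ e ∈ pairsIn M, |(δ e.1 + δ e.2) / (2 * B)| ≤ x / m := by
      intro e he
      obtain ⟨h1, h2, -⟩ := mem_pairsIn.1 he
      rw [abs_div, abs_of_pos (by positivity : 0 < 2 * B), hx, div_div,
        div_le_div_iff₀ (by positivity) (by positivity)]
      have h3 := abs_add_le (δ e.1) (δ e.2)
      have h4 : m * |δ e.1 + δ e.2| ≤ 2 * κ := by
        nlinarith [hδ _ h1, hδ _ h2, mul_le_mul_of_nonneg_left h3 hm0.le]
      nlinarith [mul_le_mul_of_nonneg_right h4 hB.le]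
    calc _ ≤ bernoulliMean (pairsIn M) l (fun T => Real.exp (centredSum (pairsIn M) l
            (fun e => (δ e.1 + δ e.2) / (2 * B)) T)) := by
          refine bernoulliMean_mono hl0.le hl1.le fun T hT => Real.exp_le_exp.2 ?_
          rw [devExponent, sum_mul_pairDeg_sub δ l hT]
          have h5 : 0 ≤ (∑ v ∈ M, (pairDeg T v - l * (M.card - 1)) ^ 2) / (4 * B) :=
            div_nonneg (Finset.sum_nonneg fun v _ => sq_nonneg _) (by positivity)
          have h6 : centredSum (pairsIn M) l (fun e => δ e.1 + δ e.2) T / (2 * B) =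
              centredSum (pairsIn M) l (fun e => (δ e.1 + δ e.2) / (2 * B)) T := by
            rw [centredSum, centredSum, Finset.sum_div]
            exact Finset.sum_congr rfl fun e _ => by ring
          linarith
      _ ≤ Real.exp (l * (1 - l) * ∑ e ∈ pairsIn M, ((δ e.1 + δ e.2) / (2 * B)) ^ 2) := by
          refine bernoulliMean_exp_centredSum_le hl0.le hl1.le fun e he => (ht e he).trans ?_
          rw [div_le_one hm0]; linarith
      _ ≤ Real.exp x := by
          refine Real.exp_le_exp.2 ?_
          have h7 : ∑ e ∈ pairsIn M, ((δ e.1 + δ e.2) / (2 * B)) ^ 2 ≤ x ^ 2 := by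
            calc _ ≤ ∑ e ∈ pairsIn M, (x / m) ^ 2 := Finset.sum_le_sum fun e he => by
                  rw [← sq_abs]
                  exact pow_le_pow_left₀ (abs_nonneg _) (ht e he) 2
              _ = p * (x / m) ^ 2 := by
                  rw [Finset.sum_const, nsmul_eq_mul, hp]
              _ ≤ m ^ 2 * (x / m) ^ 2 := by gcongr
              _ = x ^ 2 := by field_simp
          rw [hll]
          calc _ ≤ 2 * A * x ^ 2 := by gcongr
            _ ≤ x := by nlinarith
  have hpos : 0 < bernoulliMean (pairsIn M) l (fun T => Real.exp (devExponent M δ l B T)) := by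
    linarith
  refine ⟨hpos, ?_⟩
  have e1 : 2 * κ / B = 2 * x := by rw [hx]; ring
  rw [e1, abs_le]
  constructor
  · refine (Real.le_log_iff_exp_le hpos).2 (le_trans ?_ hlow)
    have h8 := Real.add_one_le_exp (2 * x)
    rw [Real.exp_neg, inv_le_comm₀ (Real.exp_pos _) (by linarith), inv_le_iff_one_le_mul₀ (by linarith)]
    nlinarith [mul_le_mul_of_nonneg_right h8 (by linarith : 0 ≤ 1 - x)]
  · refine ((Real.log_le_iff_le_exp hpos).2 hup).trans (by linarith)

end Normalization

section Normalization

variable {n : ℕ}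

/-- The proportion of graphs with degrees `d` that induce `T` on `M`. -/
theorem abs_log_card_extFamily_sub_log_sum_le {M : Finset (Fin n)} {d : Fin n → ℝ}
    {l A κ c R : ℝ} (hadm : Admissible (restCard M) c R) (hdc : ∀ v, |d v - c| + M.card ≤ R)
    (hex : ∃ H : SimpleGraph (Fin n), ∀ v, ∑ w, adjInd H v w = d v)
    (hl0 : 0 < l) (hl1 : l < 1) (hA : A = l * (1 - l) / 2)
    (hsum : ∑ v, d v = n * (l * (n - 1))) (hmκ : (M.card : ℝ) ^ 2 ≤ κ)
    (hκ : 1000000 * κ ≤ A * n) (hδ : ∀ v ∈ M, M.card * |d v - l * (n - 1)| ≤ κ)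
    {T : Finset (Fin n × Fin n)} (hT : T ⊆ pairsIn M) (hM : M.Nonempty) :
    |Real.log (extFamily M d T).card -
        Real.log (∑ S ∈ (pairsIn M).powerset, ((extFamily M d S).card : ℝ)) -
        (T.card * Real.log l + ((pairsIn M).card - T.card) * Real.log (1 - l)) -
        devExponent M (fun v => d v - l * (n - 1)) l (A * n) T| ≤ 28 * κ / (A * n) := by
  have hm0 : (0 : ℝ) < M.card := by exact_mod_cast hM.card_pos
  have hκ0 : 0 < κ := lt_of_lt_of_le (by positivity) hmκ
  have hmain : ∀ S ⊆ pairsIn M, _ := fun S hS =>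
    abs_log_card_extFamily_sub_le hadm hdc hex hl0 hl1 hA hsum hmκ hκ hδ hS hM
  obtain ⟨hpos, hbm⟩ := abs_log_bernoulliMean_exp_devExponent_le (B := A * n) hl0 hl1 hA hM hmκ
    (by linarith) hδ
  obtain ⟨G, hG⟩ : ∃ G, G = devExponent M (fun v => d v - l * (n - 1)) l (A * n) := ⟨_, rfl⟩
  obtain ⟨f, hf⟩ : ∃ f : Finset (Fin n × Fin n) → ℝ, f = fun S => ((extFamily M d S).card : ℝ) :=
    ⟨_, rfl⟩
  have hf0 : ∀ S ⊆ pairsIn M, 0 < f S := fun S hS => by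
    rw [hf]
    exact Nat.cast_pos.2 (extFamily_nonempty_of_exists hadm hdc hex hS).card_pos
  have e28 : 28 * κ / (A * n) = 28 * (κ / (A * n)) := by ring
  have e13 : 13 * κ / (A * n) = 13 * (κ / (A * n)) := by ring
  have e2 : 2 * κ / (A * n) = 2 * (κ / (A * n)) := by ring
  rw [e13] at hmain
  rw [e2, ← hG] at hbm
  rw [← hG] at hpos hmain
  rw [e28, ← hG]
  have hff : ∀ S, ((extFamily M d S).card : ℝ) = f S := fun S => by rw [hf]
  simp only [hff] at hmain ⊢
  generalize κ / (A * n) = x at *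
  obtain ⟨c₀, hc₀⟩ : ∃ c₀, c₀ = Real.log (f ∅) - G ∅ - (pairsIn M).card * Real.log (1 - l) :=
    ⟨_, rfl⟩
  have hw : ∀ S ⊆ pairsIn M, l ^ S.card * (1 - l) ^ ((pairsIn M).card - S.card) =
      Real.exp (S.card * Real.log l + ((pairsIn M).card - S.card) * Real.log (1 - l)) := by
    intro S hS
    rw [← Nat.cast_sub (Finset.card_le_card hS), Real.exp_add, Real.exp_nat_mul, Real.exp_nat_mul,
      Real.exp_log hl0, Real.exp_log (by linarith)]
  have hfS : ∀ S ⊆ pairsIn M, |Real.log (f S) - c₀ -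
      (S.card * Real.log l + ((pairsIn M).card - S.card) * Real.log (1 - l)) - G S| ≤ 13 * x := by
    intro S hS
    convert hmain S hS using 2
    rw [hc₀]
    ring
  have hexp : ∀ a, ∑ S ∈ (pairsIn M).powerset, Real.exp (a + (S.card * Real.log l +
      ((pairsIn M).card - S.card) * Real.log (1 - l)) + G S) =
        Real.exp (a + Real.log (bernoulliMean (pairsIn M) l fun S => Real.exp (G S))) := by
    intro a
    rw [Real.exp_add a, Real.exp_log hpos, bernoulliMean, Finset.mul_sum]
    refine Finset.sum_congr rfl fun S hS => ?_
    rw [hw S (Finset.mem_powerset.1 hS), Real.exp_add, Real.exp_add, mul_assoc]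
  have hsumpos : 0 < ∑ S ∈ (pairsIn M).powerset, f S :=
    Finset.sum_pos (fun S hS => hf0 S (Finset.mem_powerset.1 hS)) ⟨∅, by simp⟩
  have hup : Real.log (∑ S ∈ (pairsIn M).powerset, f S) ≤ c₀ + 13 * x +
      Real.log (bernoulliMean (pairsIn M) l fun S => Real.exp (G S)) := by
    rw [Real.log_le_iff_le_exp hsumpos, ← hexp]
    refine Finset.sum_le_sum fun S hS => ?_
    have hS' := Finset.mem_powerset.1 hS
    rw [← Real.log_le_iff_le_exp (hf0 S hS')]
    have := (abs_le.1 (hfS S hS')).2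
    linarith
  have hlow : c₀ - 13 * x + Real.log (bernoulliMean (pairsIn M) l fun S => Real.exp (G S)) ≤
      Real.log (∑ S ∈ (pairsIn M).powerset, f S) := by
    rw [Real.le_log_iff_exp_le hsumpos, ← hexp]
    refine Finset.sum_le_sum fun S hS => ?_
    have hS' := Finset.mem_powerset.1 hS
    rw [← Real.le_log_iff_exp_le (hf0 S hS')]
    have := (abs_le.1 (hfS S hS')).1
    linarith
  have h1 := abs_le.1 (hfS T hT)
  have h2 := abs_le.1 hbm
  rw [abs_le]
  constructor <;> linarith

end Normalization

section Bridge

variable {n : ℕ}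

theorem sum_pairDeg (T : Finset (Fin n × Fin n)) : ∑ v, pairDeg T v = 2 * T.card := by
  simp only [pairDeg]
  rw [Finset.sum_comm]
  simp only [Finset.sum_add_distrib, Finset.sum_ite_eq, Finset.mem_univ, if_true,
    Finset.sum_const, nsmul_eq_mul]
  ring

theorem card_pairsIn (M : Finset (Fin n)) : (pairsIn M).card = M.card.choose 2 := by
  have h1 : ∑ v, pairDeg (pairsIn M) v = ∑ v ∈ M, pairDeg (pairsIn M) v := by
    refine (Finset.sum_subset (Finset.subset_univ _) fun v _ hv => ?_).symm
    refine Finset.sum_eq_zero fun e he => ?_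
    obtain ⟨h1, h2, -⟩ := mem_pairsIn.1 he
    have h3 : e.1 ≠ v := fun h => hv (h ▸ h1)
    have h4 : e.2 ≠ v := fun h => hv (h ▸ h2)
    rw [if_neg h3, if_neg h4, add_zero]
  rw [sum_pairDeg, Finset.sum_congr rfl fun v hv => pairDeg_pairsIn hv, Finset.sum_const,
    nsmul_eq_mul] at h1
  have h2 : ((pairsIn M).card : ℝ) = (M.card.choose 2 : ℕ) := by
    rw [Nat.cast_choose_two]
    linarith
  exact_mod_cast h2

theorem natCard_neighborSet (H : SimpleGraph (Fin n)) (v : Fin n) :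
    Nat.card (H.neighborSet v) = H.degree v := by
  rw [Nat.card_eq_fintype_card, SimpleGraph.card_neighborSet_eq_degree]

theorem forall_natCard_neighborSet_iff {H : SimpleGraph (Fin n)} {d : Fin n → ℕ} :
    (∀ v, Nat.card (H.neighborSet v) = d v) ↔ ∀ v, ∑ w, adjInd H v w = (d v : ℝ) := by
  refine forall_congr' fun v => ?_
  rw [natCard_neighborSet, sum_adjInd_eq_degree, Nat.cast_inj]

theorem xDeg_eq_sum (X : SimpleGraph (Fin n)) (v : Fin n) :
    (xDeg X v : ℝ) = ∑ w, adjInd X v w := by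
  rw [xDeg, natCard_neighborSet, sum_adjInd_eq_degree]

theorem gCount_bot_eq_sum (M : Finset (Fin n)) (d : Fin n → ℕ) :
    gCount d ⊥ = ∑ S ∈ (pairsIn M).powerset, (extFamily M (fun v => (d v : ℝ)) S).card := by
  have h1 : gCount d ⊥ = (Finset.univ.filter fun H : SimpleGraph (Fin n) =>
      ∀ v, ∑ w, adjInd H v w = (d v : ℝ)).card := by
    rw [gCount, Nat.card_eq_fintype_card, Fintype.card_subtype]
    congr 1
    ext H
    simp only [Finset.mem_filter, Finset.mem_univ, true_and, SimpleGraph.edgeSet_bot,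
      Set.disjoint_empty, and_true, forall_natCard_neighborSet_iff]
  rw [h1, Finset.card_eq_sum_card_fiberwise (f := trace M) (t := (pairsIn M).powerset)]
  · simp only [extFamily, Finset.filter_filter]
  · intro H _
    exact Finset.mem_coe.2 (Finset.mem_powerset.2 (Finset.filter_subset _ _))

theorem trace_eq_trace_iff {M : Finset (Fin n)} {H X : SimpleGraph (Fin n)} :
    trace M H = trace M X ↔ ∀ j ∈ M, ∀ k ∈ M, (H.Adj j k ↔ X.Adj j k) := by
  simp only [trace, Finset.filter_inj']
  refine ⟨fun h j hj k hk => ?_, fun h e he => ?_⟩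
  · rcases lt_trichotomy j k with g | g | g
    · exact h (a := (j, k)) (mem_pairsIn.2 ⟨hj, hk, g⟩)
    · simp [g]
    · rw [H.adj_comm, X.adj_comm]
      exact h (a := (k, j)) (mem_pairsIn.2 ⟨hk, hj, g⟩)
  · obtain ⟨h1, h2, -⟩ := mem_pairsIn.1 he
    exact h _ h1 _ h2

/-- The first `m` vertices. -/
def firstVertices (n m : ℕ) : Finset (Fin n) := Finset.univ.filter fun j => (j : ℕ) < m

theorem mem_firstVertices {m : ℕ} {j : Fin n} : j ∈ firstVertices n m ↔ (j : ℕ) < m := by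
  simp [firstVertices]

theorem card_firstVertices {m : ℕ} (hm : m ≤ n) : (firstVertices n m).card = m := by
  rw [firstVertices, Fin.card_filter_val_lt, min_eq_right hm]

theorem gInd_eq_card (d : Fin n → ℕ) (X : SimpleGraph (Fin n)) (m : ℕ) :
    gInd d X m = (extFamily (firstVertices n m) (fun v => (d v : ℝ))
      (trace (firstVertices n m) X)).card := by
  rw [gInd, Nat.card_eq_fintype_card, Fintype.card_subtype]
  congr 1
  ext H
  simp only [extFamily, Finset.mem_filter, Finset.mem_univ, true_and,
    forall_natCard_neighborSet_iff, trace_eq_trace_iff, mem_firstVertices]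
  refine and_congr_right fun _ => ⟨fun h j hj k hk => h j k hj hk, fun h j k hj hk => h j hj k hk⟩

variable {X : SimpleGraph (Fin n)} {m : ℕ}

theorem pairGraph_trace (hX : ∀ j : Fin n, m ≤ (j : ℕ) → xDeg X j = 0) :
    pairGraph (trace (firstVertices n m) X) = X := by
  have h1 : ∀ {j k : Fin n}, X.Adj j k → (j : ℕ) < m := by
    intro j k h
    by_contra hj
    have h2 := hX j (not_lt.1 hj)
    rw [xDeg, natCard_neighborSet] at h2
    exact h.degree_pos_left.ne' h2
  ext j k
  simp only [pairGraph, trace, Finset.mem_filter, mem_pairsIn, mem_firstVertices]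
  refine ⟨?_, fun h => ?_⟩
  · rintro (h | h)
    · exact h.2.2
    · exact h.2.2.symm
  · rcases lt_or_gt_of_ne h.ne with g | g
    · exact Or.inl ⟨g, ⟨h1 h, h1 h.symm, g⟩, h⟩
    · exact Or.inr ⟨g, ⟨h1 h.symm, h1 h, g⟩, h.symm⟩

theorem pairDeg_trace (hX : ∀ j : Fin n, m ≤ (j : ℕ) → xDeg X j = 0) (j : Fin n) :
    pairDeg (trace (firstVertices n m) X) j = xDeg X j := by
  have h : trace (firstVertices n m) X ⊆ pairsIn (firstVertices n m) := Finset.filter_subset _ _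
  rw [xDeg_eq_sum, ← sum_adjInd_pairGraph h, pairGraph_trace hX]

theorem xEdges_eq_card (hX : ∀ j : Fin n, m ≤ (j : ℕ) → xDeg X j = 0) :
    xEdges X = (trace (firstVertices n m) X).card := by
  have h1 := sum_pairDeg (trace (firstVertices n m) X)
  simp only [pairDeg_trace hX, xDeg, natCard_neighborSet] at h1
  have h2 := X.sum_degrees_eq_twice_card_edges
  rw [xEdges, Nat.card_eq_fintype_card, ← SimpleGraph.edgeFinset_card]
  have h3 : ∑ v, X.degree v = 2 * (trace (firstVertices n m) X).card := by exact_mod_cast h1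
  omega

theorem devExponent_trace (hX : ∀ j : Fin n, m ≤ (j : ℕ) → xDeg X j = 0) (hm : m ≤ n)
    (d : Fin n → ℕ) (l B : ℝ) (hl : l = lamb d) {δ : Fin n → ℝ}
    (hδ : ∀ v, δ v = d v - dBar d) :
    devExponent (firstVertices n m) δ l B (trace (firstVertices n m) X) =
      omegaPar d X m 1 1 / (2 * B) - omegaPar d X m 0 2 / (4 * B) := by
  simp only [devExponent, omegaPar, pairDeg_trace hX, card_firstVertices hm, pow_one, pow_zero,
    one_mul, hδ, hl]
  simp only [firstVertices, Finset.sum_filter]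

end Bridge

section InducedProbability

variable {n : ℕ} {d : Fin n → ℕ} {X : SimpleGraph (Fin n)} {m : ℕ}

theorem lamb_mul (hn : 4 ≤ n) : lamb d * ((n : ℝ) - 1) = dBar d := by
  have : (4 : ℝ) ≤ n := by exact_mod_cast hn
  rw [lamb, div_mul_cancel₀]
  linarith

/-- A quantitative form of the probability of an induced subgraph. -/
theorem abs_log_gInd_sub_le {φ R : ℝ} (hn : 4 ≤ n) (hm : m ≤ n) (heven : Even (∑ j, d j))
    (hX : ∀ j : Fin n, m ≤ (j : ℕ) → xDeg X j = 0) (hR : 1 ≤ R)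
    (hA₁ : Admissible n (dBar d) (R + 2)) (hA₂ : Admissible (n - m + 2) (dBar d) R)
    (hd : ∀ v, |(d v : ℝ) - dBar d| + m ≤ R) (hl0 : 0 < lamb d) (hl1 : lamb d < 1)
    (hφ : 1000000 * φ ≤ 1) (hmφ : (m : ℝ) ^ 2 ≤ φ * (aPar d * n))
    (hdφ : ∀ j : Fin n, (j : ℕ) < m → (m : ℝ) * (m + |(d j : ℝ) - dBar d|) ≤ φ * (aPar d * n)) :
    0 < gInd d X m ∧ 0 < gCount d ⊥ ∧ xEdges X ≤ m.choose 2 ∧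
    |Real.log (gInd d X m) - Real.log (gCount d ⊥) - (xEdges X * Real.log (lamb d) +
        (m.choose 2 - xEdges X) * Real.log (1 - lamb d)) -
      (omegaPar d X m 1 1 / (2 * aPar d * n) - omegaPar d X m 0 2 / (4 * aPar d * n))| ≤
        28 * φ := by
  have hn0 : (4 : ℝ) ≤ n := by exact_mod_cast hn
  have hB : 0 < aPar d * n := by
    have : 0 < aPar d := by rw [aPar]; nlinarith
    positivity
  have hφ0 : 0 ≤ φ := by
    by_contra h
    nlinarith [sq_nonneg (m : ℝ)]
  have hMc := card_firstVertices hm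
  have hTP : trace (firstVertices n m) X ⊆ pairsIn (firstVertices n m) := Finset.filter_subset _ _
  have hM2 : (pairsIn (firstVertices n m)).card = m.choose 2 := by rw [card_pairsIn, hMc]
  have hadm : Admissible (restCard (firstVertices n m)) (dBar d) R := by
    rwa [restCard, hMc, Fintype.card_fin]
  have hdc : ∀ v, |(d v : ℝ) - dBar d| + (firstVertices n m).card ≤ R := by rwa [hMc]
  have hex := exists_graph_of_admissible hn hR hA₁ (fun v => by
    have := hd v
    have h0 : (0 : ℝ) ≤ m := Nat.cast_nonneg m
    linarith) heven
  have hpos : ∀ S ⊆ pairsIn (firstVertices n m),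
      0 < (extFamily (firstVertices n m) (fun v => (d v : ℝ)) S).card := fun S hS =>
    (extFamily_nonempty_of_exists hadm hdc hex hS).card_pos
  rw [gInd_eq_card, gCount_bot_eq_sum (firstVertices n m), xEdges_eq_card hX, ← hM2]
  refine ⟨hpos _ hTP, Finset.sum_pos (fun S hS => hpos S (Finset.mem_powerset.1 hS)) ⟨∅, by simp⟩,
    Finset.card_le_card hTP, ?_⟩
  have hdev := devExponent_trace hX hm d (lamb d) (aPar d * n) rfl
    (δ := fun v => (d v : ℝ) - lamb d * (n - 1)) fun v => by rw [lamb_mul hn]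
  rw [mul_assoc, mul_assoc, ← hdev, Nat.cast_sum]
  rcases (firstVertices n m).eq_empty_or_nonempty with hM | hM
  · simp only [hM, pairsIn, trace, devExponent]
    simpa using hφ0
  · have := abs_log_card_extFamily_sub_log_sum_le (κ := φ * (aPar d * n)) hadm hdc hex hl0 hl1
      rfl (by rw [lamb_mul hn, dBar]; field_simp) (by rwa [hMc])
      (by rw [← aPar]; nlinarith) (fun v hv => by
        rw [hMc, lamb_mul hn]
        refine le_trans ?_ (hdφ v (mem_firstVertices.1 hv))
        exact mul_le_mul_of_nonneg_left (by linarith [(Nat.cast_nonneg m : (0 : ℝ) ≤ m)])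
          (Nat.cast_nonneg m)) hTP hM
    rw [← aPar] at this
    rwa [← mul_assoc, mul_div_cancel_right₀ _ hB.ne'] at this

end InducedProbability

section Growth

theorem eventually_growth (C a : ℝ) (ha : 0 < a) :
    ∀ᶠ n : ℕ in atTop, 4 ≤ n ∧ (10 : ℝ) ^ 700 ≤ n ∧
      C * (n : ℝ) ^ ((1 : ℝ) / 2 + 1 / 1000) + 2 * (n : ℝ) ^ ((1 : ℝ) / 2) + 20 ≤
        (n : ℝ) ^ ((51 : ℝ) / 100) / 4 ∧
      4 * (n : ℝ) ^ ((99 : ℝ) / 100) ≤ n / (3 * a * Real.log n) := by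
  have hc : Tendsto (fun n : ℕ => (n : ℝ)) atTop atTop := tendsto_natCast_atTop_atTop
  have h1 : ∀ s : ℝ, 0 < s → Tendsto (fun n : ℕ => (n : ℝ) ^ (-s)) atTop (𝓝 0) := fun s hs =>
    (tendsto_rpow_neg_atTop hs).comp hc
  have h2 : Tendsto (fun n : ℕ => C * (n : ℝ) ^ (-(9 / 1000 : ℝ)) + 2 * (n : ℝ) ^ (-(1 / 100 : ℝ)) +
      20 * (n : ℝ) ^ (-(51 / 100 : ℝ))) atTop (𝓝 0) := by
    simpa using (((h1 (9 / 1000) (by norm_num)).const_mul C).add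
      ((h1 (1 / 100) (by norm_num)).const_mul 2)).add ((h1 (51 / 100) (by norm_num)).const_mul 20)
  have h3 := ((isLittleO_log_rpow_atTop (r := 1 / 100) (by norm_num)).bound
    (c := 1 / (12 * a)) (by positivity))
  filter_upwards [eventually_ge_atTop 4, hc.eventually_ge_atTop ((10 : ℝ) ^ 700),
    h2.eventually_le_const (show (0 : ℝ) < 1 / 4 by norm_num), hc.eventually h3] with n g1 g2 g3 g4
  have hn : (4 : ℝ) ≤ n := by exact_mod_cast g1
  refine ⟨g1, g2, ?_, ?_⟩ <;> clear g2 <;> have hn0 : (0 : ℝ) < n := by linarith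
  · have h4 : 0 < (n : ℝ) ^ ((51 : ℝ) / 100) := Real.rpow_pos_of_pos hn0 _
    have h5 := mul_le_mul_of_nonneg_right g3 h4.le
    rw [add_mul, add_mul, mul_assoc, mul_assoc, mul_assoc, ← Real.rpow_add hn0,
      ← Real.rpow_add hn0, ← Real.rpow_add hn0] at h5
    norm_num at h5 ⊢
    linarith
  · have h4 : 0 < Real.log n := Real.log_pos (by linarith)
    rw [Real.norm_of_nonneg h4.le, Real.norm_of_nonneg (Real.rpow_nonneg hn0.le _), one_div,
      inv_mul_eq_div, le_div_iff₀ (by positivity)] at g4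
    rw [le_div_iff₀ (by positivity)]
    calc _ = (n : ℝ) ^ ((99 : ℝ) / 100) * (Real.log n * (12 * a)) := by ring
      _ ≤ (n : ℝ) ^ ((99 : ℝ) / 100) * (n : ℝ) ^ ((1 : ℝ) / 100) := by gcongr
      _ = n := by rw [← Real.rpow_add hn0]; norm_num

theorem admissible_of_growth {n N c R : ℝ} (hn : (10 : ℝ) ^ 700 ≤ n) (h1 : n / 2 ≤ N)
    (h2 : N ≤ 2 * n) (hR : R ≤ n ^ ((51 : ℝ) / 100) / 4)
    (hc : 2 * n ^ ((99 : ℝ) / 100) + R ≤ c) (hc' : 2 * n ^ ((99 : ℝ) / 100) + R ≤ N - c) :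
    Admissible N c R := by
  have hn0 : 0 < n := lt_of_lt_of_le (by positivity) hn
  have hN0 : 0 < N := lt_of_lt_of_le (half_pos hn0) h1
  have hpow : ∀ k : ℕ, (N ^ ((1 : ℝ) / 100)) ^ k = N ^ ((k : ℝ) / 100) := fun k => by
    rw [← Real.rpow_natCast, ← Real.rpow_mul hN0.le]; congr 1; ring
  have h100 : (N ^ ((1 : ℝ) / 100)) ^ 100 = N := by rw [hpow]; norm_num
  have h99 : (N ^ ((1 : ℝ) / 100)) ^ 99 ≤ 2 * n ^ ((99 : ℝ) / 100) := by
    rw [hpow]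
    calc N ^ (((99 : ℕ) : ℝ) / 100) ≤ (2 * n) ^ (((99 : ℕ) : ℝ) / 100) :=
          Real.rpow_le_rpow hN0.le h2 (by norm_num)
      _ = 2 ^ ((99 : ℝ) / 100) * n ^ ((99 : ℝ) / 100) := by
          rw [Real.mul_rpow (by norm_num) hn0.le]; norm_num
      _ ≤ 2 ^ (1 : ℝ) * n ^ ((99 : ℝ) / 100) := by
          refine mul_le_mul_of_nonneg_right ?_ (Real.rpow_nonneg hn0.le _)
          exact Real.rpow_le_rpow_of_exponent_le (by norm_num) (by norm_num)
      _ = 2 * n ^ ((99 : ℝ) / 100) := by rw [Real.rpow_one]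
  have h51 : n ^ ((51 : ℝ) / 100) / 2 ≤ (N ^ ((1 : ℝ) / 100)) ^ 51 := by
    rw [hpow]
    calc n ^ ((51 : ℝ) / 100) / 2 ≤ n ^ ((51 : ℝ) / 100) / 2 ^ ((51 : ℝ) / 100) := by
          refine div_le_div_of_nonneg_left (Real.rpow_nonneg hn0.le _)
            (Real.rpow_pos_of_pos (by norm_num) _) ?_
          calc (2 : ℝ) ^ ((51 : ℝ) / 100) ≤ 2 ^ (1 : ℝ) :=
                Real.rpow_le_rpow_of_exponent_le (by norm_num) (by norm_num)
            _ = 2 := Real.rpow_one 2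
      _ = (n / 2) ^ (((51 : ℕ) : ℝ) / 100) := by
          rw [Real.div_rpow hn0.le (by norm_num)]; norm_num
      _ ≤ N ^ (((51 : ℕ) : ℝ) / 100) := Real.rpow_le_rpow (by positivity) h1 (by norm_num)
  refine ⟨N ^ ((1 : ℝ) / 100), ?_, h100.symm, by linarith, by linarith, by rw [h100]; linarith⟩
  refine le_of_pow_le_pow_left₀ (n := 100) (by norm_num) (Real.rpow_nonneg hN0.le _) ?_
  rw [h100]
  have : (1000000 : ℝ) ^ 100 ≤ 10 ^ 700 / 2 := by
    rw [show (1000000 : ℝ) = 10 ^ 6 by norm_num, ← pow_mul, le_div_iff₀ (by norm_num)]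
    calc (10 : ℝ) ^ (6 * 100) * 2 ≤ 10 ^ (6 * 100) * 10 ^ 100 := by
          refine mul_le_mul_of_nonneg_left ?_ (by positivity)
          exact (by norm_num : (2 : ℝ) ≤ 10 ^ 1).trans
            (pow_le_pow_right₀ (by norm_num) (by norm_num))
      _ = 10 ^ 700 := by rw [← pow_add]
  exact this.trans ((div_le_div_of_nonneg_right hn zero_le_two).trans h1)

end Growth

/-- Corollary 2.5: if moreover `m(m + max_{j≤m}|d_j-d̄|) = o(An)`, the induced
subgraph probability simplifies to
`λ^X (1-λ)^{C(m,2)-X} exp(ω₁₁/(2An) - ω₀₂/(4An) + o(1))`. -/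
theorem stmt8 (a b : ℝ) (ha : 0 < a) (hb : 0 < b) (hab : a + b < 1/2) :
    ∃ ε : ℝ, 0 < ε ∧
      ∀ (d : (n : ℕ) → Fin n → ℕ) (X : (n : ℕ) → SimpleGraph (Fin n)) (m : ℕ → ℕ),
        (∀ n, Even (∑ j, d n j)) →
        (∃ C : ℝ, ∀ (n : ℕ) (j : Fin n),
            |(d n j : ℝ) - dBar (d n)| ≤ C * (n : ℝ) ^ ((1:ℝ)/2 + ε)) →
        (∃ C : ℝ, ∀ (n : ℕ) (j : Fin n),
            (xDeg (X n) j : ℝ) ≤ C * (n : ℝ) ^ ((1:ℝ)/2 + ε)) →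
        (∃ C : ℝ, ∀ n : ℕ, (xEdges (X n) : ℝ) ≤ C * (n : ℝ) ^ ((1:ℝ) + 2*ε)) →
        (∀ᶠ n : ℕ in atTop,
            (n : ℝ) / (3 * a * Real.log n) ≤ min (dBar (d n)) ((n : ℝ) - dBar (d n) - 1)) →
        (∀ n, m n ≤ n) →
        (∃ φ : ℕ → ℝ, Tendsto φ atTop (nhds 0) ∧
          (∀ n : ℕ, (m n : ℝ)^2 ≤ φ n * (aPar (d n) * (n : ℝ))) ∧
          ∀ (n : ℕ) (j : Fin n), (j : ℕ) < m n →
            (m n : ℝ) * ((m n : ℝ) + |(d n j : ℝ) - dBar (d n)|)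
              ≤ φ n * (aPar (d n) * (n : ℝ))) →
        (∀ (n : ℕ) (j : Fin n), m n ≤ (j : ℕ) → xDeg (X n) j = 0) →
        ∃ err : ℕ → ℝ, Tendsto err atTop (nhds 0) ∧
          ∀ᶠ n : ℕ in atTop,
            (gInd (d n) (X n) (m n) : ℝ) / (gCount (d n) ⊥ : ℝ)
              = lamb (d n) ^ xEdges (X n)
                * (1 - lamb (d n)) ^ ((m n).choose 2 - xEdges (X n))
                * Real.exp (
                    omegaPar (d n) (X n) (m n) 1 1 / (2 * aPar (d n) * (n : ℝ))
                  - omegaPar (d n) (X n) (m n) 0 2 / (4 * aPar (d n) * (n : ℝ))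
                  + err n) := by
  refine ⟨1 / 1000, by norm_num, ?_⟩
  rintro d X m heven ⟨C, hC⟩ - - hden hmn ⟨φ, hφ, hmφ, hdφ⟩ hX
  have key : ∀ᶠ n : ℕ in atTop, 0 < lamb (d n) ∧ lamb (d n) < 1 ∧ 0 < gInd (d n) (X n) (m n) ∧
      0 < gCount (d n) ⊥ ∧ xEdges (X n) ≤ (m n).choose 2 ∧
      |Real.log (gInd (d n) (X n) (m n)) - Real.log (gCount (d n) ⊥) -
        (xEdges (X n) * Real.log (lamb (d n)) +
          ((m n).choose 2 - xEdges (X n)) * Real.log (1 - lamb (d n))) -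
        (omegaPar (d n) (X n) (m n) 1 1 / (2 * aPar (d n) * n) -
          omegaPar (d n) (X n) (m n) 0 2 / (4 * aPar (d n) * n))| ≤ 28 * φ n := by
    filter_upwards [eventually_growth |C| a ha, hden,
      hφ.eventually_le_const (show (0 : ℝ) < 1 / 1000000 by norm_num)] with n g1 g2 g3
    obtain ⟨hn, hbig, hgrow, hlog⟩ := g1
    have hn4 : (4 : ℝ) ≤ n := by exact_mod_cast hn
    have hn0 : (0 : ℝ) < n := lt_of_lt_of_le (by norm_num) hn4
    have hn1 : (1 : ℝ) ≤ n := le_trans (by norm_num) hn4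
    obtain ⟨hc, hc'⟩ := le_min_iff.1 g2
    have p51 : (n : ℝ) ^ ((51 : ℝ) / 100) ≤ (n : ℝ) ^ ((99 : ℝ) / 100) :=
      Real.rpow_le_rpow_of_exponent_le hn1 (by norm_num)
    have p99 : (n : ℝ) ^ ((99 : ℝ) / 100) ≤ n := by
      simpa using Real.rpow_le_rpow_of_exponent_le hn1 (by norm_num : (99 : ℝ) / 100 ≤ 1)
    have p1 : 1 ≤ (n : ℝ) ^ ((99 : ℝ) / 100) := Real.one_le_rpow hn1 (by norm_num)
    have pC : 0 ≤ |C| * (n : ℝ) ^ ((1 : ℝ) / 2 + 1 / 1000) :=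
      mul_nonneg (abs_nonneg _) (Real.rpow_nonneg hn0.le _)
    have hd : ∀ v, |(d n v : ℝ) - dBar (d n)| ≤ |C| * (n : ℝ) ^ ((1 : ℝ) / 2 + 1 / 1000) :=
      fun v => (hC n v).trans
        (mul_le_mul_of_nonneg_right (le_abs_self C) (Real.rpow_nonneg hn0.le _))
    have hs0 : 0 ≤ (n : ℝ) ^ ((1 : ℝ) / 2) := Real.rpow_nonneg hn0.le _
    have hs2 : ((n : ℝ) ^ ((1 : ℝ) / 2)) ^ 2 = n := by
      rw [← Real.rpow_natCast, ← Real.rpow_mul hn0.le]; norm_num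
    generalize (n : ℝ) ^ ((1 : ℝ) / 2 + 1 / 1000) = t at *
    have hl0 : 0 < lamb (d n) := by
      clear hbig
      rw [lamb]
      exact div_pos (by linarith) (by linarith)
    have hl1 : lamb (d n) < 1 := by
      clear hbig
      rw [lamb, div_lt_one (by linarith)]
      linarith
    have hm : (m n : ℝ) ≤ (n : ℝ) ^ ((1 : ℝ) / 2) := by
      clear hbig
      refine le_of_pow_le_pow_left₀ two_ne_zero hs0 ((hmφ n).trans ?_)
      rw [hs2]
      have h1 : 0 ≤ aPar (d n) := by rw [aPar]; nlinarith
      have h2 : aPar (d n) ≤ 1 := by rw [aPar]; nlinarith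
      have h3 : φ n * aPar (d n) ≤ 1 := by nlinarith
      nlinarith
    have hm0 : (0 : ℝ) ≤ m n := Nat.cast_nonneg _
    have hb2 : (n : ℝ) / 2 ≤ n - m n + 2 := by clear hbig; linarith
    have hb3 : (n : ℝ) - m n + 2 ≤ 2 * n := by clear hbig; linarith
    refine ⟨hl0, hl1, abs_log_gInd_sub_le (R := |C| * t + (n : ℝ) ^ ((1 : ℝ) / 2) + 10) hn (hmn n)
      (heven n) (hX n) ?_ (admissible_of_growth hbig ?_ ?_ ?_ ?_ ?_)
      (admissible_of_growth hbig hb2 hb3 ?_ ?_ ?_) (fun v => ?_) hl0 hl1 ?_ (hmφ n) (hdφ n)⟩ <;>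
      clear hbig
    on_goal 10 => have := hd v
    all_goals linarith
  refine ⟨fun n => Real.log (gInd (d n) (X n) (m n)) - Real.log (gCount (d n) ⊥) -
        (xEdges (X n) * Real.log (lamb (d n)) +
          ((m n).choose 2 - xEdges (X n)) * Real.log (1 - lamb (d n))) -
        (omegaPar (d n) (X n) (m n) 1 1 / (2 * aPar (d n) * n) -
          omegaPar (d n) (X n) (m n) 0 2 / (4 * aPar (d n) * n)), ?_, ?_⟩
  · refine squeeze_zero_norm' (a := fun n => 28 * φ n) ?_ (by simpa using hφ.const_mul 28)
    filter_upwards [key] with n hn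
    exact hn.2.2.2.2.2
  · filter_upwards [key] with n hn
    obtain ⟨hl0, hl1, hI, hG, hXe, -⟩ := hn
    have hI' : (0 : ℝ) < gInd (d n) (X n) (m n) := Nat.cast_pos.2 hI
    have hG' : (0 : ℝ) < gCount (d n) ⊥ := Nat.cast_pos.2 hG
    have e1 : lamb (d n) ^ xEdges (X n) * (1 - lamb (d n)) ^ ((m n).choose 2 - xEdges (X n)) =
        Real.exp (xEdges (X n) * Real.log (lamb (d n)) +
          ((m n).choose 2 - xEdges (X n)) * Real.log (1 - lamb (d n))) := by
      rw [← Nat.cast_sub hXe, Real.exp_add, Real.exp_nat_mul, Real.exp_nat_mul,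
        Real.exp_log hl0, Real.exp_log (sub_pos.2 hl1)]
    rw [e1, ← Real.exp_add, ← Real.exp_log (div_pos hI' hG'), Real.log_div hI'.ne' hG'.ne']
    congr 1
    ring
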